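/- Let A be an n-dimensional algebra with G(A) = 1. (1) If n = 2, then lev(A) = 2 iff A is represented by E_4. (2) If n = 3, then lev(A) = 2 iff A is represented by one of: T_0^{2,(α,β)} for some (α,β) ∈ k²∖{(0,0)}; T_1^{2,(α,β)} for some (α,β) ∈ k²; or k^{n−2}⋊E_4 (with n = 3). (3) If n = 4, then lev(A) = 2 iff A is represented by one of: T_0^{2,(α,β)} for some (α,β) ∈ k²∖{(0,0)}; T_1^{2,(α,β)} for some (α,β) ∈ k²; T_0^3; or k^{n−2}⋊E_4 (with n = 4). (4) If n ≥ 5, then lev(A) = 2 iff A is represented by one of: T_0^{2,(α,β)} for some (α,β) ∈ k²∖{(0,0)}; T_1^{2,(α,β)} for some (α,β) ∈ k²; T_0^{2,2}; k^{n−2}⋊E_4; or η_2 ⊕ k^{n−5}. -/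

import Mathlib

open scoped BigOperators

noncomputable section

/-- The space of `n`-dimensional (nonassociative) algebra structures on `kⁿ`:
bilinear maps `kⁿ × kⁿ → kⁿ`. -/
abbrev AlgStr (k : Type*) [Field k] (n : ℕ) : Type _ :=
  (Fin n → k) →ₗ[k] (Fin n → k) →ₗ[k] (Fin n → k)

variable {k : Type*} [Field k]

/-- The algebra structure with prescribed structure constants `c`:
`μ(x, y) m = ∑ i, ∑ j, x i * y j * c i j m`. -/
def ofConst {n : ℕ} (c : Fin n → Fin n → Fin n → k) : AlgStr k n :=
  ∑ i, ∑ j,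
    ((LinearMap.mul k k).compl₁₂ (LinearMap.proj i) (LinearMap.proj j)).compr₂
      (LinearMap.toSpanSingleton k (Fin n → k) (c i j))

/-- The structure constants of an algebra structure in the standard basis. -/
def structConst {n : ℕ} (μ : AlgStr k n) : Fin n × Fin n × Fin n → k :=
  fun t => μ (Pi.single t.1 1) (Pi.single t.2.1 1) t.2.2

/-- A subset of `AlgStr k n` is Zariski closed if it is the common zero locus of a
family of polynomials in the structure constants. -/
def IsZariskiClosed {n : ℕ} (S : Set (AlgStr k n)) : Prop :=
  ∃ P : Set (MvPolynomial (Fin n × Fin n × Fin n) k),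
    ∀ μ : AlgStr k n, μ ∈ S ↔ ∀ p ∈ P, MvPolynomial.eval (structConst μ) p = 0

/-- The action of `GL(V)` on algebra structures: `(g • μ)(x,y) = g (μ (g⁻¹ x) (g⁻¹ y))`. -/
def transport {n : ℕ} (g : (Fin n → k) ≃ₗ[k] (Fin n → k)) (μ : AlgStr k n) :
    AlgStr k n :=
  ((μ.comp g.symm.toLinearMap).compl₂ g.symm.toLinearMap).compr₂ g.toLinearMap

/-- The `GL(V)`-orbit of an algebra structure; two structures represent isomorphic
algebras iff they lie in the same orbit. -/
def orbit {n : ℕ} (μ : AlgStr k n) : Set (AlgStr k n) :=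
  {χ | ∃ g : (Fin n → k) ≃ₗ[k] (Fin n → k), transport g μ = χ}

/-- The Zariski closure of a set of algebra structures. -/
def zclosure {n : ℕ} (S : Set (AlgStr k n)) : Set (AlgStr k n) :=
  {χ | ∀ T : Set (AlgStr k n), IsZariskiClosed T → S ⊆ T → χ ∈ T}

/-- `μ` degenerates to `χ` if `χ` lies in the Zariski closure of the orbit of `μ`. -/
def degenerates {n : ℕ} (μ χ : AlgStr k n) : Prop :=
  χ ∈ zclosure (orbit μ)

/-- A proper degeneration: additionally `χ` is not isomorphic to `μ`. -/
def properlyDegenerates {n : ℕ} (μ χ : AlgStr k n) : Prop :=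
  degenerates μ χ ∧ χ ∉ orbit μ

/-- There is a chain of `m` proper degenerations starting at `μ`. -/
def hasChain {n : ℕ} (μ : AlgStr k n) (m : ℕ) : Prop :=
  ∃ c : ℕ → AlgStr k n, c m = μ ∧ ∀ i < m, properlyDegenerates (c (i + 1)) (c i)

/-- The level of `μ` is `m`: there is a chain of `m` proper degenerations starting
at `μ` but no chain of `m+1`. -/
def levelIs {n : ℕ} (μ : AlgStr k n) (m : ℕ) : Prop :=
  hasChain μ m ∧ ¬ hasChain μ (m + 1)

/-- The subalgebra generated by a set `s`. -/
def subalgGen {n : ℕ} (μ : AlgStr k n) (s : Set (Fin n → k)) :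
    Submodule k (Fin n → k) :=
  sInf {W | s ⊆ W ∧ ∀ x ∈ W, ∀ y ∈ W, μ x y ∈ W}

/-- The generation type of `μ` is `m`: `m` is the maximal dimension of a
one-generated subalgebra. -/
def genType {n : ℕ} (μ : AlgStr k n) (m : ℕ) : Prop :=
  IsGreatest {d : ℕ | ∃ a : Fin n → k, Module.finrank k ↥(subalgGen μ {a}) = d} m

/-- A standard `1`-generated algebra: it admits a grading `A = ⊕_{i ≥ 1} A_i` with
`dim A_1 = 1`, `A_i A_j ⊆ A_{i+j}`, generated by `A_1` as an algebra. -/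
def StandardOneGenerated {m : ℕ} (μ : AlgStr k m) : Prop :=
  ∃ A : ℕ → Submodule k (Fin m → k),
    A 0 = ⊥ ∧ DirectSum.IsInternal A ∧ Module.finrank k ↥(A 1) = 1 ∧
    (∀ i j : ℕ, ∀ x ∈ A i, ∀ y ∈ A j, μ x y ∈ A (i + j)) ∧
    subalgGen μ ((A 1 : Submodule k (Fin m → k)) : Set (Fin m → k)) = ⊤

/-- Extension by zero of coordinates, `kᵐ → kⁿ`. -/
def inclMap (k : Type*) [Field k] {m n : ℕ} (h : m ≤ n) :
    (Fin m → k) →ₗ[k] (Fin n → k) where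
  toFun x i := if hi : (i : ℕ) < m then x ⟨i, hi⟩ else 0
  map_add' x y := by funext i; by_cases hi : (i : ℕ) < m <;> simp [hi]
  map_smul' a x := by funext i; by_cases hi : (i : ℕ) < m <;> simp [hi]

/-- The `n`-dimensional algebra `B ⊕ k^{n-m}` obtained from an `m`-dimensional
algebra `B` by adjoining a complement with all products zero. -/
def extendZero {m n : ℕ} (h : m ≤ n) (B : AlgStr k m) : AlgStr k n :=
  ((B.comp (LinearMap.funLeft k k (Fin.castLE h))).compl₂
      (LinearMap.funLeft k k (Fin.castLE h))).compr₂ (inclMap k h)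

/-- The `i`-th standard basis vector (as a plain function, `0` if `i ≥ n`). -/
def unitVec {k : Type*} [Field k] (n i : ℕ) : Fin n → k :=
  fun j => if (j : ℕ) = i then 1 else 0

/-- Projection onto the coordinate `0` part. -/
def proj0 (k : Type*) [Field k] (n : ℕ) : (Fin n → k) →ₗ[k] (Fin n → k) :=
  LinearMap.pi fun i => if (i : ℕ) = 0 then LinearMap.proj i else 0

/-- Projection onto the coordinates `≥ 1` part. -/
def projPos (k : Type*) [Field k] (n : ℕ) : (Fin n → k) →ₗ[k] (Fin n → k) :=
  LinearMap.pi fun i => if (i : ℕ) = 0 then 0 else LinearMap.proj i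

/-- The Inönü–Wigner contraction of `μ` with respect to the `1`-dimensional
subalgebra spanned by the first basis vector (the remaining coordinates form the
square-zero ideal part). -/
def IWcontract0 {n : ℕ} (μ : AlgStr k n) : AlgStr k n :=
  ((μ.comp (projPos k n)).compl₂ (proj0 k n)).compr₂ (projPos k n) +
    ((μ.comp (proj0 k n)).compl₂ (projPos k n)).compr₂ (projPos k n) +
    (μ.comp (proj0 k n)).compl₂ (proj0 k n)

/-- The annihilator of an algebra structure. -/
def annihilator {n : ℕ} (μ : AlgStr k n) : Submodule k (Fin n → k) where
  carrier := {a | ∀ b, μ a b = 0 ∧ μ b a = 0}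
  add_mem' := by
    intro a b ha hb
    intro c
    constructor
    · rw [map_add, LinearMap.add_apply, (ha c).1, (hb c).1, add_zero]
    · rw [map_add, (ha c).2, (hb c).2, add_zero]
  zero_mem' := by
    intro b
    constructor
    · rw [map_zero, LinearMap.zero_apply]
    · rw [map_zero]
  smul_mem' := by
    intro t a ha b
    constructor
    · rw [map_smul, LinearMap.smul_apply, (ha b).1, smul_zero]
    · rw [map_smul, (ha b).2, smul_zero]

/-- `μ` has a square-zero (two-sided) ideal of codimension `1`. -/
def hasSqZeroIdealCodim1 {n : ℕ} (μ : AlgStr k n) : Prop :=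
  ∃ I : Submodule k (Fin n → k), Module.finrank k ↥I = n - 1 ∧
    (∀ x ∈ I, ∀ y : Fin n → k, μ x y ∈ I ∧ μ y x ∈ I) ∧
    ∀ x ∈ I, ∀ y ∈ I, μ x y = 0

/-- `a` (viewed as the sequence of parts `a 0 ≥ a 1 ≥ …`) is a partition of `N`. -/
def IsPartitionOf (a : ℕ → ℕ) (N : ℕ) : Prop :=
  (∀ i j : ℕ, i ≤ j → a j ≤ a i) ∧
    ∃ l : ℕ, (∀ i, l ≤ i → a i = 0) ∧ ∑ i ∈ Finset.range l, a i = N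

/-- The dominance order on partitions: `a ⪰ b`. -/
def Dominates (a b : ℕ → ℕ) : Prop :=
  ∀ m : ℕ, ∑ i ∈ Finset.range m, b i ≤ ∑ i ∈ Finset.range m, a i

/-- `a` is the Jordan type of the matrix `M` at the eigenvalue `lam`:
`a` is a partition of the generalized eigenspace dimension, and the parts of `a`
are the sizes of the Jordan blocks of `M` with eigenvalue `lam`, expressed via
the ranks of powers of `M - lam • 1`. -/
def IsJordanTypeAt {N : ℕ} (M : Matrix (Fin N) (Fin N) k) (lam : k) (a : ℕ → ℕ) :
    Prop :=
  IsPartitionOf a (N - ((M - lam • (1 : Matrix (Fin N) (Fin N) k)) ^ N).rank) ∧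
    ∀ p : ℕ, ((M - lam • (1 : Matrix (Fin N) (Fin N) k)) ^ p).rank =
      N - ∑ i ∈ Finset.range N, min (a i) p

/-- The full specter of `M` is `{(lam i, a i)}`: the `lam i` are pairwise distinct,
each `a i` is the (nonempty) Jordan type of `M` at `lam i`, and every eigenvalue
of `M` occurs among the `lam i`. -/
def IsFullSpecter {N : ℕ} (M : Matrix (Fin N) (Fin N) k) {l : ℕ}
    (lam : Fin l → k) (a : Fin l → ℕ → ℕ) : Prop :=
  Function.Injective lam ∧
    (∀ i, IsJordanTypeAt M (lam i) (a i) ∧ a i 0 ≠ 0) ∧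
    ∀ c : k, (∃ v : Fin N → k, v ≠ 0 ∧ M.mulVec v = c • v) → ∃ i, lam i = c

/-- There is a chain of `len` strict dominance steps of partitions of `N`
starting (on top) at `a`. -/
def partChain (a : ℕ → ℕ) (N len : ℕ) : Prop :=
  ∃ c : ℕ → ℕ → ℕ, (∀ i ≤ len, IsPartitionOf (c i) N) ∧ c len = a ∧
    ∀ i < len, Dominates (c (i + 1)) (c i) ∧ c (i + 1) ≠ c i

/-- The structure `T_α^M ∈ A_{m+1}`. -/
def Tstr {m : ℕ} (α : k) (M : Matrix (Fin m) (Fin m) k) : AlgStr k (m + 1) :=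
  ofConst fun i j mm =>
    if hi : i = 0 then
      if hj : j = 0 then (if mm = 0 then α else 0)
      else if hmm : mm = 0 then 0 else M (mm.pred hmm) (j.pred hj)
    else if hj : j = 0 then
      if hmm : mm = 0 then 0 else (if i = mm then α else 0) - M (mm.pred hmm) (i.pred hi)
    else 0

/-- The trivial singular extension `k^{n-2} ⋊_{(L₁,R₁,L₂,R₂)} χ` of the
`2`-dimensional algebra `χ` given by the coefficients `c11, c12, c21, d12, d21, d22`
(with `χ(e₁,e₁) = c11·e₁ + e₂`, `χ(e₁,e₂) = c12·e₁ + d12·e₂`,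
`χ(e₂,e₁) = c21·e₁ + d21·e₂`, `χ(e₂,e₂) = d22·e₂`). -/
def sdExt {m : ℕ} (c11 c12 c21 d12 d21 d22 : k)
    (L1 R1 L2 R2 : Matrix (Fin m) (Fin m) k) : AlgStr k (m + 2) :=
  ofConst fun i j mm =>
    if hi0 : (i : ℕ) = 0 then
      if hj0 : (j : ℕ) = 0 then
        if (mm : ℕ) = 0 then c11 else if (mm : ℕ) = 1 then 1 else 0
      else if hj1 : (j : ℕ) = 1 then
        if (mm : ℕ) = 0 then c12 else if (mm : ℕ) = 1 then d12 else 0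
      else if hmm : (mm : ℕ) < 2 then 0
      else L1 ⟨(mm : ℕ) - 2, by have := mm.isLt; omega⟩
             ⟨(j : ℕ) - 2, by have := j.isLt; omega⟩
    else if hi1 : (i : ℕ) = 1 then
      if hj0 : (j : ℕ) = 0 then
        if (mm : ℕ) = 0 then c21 else if (mm : ℕ) = 1 then d21 else 0
      else if hj1 : (j : ℕ) = 1 then
        if (mm : ℕ) = 1 then d22 else 0
      else if hmm : (mm : ℕ) < 2 then 0
      else L2 ⟨(mm : ℕ) - 2, by have := mm.isLt; omega⟩
             ⟨(j : ℕ) - 2, by have := j.isLt; omega⟩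
    else
      if hj0 : (j : ℕ) = 0 then
        if hmm : (mm : ℕ) < 2 then 0
        else R1 ⟨(mm : ℕ) - 2, by have := mm.isLt; omega⟩
               ⟨(i : ℕ) - 2, by have := i.isLt; omega⟩
      else if hj1 : (j : ℕ) = 1 then
        if hmm : (mm : ℕ) < 2 then 0
        else R2 ⟨(mm : ℕ) - 2, by have := mm.isLt; omega⟩
               ⟨(i : ℕ) - 2, by have := i.isLt; omega⟩
      else 0

/-! Concrete algebra structures, given by multiplication tables on the standard
basis `e₁, …, eₙ` (0-indexed as `0, …, n-1`); all unspecified products are zero. -/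

/-- `A₃ ⊕ k^{n-2}`: `e₁e₁ = e₂`. -/
def A3str (n : ℕ) : AlgStr k n :=
  ofConst fun i j m => if (i : ℕ) = 0 ∧ (j : ℕ) = 0 ∧ (m : ℕ) = 1 then 1 else 0

/-- `n₃ ⊕ k^{n-3}`: `e₁e₂ = e₃`, `e₂e₁ = -e₃`. -/
def n3str (n : ℕ) : AlgStr k n :=
  ofConst fun i j m =>
    if (i : ℕ) = 0 ∧ (j : ℕ) = 1 ∧ (m : ℕ) = 2 then 1
    else if (i : ℕ) = 1 ∧ (j : ℕ) = 0 ∧ (m : ℕ) = 2 then -1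
    else 0

/-- `p⁻`: `e₁eᵢ = eᵢ`, `eᵢe₁ = -eᵢ` for `i ≥ 2`. -/
def pminusStr (n : ℕ) : AlgStr k n :=
  ofConst fun i j m =>
    if (i : ℕ) = 0 ∧ 1 ≤ (j : ℕ) ∧ m = j then 1
    else if 1 ≤ (i : ℕ) ∧ (j : ℕ) = 0 ∧ m = i then -1
    else 0

/-- `ν^α`: `e₁e₁ = e₁`, `e₁eᵢ = α eᵢ`, `eᵢe₁ = (1-α) eᵢ` for `i ≥ 2`. -/
def nuStr (n : ℕ) (α : k) : AlgStr k n :=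
  ofConst fun i j m =>
    if (i : ℕ) = 0 then
      if (j : ℕ) = 0 then (if (m : ℕ) = 0 then 1 else 0)
      else (if m = j then α else 0)
    else if (j : ℕ) = 0 then (if m = i then 1 - α else 0)
    else 0

/-- `k^{n-2} ⋊ E₄`: `e₁e₁ = e₁`, `e₁e₂ = e₁ + e₂`, `e₂e₂ = e₂`,
`e₁eᵢ = eᵢ`, `eᵢe₂ = eᵢ` for `i ≥ 3`.  (For `n = 2` this is `E₄`.) -/
def kE4str (n : ℕ) : AlgStr k n :=
  ofConst fun i j m =>
    if (i : ℕ) = 0 ∧ (j : ℕ) = 0 then (if (m : ℕ) = 0 then 1 else 0)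
    else if (i : ℕ) = 0 ∧ (j : ℕ) = 1 then (if (m : ℕ) = 0 ∨ (m : ℕ) = 1 then 1 else 0)
    else if (i : ℕ) = 1 ∧ (j : ℕ) = 1 then (if (m : ℕ) = 1 then 1 else 0)
    else if (i : ℕ) = 0 ∧ 2 ≤ (j : ℕ) then (if m = j then 1 else 0)
    else if 2 ≤ (i : ℕ) ∧ (j : ℕ) = 1 then (if m = i then 1 else 0)
    else 0

/-- `T₀^{2,(α,β)}`: `e₁e₂ = αe₂ + e₃`, `e₂e₁ = -αe₂ - e₃`,
`e₁eᵢ = βeᵢ`, `eᵢe₁ = -βeᵢ` for `i ≥ 3`. -/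
def T02str (n : ℕ) (α β : k) : AlgStr k n :=
  ofConst fun i j m =>
    if (i : ℕ) = 0 ∧ (j : ℕ) = 1 then
      (if (m : ℕ) = 1 then α else if (m : ℕ) = 2 then 1 else 0)
    else if (i : ℕ) = 1 ∧ (j : ℕ) = 0 then
      (if (m : ℕ) = 1 then -α else if (m : ℕ) = 2 then -1 else 0)
    else if (i : ℕ) = 0 ∧ 2 ≤ (j : ℕ) then (if m = j then β else 0)
    else if 2 ≤ (i : ℕ) ∧ (j : ℕ) = 0 then (if m = i then -β else 0)
    else 0

/-- `T₁^{2,(α,β)}`: `e₁e₁ = e₁`, `e₁e₂ = αe₂ + e₃`, `e₂e₁ = (1-α)e₂ - e₃`,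
`e₁eᵢ = βeᵢ`, `eᵢe₁ = (1-β)eᵢ` for `i ≥ 3`. -/
def T12str (n : ℕ) (α β : k) : AlgStr k n :=
  ofConst fun i j m =>
    if (i : ℕ) = 0 ∧ (j : ℕ) = 0 then (if (m : ℕ) = 0 then 1 else 0)
    else if (i : ℕ) = 0 ∧ (j : ℕ) = 1 then
      (if (m : ℕ) = 1 then α else if (m : ℕ) = 2 then 1 else 0)
    else if (i : ℕ) = 1 ∧ (j : ℕ) = 0 then
      (if (m : ℕ) = 1 then 1 - α else if (m : ℕ) = 2 then -1 else 0)
    else if (i : ℕ) = 0 ∧ 2 ≤ (j : ℕ) then (if m = j then β else 0)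
    else if 2 ≤ (i : ℕ) ∧ (j : ℕ) = 0 then (if m = i then 1 - β else 0)
    else 0

/-- `T₀³`: `e₁e₂ = e₃`, `e₂e₁ = -e₃`, `e₁e₃ = e₄`, `e₃e₁ = -e₄`. -/
def T03str (n : ℕ) : AlgStr k n :=
  ofConst fun i j m =>
    if (i : ℕ) = 0 ∧ (j : ℕ) = 1 ∧ (m : ℕ) = 2 then 1
    else if (i : ℕ) = 1 ∧ (j : ℕ) = 0 ∧ (m : ℕ) = 2 then -1
    else if (i : ℕ) = 0 ∧ (j : ℕ) = 2 ∧ (m : ℕ) = 3 then 1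
    else if (i : ℕ) = 2 ∧ (j : ℕ) = 0 ∧ (m : ℕ) = 3 then -1
    else 0

/-- `T₀^{2,2}`: `e₁e₂ = e₃`, `e₂e₁ = -e₃`, `e₁e₄ = e₅`, `e₄e₁ = -e₅`. -/
def T022str (n : ℕ) : AlgStr k n :=
  ofConst fun i j m =>
    if (i : ℕ) = 0 ∧ (j : ℕ) = 1 ∧ (m : ℕ) = 2 then 1
    else if (i : ℕ) = 1 ∧ (j : ℕ) = 0 ∧ (m : ℕ) = 2 then -1
    else if (i : ℕ) = 0 ∧ (j : ℕ) = 3 ∧ (m : ℕ) = 4 then 1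
    else if (i : ℕ) = 3 ∧ (j : ℕ) = 0 ∧ (m : ℕ) = 4 then -1
    else 0

/-- `η_l ⊕ k^{n-2l-1}`: `e_{2i-1}e_{2i} = e_{2l+1}`, `e_{2i}e_{2i-1} = -e_{2l+1}`
for `1 ≤ i ≤ l`. -/
def etaStr (n l : ℕ) : AlgStr k n :=
  ofConst fun i j m =>
    if (i : ℕ) % 2 = 0 ∧ (j : ℕ) = (i : ℕ) + 1 ∧ (i : ℕ) < 2 * l ∧ (m : ℕ) = 2 * l then 1
    else if (j : ℕ) % 2 = 0 ∧ (i : ℕ) = (j : ℕ) + 1 ∧ (j : ℕ) < 2 * l ∧ (m : ℕ) = 2 * l then -1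
    else 0

/-- `F^{α,β} ⊕ k^{n-3}`: `e₁e₁ = e₃`, `e₁e₂ = αe₃`, `e₂e₁ = βe₃`. -/
def FabStr (n : ℕ) (α β : k) : AlgStr k n :=
  ofConst fun i j m =>
    if (i : ℕ) = 0 ∧ (j : ℕ) = 0 ∧ (m : ℕ) = 2 then 1
    else if (i : ℕ) = 0 ∧ (j : ℕ) = 1 ∧ (m : ℕ) = 2 then α
    else if (i : ℕ) = 1 ∧ (j : ℕ) = 0 ∧ (m : ℕ) = 2 then β
    else 0

/-- `k^{n-2} ⋊ A₃`: `e₁e₁ = e₂`, `e₁eᵢ = eᵢ`, `eᵢe₁ = -eᵢ` for `i ≥ 3`. -/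
def kA3str (n : ℕ) : AlgStr k n :=
  ofConst fun i j m =>
    if (i : ℕ) = 0 ∧ (j : ℕ) = 0 ∧ (m : ℕ) = 1 then 1
    else if (i : ℕ) = 0 ∧ 2 ≤ (j : ℕ) then (if m = j then 1 else 0)
    else if 2 ≤ (i : ℕ) ∧ (j : ℕ) = 0 then (if m = i then -1 else 0)
    else 0

/-- `k² ⋊_{α,β} A₃ ⊕ k^{n-4}`: `e₁e₁ = e₂`, `e₁e₃ = αe₄`, `e₃e₁ = βe₄`. -/
def k2A3str (n : ℕ) (α β : k) : AlgStr k n :=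
  ofConst fun i j m =>
    if (i : ℕ) = 0 ∧ (j : ℕ) = 0 ∧ (m : ℕ) = 1 then 1
    else if (i : ℕ) = 0 ∧ (j : ℕ) = 2 ∧ (m : ℕ) = 3 then α
    else if (i : ℕ) = 2 ∧ (j : ℕ) = 0 ∧ (m : ℕ) = 3 then β
    else 0

/-- `k^{n-2} ⋊_α A₁^α`: `e₁e₁ = e₁ + e₂`, `e₁eᵢ = αeᵢ`, `eᵢe₁ = (1-α)eᵢ` for `i ≥ 2`. -/
def kA1str (n : ℕ) (α : k) : AlgStr k n :=
  ofConst fun i j m =>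
    if (i : ℕ) = 0 ∧ (j : ℕ) = 0 then (if (m : ℕ) = 0 ∨ (m : ℕ) = 1 then 1 else 0)
    else if (i : ℕ) = 0 then (if m = j then α else 0)
    else if (j : ℕ) = 0 then (if m = i then 1 - α else 0)
    else 0

/-- `k^{n-2} ⋊₁ A₂`: `e₁e₁ = e₂`, `e₁eᵢ = eᵢ`, `eᵢe₁ = -eᵢ` for `i ≥ 2`. -/
def kA2str (n : ℕ) : AlgStr k n :=
  ofConst fun i j m =>
    if (i : ℕ) = 0 ∧ (j : ℕ) = 0 then (if (m : ℕ) = 1 then 1 else 0)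
    else if (i : ℕ) = 0 then (if m = j then 1 else 0)
    else if (j : ℕ) = 0 then (if m = i then -1 else 0)
    else 0

/-- `k^{n-2} ⋊₀ᵗ B₂^α`: `e₁eᵢ = αeᵢ`, `eᵢe₁ = (1-α)eᵢ` for `i ≥ 2`. -/
def ktB2str (n : ℕ) (α : k) : AlgStr k n :=
  ofConst fun i j m =>
    if (i : ℕ) = 0 ∧ 1 ≤ (j : ℕ) then (if m = j then α else 0)
    else if 1 ≤ (i : ℕ) ∧ (j : ℕ) = 0 then (if m = i then 1 - α else 0)
    else 0

/-- `k^{n-2} ⋊₀ᵗ D₂^{α,β}`: `e₁e₁ = e₁`, `e₁eᵢ = αeᵢ`, `eᵢe₁ = βeᵢ` for `i ≥ 2`. -/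
def ktD2str (n : ℕ) (α β : k) : AlgStr k n :=
  ofConst fun i j m =>
    if (i : ℕ) = 0 ∧ (j : ℕ) = 0 then (if (m : ℕ) = 0 then 1 else 0)
    else if (i : ℕ) = 0 then (if m = j then α else 0)
    else if (j : ℕ) = 0 then (if m = i then β else 0)
    else 0

/-! ### Closedness of the projection from a projective space -/

/-- A function of a vector `v` and an algebra structure `χ` which is given by a polynomial,
homogeneous of degree `d` in `v`, in the coordinates of `v` and the structure constants of `χ`. -/
def HomPoly {σ : Type} {n : ℕ} (d : ℕ) (F : (σ → k) → AlgStr k n → k) : Prop :=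
  ∃ Q : MvPolynomial σ (MvPolynomial (Fin n × Fin n × Fin n) k), Q.IsHomogeneous d ∧
    ∀ v χ, F v χ = MvPolynomial.eval v (Q.map (MvPolynomial.eval (structConst χ)))

namespace HomPoly

variable {σ : Type} {n : ℕ} {d e : ℕ} {F G : (σ → k) → AlgStr k n → k}

lemma zero : HomPoly d (fun (_ : σ → k) (_ : AlgStr k n) => 0) :=
  ⟨0, MvPolynomial.isHomogeneous_zero _ _ _, by simp⟩

lemma add (hF : HomPoly d F) (hG : HomPoly d G) : HomPoly d (fun v χ => F v χ + G v χ) := by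
  obtain ⟨P, hP, hP'⟩ := hF
  obtain ⟨Q, hQ, hQ'⟩ := hG
  exact ⟨P + Q, hP.add hQ, fun v χ => by simp [hP', hQ']⟩

lemma mul (hF : HomPoly d F) (hG : HomPoly e G) :
    HomPoly (d + e) (fun v χ => F v χ * G v χ) := by
  obtain ⟨P, hP, hP'⟩ := hF
  obtain ⟨Q, hQ, hQ'⟩ := hG
  exact ⟨P * Q, hP.mul hQ, fun v χ => by simp [hP', hQ']⟩

lemma const (c : k) : HomPoly 0 (fun (_ : σ → k) (_ : AlgStr k n) => c) :=
  ⟨MvPolynomial.C (MvPolynomial.C c), MvPolynomial.isHomogeneous_C _ _, by simp⟩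

lemma const_mul (c : k) (hF : HomPoly d F) : HomPoly d (fun v χ => c * F v χ) := by
  simpa using (const c).mul hF

lemma neg (hF : HomPoly d F) : HomPoly d (fun v χ => - F v χ) := by
  simpa using hF.const_mul (-1)

lemma sub (hF : HomPoly d F) (hG : HomPoly d G) : HomPoly d (fun v χ => F v χ - G v χ) := by
  simpa [sub_eq_add_neg] using hF.add hG.neg

lemma sum {ι : Type*} (s : Finset ι) {F : ι → (σ → k) → AlgStr k n → k}
    (hF : ∀ i, HomPoly d (F i)) : HomPoly d (fun v χ => ∑ i ∈ s, F i v χ) := by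
  classical
  induction s using Finset.induction_on with
  | empty => simpa using zero
  | insert a s ha ih => simpa [Finset.sum_insert ha] using (hF a).add ih

lemma coord (i : σ) : HomPoly 1 (fun v (_ : AlgStr k n) => v i) :=
  ⟨MvPolynomial.X i, MvPolynomial.isHomogeneous_X _ _, by simp⟩

lemma structConst (s : Fin n × Fin n × Fin n) :
    HomPoly 0 (fun (_ : σ → k) (χ : AlgStr k n) => structConst χ s) :=
  ⟨MvPolynomial.C (MvPolynomial.X s), MvPolynomial.isHomogeneous_C _ _, by simp⟩

lemma prod {ι : Type*} (s : Finset ι) {F : ι → (σ → k) → AlgStr k n → k}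
    (hF : ∀ i, HomPoly 0 (F i)) : HomPoly 0 (fun v χ => ∏ i ∈ s, F i v χ) := by
  classical
  induction s using Finset.induction_on with
  | empty => simpa using const 1
  | insert a s ha ih => simpa [Finset.prod_insert ha] using (hF a).mul ih

lemma det {m : ℕ} {F : Fin m → Fin m → (σ → k) → AlgStr k n → k}
    (hF : ∀ i j, HomPoly 0 (F i j)) :
    HomPoly 0 (fun v χ => (Matrix.of fun i j => F i j v χ).det) := by
  simp only [Matrix.det_apply', Matrix.of_apply]
  exact sum _ fun g => (prod _ fun i => hF (g i) i).const_mul _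

lemma smul_eq (hF : HomPoly d F) (c : k) (v : σ → k) (χ : AlgStr k n) :
    F (c • v) χ = c ^ d * F v χ := by
  obtain ⟨Q, hQ, hQ'⟩ := hF
  rw [hQ', hQ', ← smul_eq_mul]
  have := (hQ.map (MvPolynomial.eval (_root_.structConst χ)))
  rw [MvPolynomial.eval_eq, MvPolynomial.eval_eq, smul_eq_mul, Finset.mul_sum]
  refine Finset.sum_congr rfl fun m hm => ?_
  have hd : ∑ i ∈ m.support, m i = d := by
    have h1 := this (MvPolynomial.mem_support_iff.mp hm)
    simpa [Finsupp.weight_apply, Finsupp.sum] using h1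
  simp only [Pi.smul_apply, smul_eq_mul, mul_pow, Finset.prod_mul_distrib,
    Finset.prod_pow_eq_pow_sum, hd]
  ring

end HomPoly

/-- A vector-valued version of `HomPoly`. -/
def HomPolyV {σ : Type} {n : ℕ} (d : ℕ) (F : (σ → k) → AlgStr k n → Fin n → k) : Prop :=
  ∀ i, HomPoly d (fun v χ => F v χ i)

namespace HomPolyV

variable {σ : Type} {n : ℕ} {d e : ℕ} {F G : (σ → k) → AlgStr k n → Fin n → k}

lemma const (x : Fin n → k) : HomPolyV 0 (fun (_ : σ → k) (_ : AlgStr k n) => x) :=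
  fun i => HomPoly.const (x i)

lemma sub (hF : HomPolyV d F) (hG : HomPolyV d G) : HomPolyV d (fun v χ => F v χ - G v χ) :=
  fun i => (hF i).sub (hG i)

lemma add (hF : HomPolyV d F) (hG : HomPolyV d G) : HomPolyV d (fun v χ => F v χ + G v χ) :=
  fun i => (hF i).add (hG i)

lemma smul {f : (σ → k) → AlgStr k n → k} (hf : HomPoly d f) (hG : HomPolyV e G) :
    HomPolyV (d + e) (fun v χ => f v χ • G v χ) :=
  fun i => hf.mul (hG i)

lemma apply (hF : HomPolyV d F) (g : (Fin n → k) →ₗ[k] k) :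
    HomPoly d (fun v χ => g (F v χ)) := by
  have : ∀ x : Fin n → k, g x = ∑ i, g (Pi.single i 1) * x i := fun x => by
    rw [LinearMap.pi_apply_eq_sum_univ g x]
    exact Finset.sum_congr rfl fun i _ => by
      rw [smul_eq_mul, mul_comm]
      congr 2
      ext j; simp [Pi.single_apply, eq_comm]
  have h : (fun v χ => g (F v χ)) = fun v χ => ∑ i, g (Pi.single i 1) * F v χ i :=
    funext₂ fun v χ => this _
  rw [h]
  exact HomPoly.sum _ fun i => (hF i).const_mul _

end HomPolyV

lemma AlgStr.apply_eq_sum {n : ℕ} (χ : AlgStr k n) (x y : Fin n → k) (m : Fin n) :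
    χ x y m = ∑ i, ∑ j, x i * (y j * structConst χ (i, j, m)) := by
  conv_lhs => rw [← (Pi.basisFun k (Fin n)).sum_repr x, ← (Pi.basisFun k (Fin n)).sum_repr y]
  simp only [map_sum, map_smul, LinearMap.sum_apply, LinearMap.smul_apply, Finset.sum_apply,
    Pi.smul_apply, smul_eq_mul, Pi.basisFun_repr, Pi.basisFun_apply, structConst, Finset.mul_sum]
  rw [Finset.sum_comm]
  exact Finset.sum_congr rfl fun i _ => Finset.sum_congr rfl fun j _ => mul_left_comm _ _ _

lemma HomPolyV.bilin {σ : Type} {n : ℕ} {d e : ℕ} {F G : (σ → k) → AlgStr k n → Fin n → k}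
    (hF : HomPolyV d F) (hG : HomPolyV e G) : HomPolyV (d + e) (fun v χ => χ (F v χ) (G v χ)) := by
  intro m
  simp only [AlgStr.apply_eq_sum]
  refine HomPoly.sum _ fun i => HomPoly.sum _ fun j => ?_
  simpa using (hF i).mul ((hG j).mul (HomPoly.structConst (i, j, m)))

lemma HomPolyV.bilin' {σ : Type} {n : ℕ} (x y : Fin n → k) :
    HomPolyV 0 (fun (_ : σ → k) (χ : AlgStr k n) => χ x y) :=
  (HomPolyV.const x).bilin (HomPolyV.const y)

open MvPolynomial in
/-- In high degree `D`, forms of degree `D` are combinations of monomial multiples, of degree `D`,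
of given forms without a common nonzero zero. -/
lemma exists_homogeneousSubmodule_le_span [IsAlgClosed k] {σ : Type} [Finite σ] {ι : Type*}
    (d : ι → ℕ) (q : ι → MvPolynomial σ k) (hq : ∀ s, (q s).IsHomogeneous (d s))
    (h0 : ∀ v : σ → k, (∀ s, eval v (q s) = 0) → v = 0) :
    ∃ D : ℕ, homogeneousSubmodule σ k D ≤ Submodule.span k
      {p | ∃ s e, Finsupp.degree e + d s = D ∧ p = monomial e 1 * q s} := by
  classical
  have := Fintype.ofFinite σ
  set I : Ideal (MvPolynomial σ k) := Ideal.span (Set.range q) with hI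
  have hrad : ∀ i, ∃ N, (X i : MvPolynomial σ k) ^ N ∈ I := by
    intro i
    have : (X i : MvPolynomial σ k) ∈ I.radical := by
      rw [← vanishingIdeal_zeroLocus_eq_radical (K := k), mem_vanishingIdeal_iff]
      intro v hv
      rw [hI, zeroLocus_span] at hv
      have : v = 0 := h0 v fun s => by
        simpa [aeval_eq_eval] using hv (q s) ⟨s, rfl⟩
      simp [this]
    exact this
  choose N hN using hrad
  refine ⟨∑ i, N i + 1, ?_⟩
  set D := ∑ i, N i + 1
  have hIspan : ∀ p ∈ I, p ∈ Submodule.span k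
      {p | ∃ s e, p = monomial e 1 * q s} := by
    intro p hp
    refine Submodule.span_induction ?_ (zero_mem _) (fun _ _ _ _ h1 h2 => add_mem h1 h2) ?_ hp
    · rintro _ ⟨s, rfl⟩
      exact Submodule.subset_span ⟨s, 0, by simp⟩
    · intro a x _ hx
      refine Submodule.span_induction (p := fun x _ => a • x ∈ _) ?_ (by simp)
        (fun _ _ _ _ h1 h2 => by rw [smul_add]; exact add_mem h1 h2)
        (fun c x _ h => by rw [smul_comm]; exact Submodule.smul_mem _ _ h) hx
      rintro _ ⟨s, e, rfl⟩
      rw [a.as_sum, Finset.sum_smul]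
      refine Submodule.sum_mem _ fun f _ => ?_
      have : (monomial f (coeff f a)) • (monomial e 1 * q s)
          = coeff f a • (monomial (f + e) (1 : k) * q s) := by
        rw [smul_eq_mul, ← mul_assoc, monomial_mul, ← smul_mul_assoc, smul_monomial]
        simp
      rw [this]
      exact Submodule.smul_mem _ _ (Submodule.subset_span ⟨s, _, rfl⟩)
  have hmono : ∀ e : σ →₀ ℕ, Finsupp.degree e = D → monomial e (1 : k) ∈ I := by
    intro e he
    have : ∃ i, N i ≤ e i := by
      by_contra! hcon
      have h1 : Finsupp.degree e = ∑ i, e i := Finsupp.degree_eq_sum e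
      have := Finset.sum_le_sum (s := Finset.univ) fun i _ => (hcon i).le
      omega
    obtain ⟨i, hi⟩ := this
    have : monomial e (1 : k) = monomial (e - Finsupp.single i (N i)) 1 * X i ^ N i := by
      rw [X_pow_eq_monomial, monomial_mul, mul_one, tsub_add_cancel_of_le]
      simpa using hi
    rw [this]
    exact I.mul_mem_left _ (hN i)
  intro p hp
  rw [mem_homogeneousSubmodule] at hp
  have hpI : p ∈ I := by
    rw [p.as_sum]
    refine I.sum_mem fun e he => ?_
    have : monomial e (coeff e p) = C (coeff e p) * monomial e 1 := by
      rw [C_mul_monomial, mul_one]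
    rw [this]
    refine I.mul_mem_left _ (hmono e ?_)
    have h1 := hp (mem_support_iff.mp he)
    simpa [Finsupp.weight_apply, Finsupp.sum, Finsupp.degree_apply] using h1
  have h2 : homogeneousComponent D p ∈ Submodule.map (homogeneousComponent D)
      (Submodule.span k {p | ∃ s e, p = monomial e 1 * q s}) := ⟨p, hIspan p hpI, rfl⟩
  rw [homogeneousComponent_of_mem hp, if_pos rfl, Submodule.map_span] at h2
  refine Submodule.span_le.mpr ?_ h2
  rintro _ ⟨_, ⟨s, e, rfl⟩, rfl⟩
  have h3 : (monomial e (1 : k) * q s) ∈ homogeneousSubmodule σ k (Finsupp.degree e + d s) :=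
    (isHomogeneous_monomial (1 : k) rfl).mul (hq s)
  rw [homogeneousComponent_of_mem h3]
  split_ifs with h
  · exact Submodule.subset_span ⟨s, e, h.symm, rfl⟩
  · exact zero_mem _

open MvPolynomial in
/-- The main theorem of elimination theory, for degenerations: a closed homogeneous system of
equations in unknowns `v` which has a nonzero solution over every structure of the orbit has a
nonzero solution over every degeneration. -/
theorem exists_zero_of_degenerates [IsAlgClosed k] {σ : Type} [Finite σ] {n : ℕ}
    {μ χ : AlgStr k n} (hd : degenerates μ χ) (R : (σ → k) → AlgStr k n → Prop)
    (h0 : ∀ μ' ∈ orbit μ, ∃ v ≠ 0, R v μ') :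
    ∃ v : σ → k, v ≠ 0 ∧ ∀ d F, HomPoly d F → (∀ v' μ', R v' μ' → F v' μ' = 0) → F v χ = 0 := by
  classical
  have := Fintype.ofFinite σ
  by_contra! hcon
  let S := MvPolynomial (Fin n × Fin n × Fin n) k
  let ev (χ : AlgStr k n) : S →ₐ[k] k := aeval (structConst χ)
  have hev : ∀ χ, (ev χ : S →+* k) = eval (structConst χ) := fun χ =>
    RingHom.ext fun p => by simp [ev]; rfl
  let ι := {p : ℕ × MvPolynomial σ S // p.2.IsHomogeneous p.1 ∧
    ∀ v' μ', R v' μ' → eval v' (p.2.map (eval (structConst μ'))) = 0}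
  obtain ⟨D, hD⟩ := exists_homogeneousSubmodule_le_span (ι := ι) (fun s => s.1.1)
    (fun s => s.1.2.map (eval (structConst χ))) (fun s => s.2.1.map _) (fun v hv => by
      by_contra hne
      obtain ⟨d, F, ⟨Q, hQ, hQ'⟩, hF, hF'⟩ := hcon v hne
      refine hF' ?_
      rw [hQ']
      exact hv ⟨(d, Q), hQ, fun v' μ' h => by rw [← hQ', hF v' μ' h]⟩)
  let gens : Set (MvPolynomial σ S) :=
    {p | ∃ (s : ι) (e : σ →₀ ℕ), Finsupp.degree e + s.1.1 = D ∧ p = monomial e 1 * s.1.2}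
  have hB : ∀ e : σ →₀ ℕ, Finsupp.degree e = D → ∃ B ∈ Submodule.span k gens,
      B.map (eval (structConst χ)) = monomial e (1 : k) := by
    intro e he
    have h1 : monomial e (1 : k) ∈ Submodule.map (mapAlgHom (σ := σ) (ev χ)).toLinearMap
        (Submodule.span k gens) := by
      rw [Submodule.map_span]
      refine Submodule.span_mono ?_ (hD (isHomogeneous_monomial (1 : k) he))
      rintro _ ⟨s, f, hf, rfl⟩
      refine ⟨_, ⟨s, f, hf, rfl⟩, ?_⟩
      simp [mapAlgHom_apply, hev]
    obtain ⟨B, hB, hB'⟩ := h1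
    refine ⟨B, hB, ?_⟩
    rw [← hB', ← hev]
    simp [mapAlgHom_apply]
  have hgen : ∀ B ∈ Submodule.span k gens, B.IsHomogeneous D ∧
      ∀ v' μ', R v' μ' → eval v' (B.map (eval (structConst μ'))) = 0 := by
    intro B hB
    refine Submodule.span_induction ?_ ?_ ?_ ?_ hB
    · rintro _ ⟨s, f, hf, rfl⟩
      refine ⟨hf ▸ (isHomogeneous_monomial _ rfl).mul s.2.1, fun v' μ' h => ?_⟩
      simp [s.2.2 v' μ' h]
    · exact ⟨isHomogeneous_zero _ _ _, by simp⟩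
    · rintro x y _ _ ⟨hx, hx'⟩ ⟨hy, hy'⟩
      exact ⟨hx.add hy, fun v' μ' h => by simp [hx' v' μ' h, hy' v' μ' h]⟩
    · rintro a x _ ⟨hx, hx'⟩
      have : a • x = C (C a) * x := by
        rw [← smul_eq_C_mul, ← algebraMap_eq (R := k), algebraMap_smul]
      rw [this]
      exact ⟨hx.C_mul _, fun v' μ' h => by simp [hx' v' μ' h]⟩
  have hfin : Finite {e : σ →₀ ℕ // Finsupp.degree e = D} :=
    ((Finsupp.finite_of_degree_le D).subset fun e he => le_of_eq he).to_subtype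
  have := Fintype.ofFinite {e : σ →₀ ℕ // Finsupp.degree e = D}
  choose B hBmem hBmap using fun e : {e : σ →₀ ℕ // Finsupp.degree e = D} => hB e.1 e.2
  let A : Matrix {e : σ →₀ ℕ // Finsupp.degree e = D} {e : σ →₀ ℕ // Finsupp.degree e = D} S :=
    Matrix.of fun e e' => coeff e'.1 (B e)
  have hχ : eval (structConst χ) A.det = 1 := by
    rw [RingHom.map_det]
    rw [← Matrix.det_one (n := {e : σ →₀ ℕ // Finsupp.degree e = D})]
    congr 1
    ext e e'
    have : eval (structConst χ) (coeff e'.1 (B e)) = coeff e'.1 (monomial e.1 (1 : k)) := by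
      rw [← hBmap, coeff_map]
    simp [A, this, coeff_monomial, Matrix.one_apply, Subtype.ext_iff]
  have hμ : orbit μ ⊆ {ν | eval (structConst ν) A.det = 0} := by
    intro ν hν
    obtain ⟨v, hv, hR⟩ := h0 ν hν
    rw [Set.mem_ofPred_eq, RingHom.map_det]
    refine Matrix.exists_mulVec_eq_zero_iff.mp ⟨fun e => ∏ i, v i ^ e.1 i, ?_, ?_⟩
    · obtain ⟨i, hi⟩ := Function.ne_iff.mp hv
      refine Function.ne_iff.mpr ⟨⟨Finsupp.single i D, by simp⟩, ?_⟩
      rw [Finset.prod_eq_single i (fun j _ hj => by simp [Finsupp.single_eq_of_ne hj])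
        (by simp)]
      simpa using pow_ne_zero _ hi
    · funext e
      obtain ⟨hh, hz⟩ := hgen _ (hBmem e)
      have h1 := hz v ν hR
      rw [eval_eq'] at h1
      rw [Pi.zero_apply, ← h1]
      have hsub : (((B e).map (eval (structConst ν))).support) ⊆
          (Finset.univ : Finset {e : σ →₀ ℕ // Finsupp.degree e = D}).map
            (Function.Embedding.subtype _) := by
        intro f hf
        have h2 := (hh.map (eval (structConst ν))) (mem_support_iff.mp hf)
        have h3 : Finsupp.degree f = D := by
          simpa [Finsupp.weight_apply, Finsupp.sum, Finsupp.degree_apply] using h2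
        exact Finset.mem_map.mpr ⟨⟨f, h3⟩, Finset.mem_univ _, rfl⟩
      rw [Finset.sum_subset hsub (fun f _ hf => by rw [notMem_support_iff.mp hf, zero_mul]),
        Finset.sum_map]
      refine Finset.sum_congr rfl fun f _ => ?_
      simp [A, coeff_map]
  have := hd _ ⟨{A.det}, fun ν => by simp⟩ hμ
  rw [Set.mem_ofPred_eq, hχ] at this
  exact one_ne_zero this

/-! ### Orbits and degenerations -/

section Basics

variable {n : ℕ} {μ χ ν : AlgStr k n}

lemma transport_apply (g : (Fin n → k) ≃ₗ[k] (Fin n → k)) (μ : AlgStr k n) (x y : Fin n → k) :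
    transport g μ x y = g (μ (g.symm x) (g.symm y)) := rfl

lemma mem_orbit_iff : χ ∈ orbit μ ↔
    ∃ g : (Fin n → k) ≃ₗ[k] (Fin n → k), ∀ x y, g (μ x y) = χ (g x) (g y) := by
  refine exists_congr fun g => ⟨?_, fun h => ?_⟩
  · rintro rfl x y
    simp [transport_apply]
  · refine LinearMap.ext₂ fun x y => ?_
    rw [transport_apply, h]
    simp

lemma orbit_refl (μ : AlgStr k n) : μ ∈ orbit μ :=
  mem_orbit_iff.mpr ⟨LinearEquiv.refl k _, fun _ _ => rfl⟩

lemma orbit_symm (h : χ ∈ orbit μ) : μ ∈ orbit χ := by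
  obtain ⟨g, hg⟩ := mem_orbit_iff.mp h
  exact mem_orbit_iff.mpr ⟨g.symm, fun x y => by rw [LinearEquiv.symm_apply_eq, hg]; simp⟩

/-- To give an isomorphism it suffices to find bases with the same multiplication table. -/
lemma mem_orbit_of_bases (b b' : Module.Basis (Fin n) k (Fin n → k))
    (h : ∀ i j m, b.repr (μ (b i) (b j)) m = b'.repr (χ (b' i) (b' j)) m) : χ ∈ orbit μ := by
  refine mem_orbit_iff.mpr ⟨b.equiv b' (Equiv.refl _), fun x y => ?_⟩
  have : μ.compr₂ (b.equiv b' (Equiv.refl _)).toLinearMap = χ.compl₁₂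
      (b.equiv b' (Equiv.refl _)).toLinearMap (b.equiv b' (Equiv.refl _)).toLinearMap := by
    refine b.ext fun i => b.ext fun j => b'.ext_elem fun m => ?_
    simp only [LinearMap.compr₂_apply, LinearMap.compl₁₂_apply, LinearEquiv.coe_coe,
      Module.Basis.equiv_apply, Equiv.refl_apply, ← h]
    simp [Module.Basis.equiv]
  simpa using LinearMap.congr_fun₂ this x y

lemma ofConst_apply (c : Fin n → Fin n → Fin n → k) (x y : Fin n → k) (m : Fin n) :
    ofConst c x y m = ∑ i, ∑ j, x i * y j * c i j m := by
  simp [ofConst, LinearMap.sum_apply, Finset.sum_apply]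

lemma ofConst_single (c : Fin n → Fin n → Fin n → k) (i j m : Fin n) :
    ofConst c (Pi.single i 1) (Pi.single j 1) m = c i j m := by
  rw [ofConst_apply, Finset.sum_eq_single i, Finset.sum_eq_single j] <;>
    simp +contextual [Pi.single_apply]

lemma structConst_eq_sum (b : Module.Basis (Fin n) k (Fin n → k)) (ν : AlgStr k n)
    (s : Fin n × Fin n × Fin n) :
    structConst ν s = ∑ i, ∑ j, ∑ m, b.repr (ν (b i) (b j)) m *
      (b.repr (Pi.single s.1 1) i * b.repr (Pi.single s.2.1 1) j * b m s.2.2) := by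
  have h1 : ∀ x y : Fin n → k, ν x y = ∑ i, ∑ j, ∑ m, (b.repr (ν (b i) (b j)) m *
      (b.repr x i * b.repr y j)) • b m := by
    intro x y
    conv_lhs => rw [← b.sum_repr x, ← b.sum_repr y]
    simp only [map_sum, LinearMap.sum_apply, map_smul, LinearMap.smul_apply]
    simp only [Finset.smul_sum]
    rw [Finset.sum_comm]
    refine Finset.sum_congr rfl fun i _ => Finset.sum_congr rfl fun j _ => ?_
    conv_lhs => rw [← b.sum_repr (ν (b i) (b j))]
    simp only [Finset.smul_sum, smul_smul]
    exact Finset.sum_congr rfl fun m _ => by ring_nf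
  rw [structConst, h1]
  simp only [Finset.sum_apply, Pi.smul_apply, smul_eq_mul, mul_assoc]

/-- One-parameter degenerations: the terms of positive weight disappear in the limit. -/
theorem degenerates_of_weights [Infinite k] (b : Module.Basis (Fin n) k (Fin n → k))
    (w : Fin n → ℕ)
    (h1 : ∀ i j m, w i + w j ≤ w m → b.repr (μ (b i) (b j)) m = b.repr (χ (b i) (b j)) m)
    (h2 : ∀ i j m, w i + w j ≠ w m → b.repr (χ (b i) (b j)) m = 0) : degenerates μ χ := by
  intro T hT hsub
  obtain ⟨P, hP⟩ := hT
  rw [hP]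
  intro p hp
  let E : Fin n × Fin n × Fin n → Fin n → Fin n → Fin n → k := fun s i j m =>
    b.repr (Pi.single s.1 1) i * b.repr (Pi.single s.2.1 1) j * b m s.2.2
  let G : Fin n × Fin n × Fin n → Polynomial k := fun s => ∑ i, ∑ j, ∑ m,
    Polynomial.C (b.repr (μ (b i) (b j)) m * E s i j m) * Polynomial.X ^ (w i + w j - w m)
  let q : Polynomial k := MvPolynomial.aeval G p
  have hq : ∀ t : k, q.eval t = MvPolynomial.eval (fun s => (G s).eval t) p := by
    intro t
    change Polynomial.evalRingHom t (MvPolynomial.aeval G p) = _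
    rw [MvPolynomial.aeval_def, MvPolynomial.hom_eval₂]
    change _ = MvPolynomial.eval₂ _ _ _
    congr 1
    ext; simp
  have hG : ∀ (t : k) s, (G s).eval t = ∑ i, ∑ j, ∑ m,
      (b.repr (μ (b i) (b j)) m * t ^ (w i + w j - w m)) * E s i j m := by
    intro t s
    simp only [G, Polynomial.eval_finsetSum, Polynomial.eval_mul, Polynomial.eval_C,
      Polynomial.eval_pow, Polynomial.eval_X]
    exact Finset.sum_congr rfl fun i _ => Finset.sum_congr rfl fun j _ =>
      Finset.sum_congr rfl fun m _ => by ring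
  have hlt : ∀ i j m, w i + w j < w m → b.repr (μ (b i) (b j)) m = 0 := fun i j m h => by
    rw [h1 i j m h.le, h2 i j m h.ne]
  have hne : ∀ t : k, t ≠ 0 → q.eval t = 0 := by
    intro t ht
    let h : (Fin n → k) ≃ₗ[k] (Fin n → k) := (b.equivFun.trans (LinearEquiv.piCongrRight
      fun i => LinearEquiv.smulOfUnit (Units.mk0 t ht ^ w i))).trans b.equivFun.symm
    have hh : ∀ x i, b.repr (h x) i = t ^ w i * b.repr x i := by
      intro x i
      rw [← b.equivFun_apply]
      simp [h, LinearEquiv.smulOfUnit, Units.smul_def, Finsupp.single_apply]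
    have hb : ∀ i, h (b i) = t ^ w i • b i := by
      intro i
      refine b.ext_elem fun j => ?_
      rw [hh]
      by_cases hij : i = j <;> simp [hij]
    have hh' : ∀ x i, b.repr (h.symm x) i = (t ^ w i)⁻¹ * b.repr x i := by
      intro x i
      have := hh (h.symm x) i
      rw [h.apply_symm_apply] at this
      rw [this, inv_mul_cancel_left₀ (pow_ne_zero _ ht)]
    have hν := (hP (transport h.symm μ)).mp (hsub ⟨h.symm, rfl⟩) p hp
    rw [hq, ← hν]
    congr 2
    funext s
    rw [hG, structConst_eq_sum b]
    refine Finset.sum_congr rfl fun i _ => Finset.sum_congr rfl fun j _ =>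
      Finset.sum_congr rfl fun m _ => ?_
    congr 1
    rw [transport_apply, hh', LinearEquiv.symm_symm, hb, hb]
    simp only [map_smul, LinearMap.smul_apply, Finsupp.smul_apply, smul_eq_mul]
    rcases lt_or_ge (w i + w j) (w m) with hc | hc
    · rw [hlt i j m hc]; simp
    · obtain ⟨c, hc⟩ := Nat.exists_eq_add_of_le hc
      rw [hc, Nat.add_sub_cancel_left, mul_comm]
      have e1 : t ^ w j * t ^ w i = t ^ w m * t ^ c := by
        rw [← pow_add, ← pow_add, ← hc, add_comm]
      have e2 := inv_mul_cancel_left₀ (pow_ne_zero (w m) ht) (t ^ c)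
      rw [← e2, ← e1]
      ring
  have hq0 : q = 0 := by
    refine Polynomial.eq_zero_of_infinite_isRoot q (Set.Infinite.mono (s := {0}ᶜ) ?_ ?_)
    · intro t ht
      exact hne t (by simpa using ht)
    · exact (Set.finite_singleton (0 : k)).infinite_compl
  have h0 := hq 0
  rw [hq0, Polynomial.eval_zero] at h0
  rw [h0]
  congr 2
  funext s
  rw [hG, structConst_eq_sum b]
  refine Finset.sum_congr rfl fun i _ => Finset.sum_congr rfl fun j _ =>
    Finset.sum_congr rfl fun m _ => ?_
  congr 1
  rcases lt_trichotomy (w i + w j) (w m) with hc | hc | hc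
  · rw [hlt i j m hc, h2 i j m hc.ne]; simp
  · rw [h1 i j m hc.le, hc]; simp
  · rw [h2 i j m hc.ne', zero_pow (by omega)]; simp

lemma degenerates_zero [Infinite k] (μ : AlgStr k n) : degenerates μ 0 :=
  degenerates_of_weights (Pi.basisFun k (Fin n)) (fun _ => 1) (fun _ _ _ h => by omega)
    (fun _ _ _ _ => by simp)

lemma mem_orbit_zero : χ ∈ orbit (0 : AlgStr k n) ↔ χ = 0 := by
  rw [mem_orbit_iff]
  refine ⟨fun ⟨g, hg⟩ => LinearMap.ext₂ fun x y => ?_, ?_⟩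
  · have := hg (g.symm x) (g.symm y)
    simpa using this.symm
  · rintro rfl
    exact ⟨LinearEquiv.refl k _, fun _ _ => rfl⟩

lemma zero_mem_orbit : (0 : AlgStr k n) ∈ orbit μ ↔ μ = 0 :=
  ⟨fun h => mem_orbit_zero.mp (orbit_symm h), fun h => h ▸ orbit_refl _⟩

lemma hasChain_two : hasChain μ 2 ↔
    ∃ χ ν : AlgStr k n, properlyDegenerates μ χ ∧ properlyDegenerates χ ν := by
  constructor
  · rintro ⟨c, rfl, h⟩
    exact ⟨c 1, c 0, h 1 (by omega), h 0 (by omega)⟩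
  · rintro ⟨χ, ν, h1, h2⟩
    refine ⟨fun i => if i = 0 then ν else if i = 1 then χ else μ, by simp, fun i hi => ?_⟩
    interval_cases i <;> simpa

lemma hasChain_three : hasChain μ 3 ↔ ∃ χ : AlgStr k n, properlyDegenerates μ χ ∧ hasChain χ 2 := by
  rw [hasChain]
  simp only [hasChain_two]
  constructor
  · rintro ⟨c, rfl, h⟩
    exact ⟨c 2, h 2 (by omega), c 1, c 0, h 1 (by omega), h 0 (by omega)⟩
  · rintro ⟨ξ, h0, χ, ν, h1, h2⟩
    refine ⟨fun i => if i = 0 then ν else if i = 1 then χ else if i = 2 then ξ else μ, by simp,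
      fun i hi => ?_⟩
    interval_cases i <;> simpa

end Basics

/-! ### Adapted bases -/

lemma exists_dual_family {n m : ℕ} {v : Fin m → Fin n → k} (hv : LinearIndependent k v) :
    ∃ θ : Fin m → (Fin n → k) →ₗ[k] k, ∀ i j, θ i (v j) = if i = j then 1 else 0 := by
  have h : ∀ i, ∃ g : (Fin n → k) →ₗ[k] k,
      g.comp (Submodule.span k (Set.range v)).subtype = (Module.Basis.span hv).coord i :=
    fun i => LinearMap.exists_extend _
  choose θ hθ using h
  refine ⟨θ, fun i j => ?_⟩
  have := LinearMap.congr_fun (hθ i) (Module.Basis.span hv j)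
  simpa [Module.Basis.span_apply, Finsupp.single_apply, eq_comm] using this

lemma exists_basis_of_dual_family {n m : ℕ} (v : Fin m → Fin n → k)
    (θ : Fin m → (Fin n → k) →ₗ[k] k) (h : ∀ i j, θ i (v j) = if i = j then 1 else 0)
    (hm : m ≤ n) : ∃ b : Module.Basis (Fin n) k (Fin n → k),
      (∀ i, b (Fin.castLE hm i) = v i) ∧ ∀ i x, b.repr x (Fin.castLE hm i) = θ i x := by
  have hv : LinearIndependent k v := by
    rw [Fintype.linearIndependent_iff]
    intro g hg i
    simpa [h] using congrArg (θ i) hg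
  set U := Submodule.span k (Set.range v)
  set W : Submodule k (Fin n → k) := LinearMap.ker (LinearMap.pi θ)
  have hW : ∀ x, x ∈ W ↔ ∀ i, θ i x = 0 := fun x => by simp [W, funext_iff]
  have hproj : ∀ x, x - ∑ j, θ j x • v j ∈ W := fun x => (hW _).mpr fun i => by simp [h]
  have hU : ∀ x ∈ U, ∑ j, θ j x • v j = x := by
    intro x hx
    obtain ⟨c, rfl⟩ := (Submodule.mem_span_range_iff_exists_fun k).mp hx
    simp [h]
  have hc : IsCompl U W := by
    refine ⟨Submodule.disjoint_def.mpr fun x hx hx' => ?_, codisjoint_iff.mpr ?_⟩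
    · rw [← hU x hx]
      simp [(hW x).mp hx']
    · refine eq_top_iff.mpr fun x _ => Submodule.mem_sup.mpr
        ⟨∑ j, θ j x • v j, ?_, _, hproj x, by abel⟩
      exact Submodule.sum_mem _ fun j _ =>
        Submodule.smul_mem _ _ (Submodule.subset_span ⟨j, rfl⟩)
  have hfin : Module.finrank k W = n - m := by
    have := Submodule.finrank_add_eq_of_isCompl hc
    rw [finrank_span_eq_card hv] at this
    simp only [Fintype.card_fin, Module.finrank_fin_fun] at this
    omega
  let b := (((Module.Basis.span hv).prod (Module.finBasisOfFinrankEq k W hfin)).map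
    (Submodule.prodEquivOfIsCompl U W hc)).reindex
      (finSumFinEquiv.trans (finCongr (Nat.add_sub_cancel' hm)))
  have hcast : ∀ i, Fin.castLE hm i =
      (finSumFinEquiv.trans (finCongr (Nat.add_sub_cancel' hm))) (Sum.inl i) := fun i => by
    ext; simp
  have hb : ∀ i, b (Fin.castLE hm i) = v i := by
    intro i
    rw [hcast, Module.Basis.reindex_apply, Equiv.symm_apply_apply]
    simp [Module.Basis.span_apply]
  refine ⟨b, hb, fun i x => ?_⟩
  have hlin : b.coord (Fin.castLE hm i) = θ i := by
    refine b.ext fun j => ?_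
    obtain ⟨s, rfl⟩ := (finSumFinEquiv.trans (finCongr (Nat.add_sub_cancel' hm))).surjective j
    rcases s with s | s
    · rw [← hcast, hb, h, Module.Basis.coord_apply, ← hb, Module.Basis.repr_self]
      simp [Finsupp.single_apply, eq_comm]
    · rw [Module.Basis.coord_apply, Module.Basis.repr_self, Module.Basis.reindex_apply,
        Equiv.symm_apply_apply, hcast, Finsupp.single_eq_of_ne (by
          simp [Fin.ext_iff]; omega)]
      have : ((Module.finBasisOfFinrankEq k W hfin) s : Fin n → k) ∈ W := Subtype.prop _
      simp [(hW _).mp this i]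
  exact LinearMap.congr_fun hlin x

/-- Basis extending a linearly independent family, with some coordinate functionals prescribed. -/
lemma exists_adapted_basis {n m : ℕ} {v : Fin m → Fin n → k} (hv : LinearIndependent k v)
    (S : Fin m → Prop) (φ : Fin m → (Fin n → k) →ₗ[k] k)
    (hφ : ∀ i, S i → ∀ j, φ i (v j) = if i = j then 1 else 0) :
    ∃ (hm : m ≤ n) (b : Module.Basis (Fin n) k (Fin n → k)),
      (∀ i, b (Fin.castLE hm i) = v i) ∧
        ∀ i, S i → ∀ x, φ i x = b.repr x (Fin.castLE hm i) := by
  classical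
  have hm : m ≤ n := by simpa using hv.fintype_card_le_finrank
  obtain ⟨θ, hθ⟩ := exists_dual_family hv
  obtain ⟨b, hb, hb'⟩ := exists_basis_of_dual_family v (fun i => if S i then φ i else θ i)
    (fun i j => by by_cases h : S i <;> simp [h, hφ, hθ]) hm
  exact ⟨hm, b, hb, fun i hi x => by rw [hb', if_pos hi]⟩

lemma algStr_ext_single {n : ℕ} {μ χ : AlgStr k n}
    (h : ∀ i j m, μ (Pi.single i 1) (Pi.single j 1) m = χ (Pi.single i 1) (Pi.single j 1) m) :
    μ = χ :=
  (Pi.basisFun k (Fin n)).ext fun i => (Pi.basisFun k (Fin n)).ext fun j => by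
    simpa using funext (h i j)

/-! ### Normal forms -/

section NormalForms

variable {n : ℕ}

/-- The family containing the algebras `T_ε^{2,(β+δ,β)}`. -/
def IsT (ε β δ : k) (μ : AlgStr k n) : Prop :=
  ∃ (h ψ : (Fin n → k) →ₗ[k] k) (x y z : Fin n → k), h x = 1 ∧ h y = 0 ∧ h z = 0 ∧
    ψ x = 0 ∧ ψ y = 1 ∧ ψ z = 0 ∧ z ≠ 0 ∧ ∀ a b, μ a b =
      (β * h a) • b + ((ε - β) * h b) • a + (h a * ψ b - h b * ψ a) • (δ • y + z)

/-- The algebras isomorphic to `T_0^{2,2}`. -/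
def Is22 (μ : AlgStr k n) : Prop :=
  ∃ (h ψ₁ ψ₂ : (Fin n → k) →ₗ[k] k) (x y₁ y₂ z₁ z₂ : Fin n → k),
    (h x = 1 ∧ h y₁ = 0 ∧ h y₂ = 0 ∧ h z₁ = 0 ∧ h z₂ = 0) ∧
    (ψ₁ x = 0 ∧ ψ₁ y₁ = 1 ∧ ψ₁ y₂ = 0 ∧ ψ₁ z₁ = 0 ∧ ψ₁ z₂ = 0) ∧
    (ψ₂ x = 0 ∧ ψ₂ y₁ = 0 ∧ ψ₂ y₂ = 1 ∧ ψ₂ z₁ = 0 ∧ ψ₂ z₂ = 0) ∧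
    LinearIndependent k ![z₁, z₂] ∧ ∀ a b, μ a b =
      (h a * ψ₁ b - h b * ψ₁ a) • z₁ + (h a * ψ₂ b - h b * ψ₂ a) • z₂

/-- The algebras isomorphic to `T_0^3` with an annihilator summand. -/
def Is03 (μ : AlgStr k n) : Prop :=
  ∃ (h ψ₁ ψ₂ : (Fin n → k) →ₗ[k] k) (x y₁ y₂ z : Fin n → k),
    (h x = 1 ∧ h y₁ = 0 ∧ h y₂ = 0 ∧ h z = 0) ∧
    (ψ₁ x = 0 ∧ ψ₁ y₁ = 1 ∧ ψ₁ y₂ = 0 ∧ ψ₁ z = 0) ∧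
    (ψ₂ x = 0 ∧ ψ₂ y₁ = 0 ∧ ψ₂ y₂ = 1 ∧ ψ₂ z = 0) ∧
    z ≠ 0 ∧ ∀ a b, μ a b =
      (h a * ψ₁ b - h b * ψ₁ a) • y₂ + (h a * ψ₂ b - h b * ψ₂ a) • z

/-- The algebras isomorphic to `η_2 ⊕ k^{n-5}`. -/
def IsEta (μ : AlgStr k n) : Prop :=
  ∃ (φ : Fin 4 → (Fin n → k) →ₗ[k] k) (x : Fin 4 → Fin n → k) (z : Fin n → k),
    (∀ i j, φ i (x j) = if i = j then 1 else 0) ∧ (∀ i, φ i z = 0) ∧ z ≠ 0 ∧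
    ∀ a b, μ a b =
      (φ 0 a * φ 1 b - φ 0 b * φ 1 a + (φ 2 a * φ 3 b - φ 2 b * φ 3 a)) • z

/-- The algebras isomorphic to `k^{n-2} ⋊ E_4`. -/
def IsE (μ : AlgStr k n) : Prop :=
  ∃ (a b : (Fin n → k) →ₗ[k] k) (x y : Fin n → k),
    (a x = 1 ∧ a y = 0 ∧ b x = 0 ∧ b y = 1) ∧ ∀ u v, μ u v = a u • v + b v • u

/-- The algebras in which any two elements span a subalgebra in a degenerate way. -/
def IsD (μ : AlgStr k n) : Prop :=
  ∃ (a b : k) (h : (Fin n → k) →ₗ[k] k), ∀ u v, μ u v = (a * h u) • v + (b * h v) • u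

variable {μ χ : AlgStr k n}

lemma IsT.mem_orbit {ε β δ : k} (hμ : IsT ε β δ μ) (hχ : IsT ε β δ χ) : χ ∈ orbit μ := by
  have key : ∀ {ν : AlgStr k n}, IsT ε β δ ν → ∃ (hm : 3 ≤ n)
      (b : Module.Basis (Fin n) k (Fin n → k)), ∀ i j, ν (b i) (b j) =
      (β * b.repr (b i) (Fin.castLE hm 0)) • b j +
        ((ε - β) * b.repr (b j) (Fin.castLE hm 0)) • b i +
      (b.repr (b i) (Fin.castLE hm 0) * b.repr (b j) (Fin.castLE hm 1) -
        b.repr (b j) (Fin.castLE hm 0) * b.repr (b i) (Fin.castLE hm 1)) •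
      (δ • b (Fin.castLE hm 1) + b (Fin.castLE hm 2)) := by
    rintro ν ⟨h, ψ, x, y, z, hx, hy, hz, px, py, pz, z0, hν⟩
    have hli : LinearIndependent k ![x, y, z] := by
      rw [Fintype.linearIndependent_iff]
      intro g hg
      simp only [Fin.sum_univ_three, Matrix.cons_val] at hg
      have g0 : g 0 = 0 := by simpa [hx, hy, hz] using congrArg h hg
      have g1 : g 1 = 0 := by simpa [px, py, pz] using congrArg ψ hg
      have g2 : g 2 = 0 := by simpa [g0, g1, z0] using hg
      intro i; fin_cases i <;> assumption
    obtain ⟨hm, b, hb, hb'⟩ := exists_adapted_basis hli (· ≠ 2) ![h, ψ, 0] (by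
      intro i hi j
      fin_cases i <;> fin_cases j <;> simp_all)
    refine ⟨hm, b, fun i j => ?_⟩
    have e0 := hb' 0 (by decide)
    have e1 := hb' 1 (by decide)
    have f1 := hb 1
    have f2 := hb 2
    simp only [Matrix.cons_val] at e0 e1 f1 f2
    rw [hν, f1, f2, e0, e0, e1, e1]
  obtain ⟨hm, b, hb⟩ := key hμ
  obtain ⟨_, b', hb'⟩ := key hχ
  refine mem_orbit_of_bases b b' fun i j m => ?_
  rw [hb, hb']
  simp

lemma Is22.mem_orbit (hμ : Is22 μ) (hχ : Is22 χ) : χ ∈ orbit μ := by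
  have key : ∀ {ν : AlgStr k n}, Is22 ν → ∃ (hm : 5 ≤ n)
      (b : Module.Basis (Fin n) k (Fin n → k)), ∀ i j, ν (b i) (b j) =
      (b.repr (b i) (Fin.castLE hm 0) * b.repr (b j) (Fin.castLE hm 1) -
        b.repr (b j) (Fin.castLE hm 0) * b.repr (b i) (Fin.castLE hm 1)) •
        b (Fin.castLE hm 3) +
      (b.repr (b i) (Fin.castLE hm 0) * b.repr (b j) (Fin.castLE hm 2) -
        b.repr (b j) (Fin.castLE hm 0) * b.repr (b i) (Fin.castLE hm 2)) •
        b (Fin.castLE hm 4) := by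
    rintro ν ⟨h, ψ₁, ψ₂, x, y₁, y₂, z₁, z₂, ⟨a1, a2, a3, a4, a5⟩, ⟨b1, b2, b3, b4, b5⟩,
      ⟨c1, c2, c3, c4, c5⟩, hz, hν⟩
    have hli : LinearIndependent k ![x, y₁, y₂, z₁, z₂] := by
      rw [Fintype.linearIndependent_iff]
      intro g hg
      simp only [Fin.sum_univ_five, Matrix.cons_val] at hg
      have g0 : g 0 = 0 := by simpa [a1, a2, a3, a4, a5] using congrArg h hg
      have g1 : g 1 = 0 := by simpa [b1, b2, b3, b4, b5] using congrArg ψ₁ hg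
      have g2 : g 2 = 0 := by simpa [c1, c2, c3, c4, c5] using congrArg ψ₂ hg
      simp only [g0, g1, g2, zero_smul, zero_add] at hg
      obtain ⟨g3, g4⟩ := LinearIndependent.pair_iff.mp hz _ _ hg
      intro i; fin_cases i <;> assumption
    obtain ⟨hm, b, hb, hb'⟩ := exists_adapted_basis hli (· < 3) ![h, ψ₁, ψ₂, 0, 0] (by
      intro i hi j
      fin_cases i <;> fin_cases j <;> simp_all)
    refine ⟨hm, b, fun i j => ?_⟩
    have e0 := hb' 0 (by decide)
    have e1 := hb' 1 (by decide)
    have e2 := hb' 2 (by decide)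
    have f3 := hb 3
    have f4 := hb 4
    simp only [Matrix.cons_val] at e0 e1 e2 f3 f4
    rw [hν, f3, f4, e0, e0, e1, e1, e2, e2]
  obtain ⟨hm, b, hb⟩ := key hμ
  obtain ⟨_, b', hb'⟩ := key hχ
  refine mem_orbit_of_bases b b' fun i j m => ?_
  rw [hb, hb']
  simp

lemma Is03.mem_orbit (hμ : Is03 μ) (hχ : Is03 χ) : χ ∈ orbit μ := by
  have key : ∀ {ν : AlgStr k n}, Is03 ν → ∃ (hm : 4 ≤ n)
      (b : Module.Basis (Fin n) k (Fin n → k)), ∀ i j, ν (b i) (b j) =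
      (b.repr (b i) (Fin.castLE hm 0) * b.repr (b j) (Fin.castLE hm 1) -
        b.repr (b j) (Fin.castLE hm 0) * b.repr (b i) (Fin.castLE hm 1)) •
        b (Fin.castLE hm 2) +
      (b.repr (b i) (Fin.castLE hm 0) * b.repr (b j) (Fin.castLE hm 2) -
        b.repr (b j) (Fin.castLE hm 0) * b.repr (b i) (Fin.castLE hm 2)) •
        b (Fin.castLE hm 3) := by
    rintro ν ⟨h, ψ₁, ψ₂, x, y₁, y₂, z, ⟨a1, a2, a3, a4⟩, ⟨b1, b2, b3, b4⟩,
      ⟨c1, c2, c3, c4⟩, hz, hν⟩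
    have hli : LinearIndependent k ![x, y₁, y₂, z] := by
      rw [Fintype.linearIndependent_iff]
      intro g hg
      simp only [Fin.sum_univ_four, Matrix.cons_val] at hg
      have g0 : g 0 = 0 := by simpa [a1, a2, a3, a4] using congrArg h hg
      have g1 : g 1 = 0 := by simpa [b1, b2, b3, b4] using congrArg ψ₁ hg
      have g2 : g 2 = 0 := by simpa [c1, c2, c3, c4] using congrArg ψ₂ hg
      have g3 : g 3 = 0 := by simpa [g0, g1, g2, hz] using hg
      intro i; fin_cases i <;> assumption
    obtain ⟨hm, b, hb, hb'⟩ := exists_adapted_basis hli (· ≠ 3) ![h, ψ₁, ψ₂, 0] (by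
      intro i hi j
      fin_cases i <;> fin_cases j <;> simp_all)
    refine ⟨hm, b, fun i j => ?_⟩
    have e0 := hb' 0 (by decide)
    have e1 := hb' 1 (by decide)
    have e2 := hb' 2 (by decide)
    have f2 := hb 2
    have f3 := hb 3
    simp only [Matrix.cons_val] at e0 e1 e2 f2 f3
    rw [hν, f2, f3, e0, e0, e1, e1, e2, e2]
  obtain ⟨hm, b, hb⟩ := key hμ
  obtain ⟨_, b', hb'⟩ := key hχ
  refine mem_orbit_of_bases b b' fun i j m => ?_
  rw [hb, hb']
  simp

lemma IsEta.mem_orbit (hμ : IsEta μ) (hχ : IsEta χ) : χ ∈ orbit μ := by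
  have key : ∀ {ν : AlgStr k n}, IsEta ν → ∃ (hm : 5 ≤ n)
      (b : Module.Basis (Fin n) k (Fin n → k)), ∀ i j, ν (b i) (b j) =
      (b.repr (b i) (Fin.castLE hm 0) * b.repr (b j) (Fin.castLE hm 1) -
        b.repr (b j) (Fin.castLE hm 0) * b.repr (b i) (Fin.castLE hm 1) +
      (b.repr (b i) (Fin.castLE hm 2) * b.repr (b j) (Fin.castLE hm 3) -
        b.repr (b j) (Fin.castLE hm 2) * b.repr (b i) (Fin.castLE hm 3))) •
        b (Fin.castLE hm 4) := by
    rintro ν ⟨φ, x, z, hφ, hφz, hz, hν⟩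
    have hli : LinearIndependent k ![x 0, x 1, x 2, x 3, z] := by
      rw [Fintype.linearIndependent_iff]
      intro g hg
      simp only [Fin.sum_univ_five, Matrix.cons_val] at hg
      have g0 : g 0 = 0 := by simpa [hφ, hφz] using congrArg (φ 0) hg
      have g1 : g 1 = 0 := by simpa [hφ, hφz] using congrArg (φ 1) hg
      have g2 : g 2 = 0 := by simpa [hφ, hφz] using congrArg (φ 2) hg
      have g3 : g 3 = 0 := by simpa [hφ, hφz] using congrArg (φ 3) hg
      have g4 : g 4 = 0 := by simpa [g0, g1, g2, g3, hz] using hg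
      intro i; fin_cases i <;> assumption
    obtain ⟨hm, b, hb, hb'⟩ := exists_adapted_basis hli (· ≠ 4) ![φ 0, φ 1, φ 2, φ 3, 0] (by
      intro i hi j
      fin_cases i <;> fin_cases j <;> simp [hφ, hφz]; exact absurd rfl hi)
    refine ⟨hm, b, fun i j => ?_⟩
    have e0 := hb' 0 (by decide)
    have e1 := hb' 1 (by decide)
    have e2 := hb' 2 (by decide)
    have e3 := hb' 3 (by decide)
    have f4 := hb 4
    simp only [Matrix.cons_val] at e0 e1 e2 e3 f4
    rw [hν, f4, e0, e0, e1, e1, e2, e2, e3, e3]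
  obtain ⟨hm, b, hb⟩ := key hμ
  obtain ⟨_, b', hb'⟩ := key hχ
  refine mem_orbit_of_bases b b' fun i j m => ?_
  rw [hb, hb']
  simp

lemma IsE.mem_orbit (hμ : IsE μ) (hχ : IsE χ) : χ ∈ orbit μ := by
  have key : ∀ {ν : AlgStr k n}, IsE ν → ∃ (hm : 2 ≤ n)
      (b : Module.Basis (Fin n) k (Fin n → k)), ∀ i j, ν (b i) (b j) =
      b.repr (b i) (Fin.castLE hm 0) • b j + b.repr (b j) (Fin.castLE hm 1) • b i := by
    rintro ν ⟨f, g, x, y, ⟨h1, h2, h3, h4⟩, hν⟩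
    have hli : LinearIndependent k ![x, y] := by
      rw [LinearIndependent.pair_iff]
      intro s t hst
      exact ⟨by simpa [h1, h2] using congrArg f hst, by simpa [h3, h4] using congrArg g hst⟩
    obtain ⟨hm, b, hb, hb'⟩ := exists_adapted_basis hli (fun _ => True) ![f, g] (by
      intro i hi j
      fin_cases i <;> fin_cases j <;> simp_all)
    refine ⟨hm, b, fun i j => ?_⟩
    have e0 := hb' 0 trivial
    have e1 := hb' 1 trivial
    simp only [Matrix.cons_val] at e0 e1
    rw [hν, e0, e1]
  obtain ⟨hm, b, hb⟩ := key hμ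
  obtain ⟨_, b', hb'⟩ := key hχ
  refine mem_orbit_of_bases b b' fun i j m => ?_
  rw [hb, hb']
  simp

end NormalForms

section Named

variable {n : ℕ} {μ χ : AlgStr k n}

lemma IsT.of_mem_orbit {ε β δ : k} (hμ : IsT ε β δ μ) (hχ : χ ∈ orbit μ) : IsT ε β δ χ := by
  obtain ⟨g, rfl⟩ := hχ
  obtain ⟨h, ψ, x, y, z, hx, hy, hz, px, py, pz, z0, hν⟩ := hμ
  exact ⟨h ∘ₗ g.symm.toLinearMap, ψ ∘ₗ g.symm.toLinearMap, g x, g y, g z, by simpa, by simpa,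
    by simpa, by simpa, by simpa, by simpa, by simpa, fun a b => by simp [transport_apply, hν]⟩

lemma Is22.of_mem_orbit (hμ : Is22 μ) (hχ : χ ∈ orbit μ) : Is22 χ := by
  obtain ⟨g, rfl⟩ := hχ
  obtain ⟨h, ψ₁, ψ₂, x, y₁, y₂, z₁, z₂, h1, h2, h3, hz, hν⟩ := hμ
  refine ⟨h ∘ₗ g.symm.toLinearMap, ψ₁ ∘ₗ g.symm.toLinearMap, ψ₂ ∘ₗ g.symm.toLinearMap, g x,
    g y₁, g y₂, g z₁, g z₂, by simpa, by simpa, by simpa, ?_,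
    fun a b => by simp [transport_apply, hν]⟩
  rw [LinearIndependent.pair_iff] at hz ⊢
  intro s t hst
  rw [← map_smul, ← map_smul, ← map_add, LinearEquiv.map_eq_zero_iff] at hst
  exact hz s t hst

lemma Is03.of_mem_orbit (hμ : Is03 μ) (hχ : χ ∈ orbit μ) : Is03 χ := by
  obtain ⟨g, rfl⟩ := hχ
  obtain ⟨h, ψ₁, ψ₂, x, y₁, y₂, z, h1, h2, h3, hz, hν⟩ := hμ
  exact ⟨h ∘ₗ g.symm.toLinearMap, ψ₁ ∘ₗ g.symm.toLinearMap, ψ₂ ∘ₗ g.symm.toLinearMap, g x,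
    g y₁, g y₂, g z, by simpa, by simpa, by simpa, by simpa,
    fun a b => by simp [transport_apply, hν]⟩

lemma IsEta.of_mem_orbit (hμ : IsEta μ) (hχ : χ ∈ orbit μ) : IsEta χ := by
  obtain ⟨g, rfl⟩ := hχ
  obtain ⟨φ, x, z, hφ, hφz, hz, hν⟩ := hμ
  exact ⟨fun i => φ i ∘ₗ g.symm.toLinearMap, fun i => g (x i), g z, by simpa, by simpa, by simpa,
    fun a b => by simp [transport_apply, hν]⟩

lemma IsE.of_mem_orbit (hμ : IsE μ) (hχ : χ ∈ orbit μ) : IsE χ := by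
  obtain ⟨g, rfl⟩ := hχ
  obtain ⟨f, h, x, y, hf, hν⟩ := hμ
  exact ⟨f ∘ₗ g.symm.toLinearMap, h ∘ₗ g.symm.toLinearMap, g x, g y, by simpa,
    fun a b => by simp [transport_apply, hν]⟩

lemma ne_zero_of_single (i : Fin n) : (Pi.single i 1 : Fin n → k) ≠ 0 := by
  simp [Pi.single_eq_zero_iff]

lemma isT_T02str (hn : 3 ≤ n) (α β : k) : IsT 0 β (α - β) (T02str n α β) := by
  let i0 : Fin n := ⟨0, by omega⟩
  let i1 : Fin n := ⟨1, by omega⟩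
  let i2 : Fin n := ⟨2, by omega⟩
  let h : (Fin n → k) →ₗ[k] k := LinearMap.proj i0
  let ψ : (Fin n → k) →ₗ[k] k := LinearMap.proj i1
  let w : Fin n → k := (α - β) • Pi.single i1 1 + Pi.single i2 1
  have : T02str n α β = h.smulRight (β • LinearMap.id) +
      (h.smulRight ((0 - β) • LinearMap.id)).flip + h.smulRight (ψ.smulRight w) -
      ψ.smulRight (h.smulRight w) := by
    refine algStr_ext_single fun i j m => ?_
    rw [T02str, ofConst_single]
    obtain ⟨i, hi⟩ := i
    obtain ⟨j, hj⟩ := j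
    obtain ⟨m, hm⟩ := m
    rcases i with _ | _ | i <;> rcases j with _ | _ | j <;>
      simp [h, ψ, w, Pi.single_apply, i0, i1, i2] <;> grind
  refine ⟨h, ψ, Pi.single i0 1, Pi.single i1 1, Pi.single i2 1, ?_, ?_, ?_, ?_, ?_, ?_,
    ne_zero_of_single _, fun a b => ?_⟩ <;> try simp [h, ψ, i0, i1, i2]
  rw [this]
  simp only [LinearMap.add_apply, LinearMap.sub_apply, LinearMap.smulRight_apply,
    LinearMap.flip_apply, LinearMap.smul_apply, LinearMap.id_apply, h, ψ, w, LinearMap.proj_apply]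
  module

lemma isT_T12str (hn : 3 ≤ n) (α β : k) : IsT 1 β (α - β) (T12str n α β) := by
  let i0 : Fin n := ⟨0, by omega⟩
  let i1 : Fin n := ⟨1, by omega⟩
  let i2 : Fin n := ⟨2, by omega⟩
  let h : (Fin n → k) →ₗ[k] k := LinearMap.proj i0
  let ψ : (Fin n → k) →ₗ[k] k := LinearMap.proj i1
  let w : Fin n → k := (α - β) • Pi.single i1 1 + Pi.single i2 1
  have : T12str n α β = h.smulRight (β • LinearMap.id) +
      (h.smulRight ((1 - β) • LinearMap.id)).flip + h.smulRight (ψ.smulRight w) -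
      ψ.smulRight (h.smulRight w) := by
    refine algStr_ext_single fun i j m => ?_
    rw [T12str, ofConst_single]
    obtain ⟨i, hi⟩ := i
    obtain ⟨j, hj⟩ := j
    obtain ⟨m, hm⟩ := m
    rcases i with _ | _ | i <;> rcases j with _ | _ | j <;>
      simp [h, ψ, w, Pi.single_apply, i0, i1, i2] <;> grind
  refine ⟨h, ψ, Pi.single i0 1, Pi.single i1 1, Pi.single i2 1, ?_, ?_, ?_, ?_, ?_, ?_,
    ne_zero_of_single _, fun a b => ?_⟩ <;> try simp [h, ψ, i0, i1, i2]
  rw [this]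
  simp only [LinearMap.add_apply, LinearMap.sub_apply, LinearMap.smulRight_apply,
    LinearMap.flip_apply, LinearMap.smul_apply, LinearMap.id_apply, h, ψ, w, LinearMap.proj_apply]
  module

lemma is22_T022str (hn : 5 ≤ n) : Is22 (T022str n : AlgStr k n) := by
  let i0 : Fin n := ⟨0, by omega⟩
  let i1 : Fin n := ⟨1, by omega⟩
  let i2 : Fin n := ⟨2, by omega⟩
  let i3 : Fin n := ⟨3, by omega⟩
  let i4 : Fin n := ⟨4, by omega⟩
  let p : Fin n → (Fin n → k) →ₗ[k] k := LinearMap.proj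
  let e : Fin n → Fin n → k := fun i => Pi.single i 1
  have : (T022str n : AlgStr k n) = (p i0).smulRight ((p i1).smulRight (e i2)) -
      (p i1).smulRight ((p i0).smulRight (e i2)) + (p i0).smulRight ((p i3).smulRight (e i4)) -
      (p i3).smulRight ((p i0).smulRight (e i4)) := by
    refine algStr_ext_single fun i j m => ?_
    rw [T022str, ofConst_single]
    obtain ⟨i, hi⟩ := i
    obtain ⟨j, hj⟩ := j
    obtain ⟨m, hm⟩ := m
    simp only [p, e, Pi.single_apply, i0, i1, i2, i3, i4, LinearMap.add_apply,
      LinearMap.sub_apply, LinearMap.smulRight_apply, LinearMap.proj_apply, LinearMap.smul_apply,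
      Pi.add_apply, Pi.sub_apply, Pi.smul_apply, smul_eq_mul, Fin.mk.injEq]
    grind
  refine ⟨p i0, p i1, p i3, e i0, e i1, e i3, e i2, e i4, ?_, ?_, ?_, ?_, fun a b => ?_⟩
  · simp [p, e, i0, i1, i2, i3, i4]
  · simp [p, e, i0, i1, i2, i3, i4]
  · simp [p, e, i0, i1, i2, i3, i4]
  · rw [LinearIndependent.pair_iff]
    intro s t hst
    exact ⟨by simpa [e, i2, i4, Pi.single_apply] using congrFun hst i2,
      by simpa [e, i2, i4, Pi.single_apply] using congrFun hst i4⟩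
  · rw [this]
    simp only [LinearMap.add_apply, LinearMap.sub_apply, LinearMap.smulRight_apply,
      LinearMap.smul_apply]
    module

lemma is03_T03str (hn : 4 ≤ n) : Is03 (T03str n : AlgStr k n) := by
  let i0 : Fin n := ⟨0, by omega⟩
  let i1 : Fin n := ⟨1, by omega⟩
  let i2 : Fin n := ⟨2, by omega⟩
  let i3 : Fin n := ⟨3, by omega⟩
  let p : Fin n → (Fin n → k) →ₗ[k] k := LinearMap.proj
  let e : Fin n → Fin n → k := fun i => Pi.single i 1
  have : (T03str n : AlgStr k n) = (p i0).smulRight ((p i1).smulRight (e i2)) -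
      (p i1).smulRight ((p i0).smulRight (e i2)) + (p i0).smulRight ((p i2).smulRight (e i3)) -
      (p i2).smulRight ((p i0).smulRight (e i3)) := by
    refine algStr_ext_single fun i j m => ?_
    rw [T03str, ofConst_single]
    obtain ⟨i, hi⟩ := i
    obtain ⟨j, hj⟩ := j
    obtain ⟨m, hm⟩ := m
    simp only [p, e, Pi.single_apply, i0, i1, i2, i3, LinearMap.add_apply,
      LinearMap.sub_apply, LinearMap.smulRight_apply, LinearMap.proj_apply, LinearMap.smul_apply,
      Pi.add_apply, Pi.sub_apply, Pi.smul_apply, smul_eq_mul, Fin.mk.injEq]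
    grind
  refine ⟨p i0, p i1, p i2, e i0, e i1, e i2, e i3, ?_, ?_, ?_, ne_zero_of_single _,
    fun a b => ?_⟩
  · simp [p, e, i0, i1, i2, i3]
  · simp [p, e, i0, i1, i2, i3]
  · simp [p, e, i0, i1, i2, i3]
  · rw [this]
    simp only [LinearMap.add_apply, LinearMap.sub_apply, LinearMap.smulRight_apply,
      LinearMap.smul_apply]
    module

lemma isEta_etaStr (hn : 5 ≤ n) : IsEta (etaStr n 2 : AlgStr k n) := by
  let i0 : Fin n := ⟨0, by omega⟩
  let i1 : Fin n := ⟨1, by omega⟩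
  let i2 : Fin n := ⟨2, by omega⟩
  let i3 : Fin n := ⟨3, by omega⟩
  let i4 : Fin n := ⟨4, by omega⟩
  let p : Fin n → (Fin n → k) →ₗ[k] k := LinearMap.proj
  let e : Fin n → Fin n → k := fun i => Pi.single i 1
  have : (etaStr n 2 : AlgStr k n) = (p i0).smulRight ((p i1).smulRight (e i4)) -
      (p i1).smulRight ((p i0).smulRight (e i4)) + (p i2).smulRight ((p i3).smulRight (e i4)) -
      (p i3).smulRight ((p i2).smulRight (e i4)) := by
    refine algStr_ext_single fun i j m => ?_
    rw [etaStr, ofConst_single]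
    obtain ⟨i, hi⟩ := i
    obtain ⟨j, hj⟩ := j
    obtain ⟨m, hm⟩ := m
    simp only [p, e, Pi.single_apply, i0, i1, i2, i3, i4, LinearMap.add_apply,
      LinearMap.sub_apply, LinearMap.smulRight_apply, LinearMap.proj_apply, LinearMap.smul_apply,
      Pi.add_apply, Pi.sub_apply, Pi.smul_apply, smul_eq_mul, Fin.mk.injEq]
    have h1 : (i % 2 = 0 ∧ j = i + 1 ∧ i < 2 * 2 ∧ m = 2 * 2) ↔
      ((i = 0 ∧ j = 1 ∧ m = 4) ∨ (i = 2 ∧ j = 3 ∧ m = 4)) := by omega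
    have h2 : (j % 2 = 0 ∧ i = j + 1 ∧ j < 2 * 2 ∧ m = 2 * 2) ↔
      ((j = 0 ∧ i = 1 ∧ m = 4) ∨ (j = 2 ∧ i = 3 ∧ m = 4)) := by omega
    simp only [h1, h2]
    grind
  refine ⟨![p i0, p i1, p i2, p i3], ![e i0, e i1, e i2, e i3], e i4, fun i j => ?_,
    fun i => ?_, ne_zero_of_single _, fun a b => ?_⟩
  · fin_cases i <;> fin_cases j <;> simp [p, e, i0, i1, i2, i3]
  · fin_cases i <;> simp [p, e, i0, i1, i2, i3, i4]
  · rw [this]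
    simp only [LinearMap.add_apply, LinearMap.sub_apply, LinearMap.smulRight_apply,
      LinearMap.smul_apply, Matrix.cons_val]
    module

lemma isE_kE4str (hn : 2 ≤ n) : IsE (kE4str n : AlgStr k n) := by
  let i0 : Fin n := ⟨0, by omega⟩
  let i1 : Fin n := ⟨1, by omega⟩
  let p : Fin n → (Fin n → k) →ₗ[k] k := LinearMap.proj
  let e : Fin n → Fin n → k := fun i => Pi.single i 1
  have : (kE4str n : AlgStr k n) = (p i0).smulRight LinearMap.id +
      ((p i1).smulRight LinearMap.id).flip := by
    refine algStr_ext_single fun i j m => ?_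
    rw [kE4str, ofConst_single]
    obtain ⟨i, hi⟩ := i
    obtain ⟨j, hj⟩ := j
    obtain ⟨m, hm⟩ := m
    simp only [p, Pi.single_apply, i0, i1, LinearMap.add_apply, LinearMap.flip_apply,
      LinearMap.id_apply, LinearMap.smulRight_apply, LinearMap.proj_apply, LinearMap.smul_apply,
      Pi.add_apply, Pi.smul_apply, smul_eq_mul, Fin.mk.injEq]
    grind
  refine ⟨p i0, p i1, e i0, e i1, ?_, fun a b => ?_⟩
  · simp [p, e, i0, i1]
  · rw [this]
    simp

lemma mem_orbit_T02str (hn : 3 ≤ n) {α β : k} :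
    χ ∈ orbit (T02str n α β) ↔ IsT 0 β (α - β) χ :=
  ⟨(isT_T02str hn α β).of_mem_orbit, (isT_T02str hn α β).mem_orbit⟩

lemma mem_orbit_T12str (hn : 3 ≤ n) {α β : k} :
    χ ∈ orbit (T12str n α β) ↔ IsT 1 β (α - β) χ :=
  ⟨(isT_T12str hn α β).of_mem_orbit, (isT_T12str hn α β).mem_orbit⟩

lemma mem_orbit_T022str (hn : 5 ≤ n) : χ ∈ orbit (T022str n) ↔ Is22 χ :=
  ⟨(is22_T022str hn).of_mem_orbit, (is22_T022str hn).mem_orbit⟩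

lemma mem_orbit_T03str (hn : 4 ≤ n) : χ ∈ orbit (T03str n) ↔ Is03 χ :=
  ⟨(is03_T03str hn).of_mem_orbit, (is03_T03str hn).mem_orbit⟩

lemma mem_orbit_etaStr (hn : 5 ≤ n) : χ ∈ orbit (etaStr n 2) ↔ IsEta χ :=
  ⟨(isEta_etaStr hn).of_mem_orbit, (isEta_etaStr hn).mem_orbit⟩

lemma mem_orbit_kE4str (hn : 2 ≤ n) : χ ∈ orbit (kE4str n) ↔ IsE χ :=
  ⟨(isE_kE4str hn).of_mem_orbit, (isE_kE4str hn).mem_orbit⟩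

end Named

/-! ### Equations which pass to degenerations -/

/-- All homogeneous equations which follow from `R` are satisfied by `(v, χ)`. -/
def SatisfiesEqs {σ : Type} {n : ℕ} (R : (σ → k) → AlgStr k n → Prop) (v : σ → k)
    (χ : AlgStr k n) : Prop :=
  ∀ d F, HomPoly d F → (∀ v' μ', R v' μ' → F v' μ' = 0) → F v χ = 0

namespace SatisfiesEqs

variable {σ : Type} {n : ℕ} {R : (σ → k) → AlgStr k n → Prop} {v : σ → k} {χ : AlgStr k n}

lemma eq_zero (h : SatisfiesEqs R v χ) {d : ℕ} {F : (σ → k) → AlgStr k n → Fin n → k}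
    (hF : HomPolyV d F) (h0 : ∀ v' μ', R v' μ' → F v' μ' = 0) : F v χ = 0 :=
  funext fun i => h d _ (hF i) fun v' μ' hR => congrFun (h0 v' μ' hR) i

lemma smul (h : SatisfiesEqs R v χ) (c : k) : SatisfiesEqs R (c • v) χ := fun d F hF h0 => by
  rw [hF.smul_eq, h d F hF h0, mul_zero]

end SatisfiesEqs

lemma satisfiesEqs_of_degenerates {n : ℕ} {μ χ : AlgStr k n} (hd : degenerates μ χ)
    (R : AlgStr k n → Prop) (h0 : ∀ μ' ∈ orbit μ, R μ') :
    SatisfiesEqs (fun (_ : Unit → k) => R) 1 χ := fun d F hF h => by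
  obtain ⟨Q, -, hQ⟩ := hF
  have key : ∀ ν : AlgStr k n, F 1 ν = MvPolynomial.eval (structConst ν)
      (MvPolynomial.eval (fun _ => 1) Q) := fun ν => by
    rw [hQ]
    clear hQ
    induction Q using MvPolynomial.induction_on <;> simp_all
  exact hd {ν | F 1 ν = 0} ⟨{MvPolynomial.eval (fun _ => 1) Q}, fun ν => by simp [key]⟩
    fun ν hν => h 1 ν (h0 ν hν)

/-- The functional with given coefficients. -/
def functional {n : ℕ} (c : Fin n → k) : (Fin n → k) →ₗ[k] k := ∑ i, c i • LinearMap.proj i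

lemma functional_apply {n : ℕ} (c x : Fin n → k) : functional c x = ∑ i, c i * x i := by
  simp [functional, LinearMap.sum_apply]

lemma exists_functional {n : ℕ} (h : (Fin n → k) →ₗ[k] k) : ∃ c, functional c = h :=
  ⟨fun i => h (Pi.single i 1), by ext i; simp [functional_apply, Pi.single_apply]⟩

lemma functional_eq_zero {n : ℕ} {c : Fin n → k} : functional c = 0 ↔ c = 0 := by
  refine ⟨fun h => funext fun i => ?_, fun h => by ext; simp [functional_apply, h]⟩
  simpa [functional_apply, Pi.single_apply] using LinearMap.congr_fun h (Pi.single i 1)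

lemma HomPoly.functional {σ : Type} {n d : ℕ} {F : (σ → k) → AlgStr k n → Fin n → k}
    (f : Fin n → σ) (hF : HomPolyV d F) :
    HomPoly (1 + d) (fun v χ => functional (fun i => v (f i)) (F v χ)) := by
  simp only [functional_apply]
  exact HomPoly.sum _ fun i => (HomPoly.coord (f i)).mul (hF i)

/-- The bilinear map `(x, y) ↦ β h(x) y + γ h(y) x`. -/
def scalarAlg {n : ℕ} (β γ : k) (h : (Fin n → k) →ₗ[k] k) : AlgStr k n :=
  h.smulRight (β • LinearMap.id) + (h.smulRight (γ • LinearMap.id)).flip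

lemma scalarAlg_apply {n : ℕ} (β γ : k) (h : (Fin n → k) →ₗ[k] k) (x y : Fin n → k) :
    scalarAlg β γ h x y = (β * h x) • y + (γ * h y) • x := by
  simp only [scalarAlg, LinearMap.add_apply, LinearMap.smulRight_apply, LinearMap.smul_apply,
    LinearMap.flip_apply, LinearMap.id_apply]
  module

/-- The difference of `t χ` and `scalarAlg β γ h`, where `v = (t, h)`. -/
def pencil {n : ℕ} (β γ : k) (v : Option (Fin n) → k) (χ : AlgStr k n) : AlgStr k n :=
  v none • χ - scalarAlg β γ (functional fun i => v (some i))

lemma HomPolyV.pencil {n d e : ℕ} (β γ : k)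
    {F G : (Option (Fin n) → k) → AlgStr k n → Fin n → k}
    (hF : HomPolyV d F) (hG : HomPolyV e G) :
    HomPolyV (1 + (d + e)) (fun v χ => pencil β γ v χ (F v χ) (G v χ)) := by
  simp only [_root_.pencil, LinearMap.sub_apply, LinearMap.smul_apply, scalarAlg_apply]
  refine HomPolyV.sub (HomPolyV.smul (HomPoly.coord none) (hF.bilin hG)) (HomPolyV.add ?_ ?_)
  · have := HomPolyV.smul ((HomPoly.functional some hF).const_mul β) hG
    rwa [add_assoc] at this
  · have := HomPolyV.smul ((HomPoly.functional some hG).const_mul γ) hF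
    rwa [add_assoc, add_comm e d] at this

/-! ### Linear algebra -/

section LinAlg

variable {n : ℕ}

lemma exists_dual_ne_zero {x : Fin n → k} (hx : x ≠ 0) :
    ∃ g : (Fin n → k) →ₗ[k] k, g x = 1 := by
  obtain ⟨i, hi⟩ := Function.ne_iff.mp hx
  exact ⟨(x i)⁻¹ • LinearMap.proj i, by simpa using inv_mul_cancel₀ hi⟩

lemma exists_eq_one {W : Type*} [AddCommGroup W] [Module k W] {h : W →ₗ[k] k} (hh : h ≠ 0) :
    ∃ x, h x = 1 := by
  obtain ⟨x, hx⟩ := DFunLike.ne_iff.mp hh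
  exact ⟨(h x)⁻¹ • x, by simpa using inv_mul_cancel₀ hx⟩

/-- Vectors all of whose determinants vanish are linearly dependent. -/
lemma not_linearIndependent_of_det {m : ℕ} {v : Fin m → Fin n → k}
    (h : ∀ g : Fin m → (Fin n → k) →ₗ[k] k, (Matrix.of fun i j => g j (v i)).det = 0) :
    ¬ LinearIndependent k v := fun hv => by
  obtain ⟨θ, hθ⟩ := exists_dual_family hv
  have h1 := h θ
  have : (Matrix.of fun i j => θ j (v i)) = 1 := by
    ext i j; simp [hθ, Matrix.one_apply, eq_comm]
  rw [this, Matrix.det_one] at h1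
  exact one_ne_zero h1

lemma det_eq_zero_of_dependent {m : ℕ} {v : Fin m → Fin n → k} (hv : ¬ LinearIndependent k v)
    (g : Fin m → (Fin n → k) →ₗ[k] k) : (Matrix.of fun i j => g j (v i)).det = 0 := by
  rw [Fintype.not_linearIndependent_iff] at hv
  obtain ⟨c, hc, i, hi⟩ := hv
  refine Matrix.exists_vecMul_eq_zero_iff.mp ⟨c, fun h => hi (congrFun h i), ?_⟩
  funext j
  simpa [Matrix.vecMul, dotProduct] using congrArg (g j) hc

lemma exists_pair (hn : 2 ≤ n) {x : Fin n → k} (hx : x ≠ 0) :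
    ∃ y, LinearIndependent k ![x, y] := by
  by_contra! h
  have h1 : ∀ y, ∃ c : k, c • x = y := fun y => by
    have := h y
    rw [LinearIndependent.pair_iff' hx] at this
    push Not at this
    exact this
  have := finrank_le_one x h1
  rw [Module.finrank_fin_fun] at this
  omega

end LinAlg

/-! ### Closures of the orbits: the algebras `T_ε^{2,(α,β)}` -/

section PluckerForm

variable {n : ℕ}

/-- The Plücker relations, which say that an alternating bilinear map is of the form
`(φ ∧ ψ) ⊗ z`. -/
def Plucker (μ : AlgStr k n) : Prop :=
  ∀ (g : (Fin n → k) →ₗ[k] k) (x y u v : Fin n → k),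
    g (μ x y) • μ u v + g (μ y u) • μ x v + g (μ u x) • μ y v = 0

variable {μ χ : AlgStr k n}

lemma neg_of_alternating (h : ∀ x, μ x x = 0) (x y : Fin n → k) : μ y x = - μ x y := by
  have := h (x + y)
  simp only [map_add, LinearMap.add_apply, h, zero_add, add_zero] at this
  exact eq_neg_of_add_eq_zero_left this

lemma plucker_of_eq {φ ψ : (Fin n → k) →ₗ[k] k} {z : Fin n → k}
    (h : ∀ u v, μ u v = (φ u * ψ v - φ v * ψ u) • z) : Plucker μ := fun g x y u v => by
  simp only [h, map_smul, smul_smul, smul_eq_mul, ← add_smul]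
  convert zero_smul k z using 2
  ring

lemma Plucker.exists_form (hp : Plucker μ) (halt : ∀ x, μ x x = 0) {x y : Fin n → k}
    (hxy : μ x y ≠ 0) : ∃ φ ψ : (Fin n → k) →ₗ[k] k, φ x = 1 ∧ φ y = 0 ∧ ψ x = 0 ∧ ψ y = 1 ∧
      ∀ u v, μ u v = (φ u * ψ v - φ v * ψ u) • μ x y := by
  obtain ⟨g, hg⟩ := exists_dual_ne_zero hxy
  have hneg := neg_of_alternating halt
  refine ⟨g ∘ₗ μ.flip y, g ∘ₗ μ x, by simpa, by simp [halt], by simp [halt], by simpa, ?_⟩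
  have h1 : ∀ u v, μ u v = g (μ u y) • μ x v + g (μ x u) • μ y v := fun u v => by
    have := hp g x y u v
    rw [hg, one_smul, hneg u y, hneg x u, map_neg, map_neg, neg_smul, neg_smul] at this
    rw [← sub_eq_zero, ← this]
    abel
  have h2 : ∀ u, μ y u = - (g (μ u y) • μ x y) := fun u => by
    have := h1 u y
    rw [halt y, smul_zero, add_zero] at this
    rw [hneg u y, this]
    simp [hg]
  have h3 : ∀ u, μ x u = g (μ x u) • μ x y := fun u => by
    have := h1 u x
    rw [halt x, smul_zero, zero_add, hneg x y] at this
    rw [hneg u x, this, smul_neg, neg_neg, map_smul, hg, smul_eq_mul, mul_one]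
  intro u v
  rw [h1 u v, h2 v, h3 v]
  simp only [LinearMap.comp_apply, LinearMap.flip_apply]
  module

lemma exists_ne_zero_of_eq_zero (hn : 3 ≤ n) (h ψ : (Fin n → k) →ₗ[k] k) :
    ∃ w ≠ 0, h w = 0 ∧ ψ w = 0 := by
  have hk := LinearMap.ker_ne_bot_of_finrank_lt (f := h.prod ψ) (by simp; omega)
  obtain ⟨w, hw, hw0⟩ := (Submodule.ne_bot_iff _).mp hk
  have : h w = 0 ∧ ψ w = 0 := by simpa using hw
  exact ⟨w, hw0, this⟩

lemma IsT.of {ε β δ : k} (hn : 3 ≤ n) {h ψ : (Fin n → k) →ₗ[k] k} {x y z : Fin n → k}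
    (hx : h x = 1) (hy : h y = 0) (px : ψ x = 0) (py : ψ y = 1) (hz : h z = 0) (pz : ψ z = δ)
    (z0 : z ≠ 0) (hμ : ∀ a b, μ a b =
      (β * h a) • b + ((ε - β) * h b) • a + (h a * ψ b - h b * ψ a) • z) : IsT ε β δ μ := by
  by_cases hzy : z = δ • y
  · obtain ⟨w, w0, hw, pw⟩ := exists_ne_zero_of_eq_zero hn h ψ
    have hδ : δ ≠ 0 := by rintro rfl; exact z0 (by simpa using hzy)
    refine ⟨h, ψ, x, y + w, -(δ • w), hx, by simp [hy, hw], by simp [hw], px, by simp [py, pw],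
      by simp [pw], by simp [hδ, w0], fun a b => ?_⟩
    rw [hμ, hzy, smul_add]
    simp
  · exact ⟨h, ψ, x, y, z - δ • y, hx, hy, by simp [hz, hy], px, py, by simp [pz, py],
      sub_ne_zero.mpr hzy, fun a b => by rw [hμ]; simp⟩

/-- The algebras of level at most one and generation type one. -/
def IsSmall (μ : AlgStr k n) : Prop := IsD μ ∨ IsT 0 0 0 μ

lemma IsT.zero_iff : IsT 0 0 0 μ ↔ ∃ (h ψ : (Fin n → k) →ₗ[k] k) (x y z : Fin n → k),
    h x = 1 ∧ h y = 0 ∧ h z = 0 ∧ ψ x = 0 ∧ ψ y = 1 ∧ ψ z = 0 ∧ z ≠ 0 ∧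
      ∀ a b, μ a b = (h a * ψ b - h b * ψ a) • z := by
  simp [IsT]

lemma eq_zero_or_isT_zero (halt : ∀ x, χ x x = 0) (hp : Plucker χ)
    (hnil : ∀ x y, χ x (χ x y) = 0) : χ = 0 ∨ IsT 0 0 0 χ := by
  by_cases h0 : χ = 0
  · exact Or.inl h0
  obtain ⟨x, hx⟩ := DFunLike.ne_iff.mp h0
  obtain ⟨y, hy⟩ := DFunLike.ne_iff.mp hx
  replace hy : χ x y ≠ 0 := hy
  obtain ⟨φ, ψ, h1, h2, h3, h4, h⟩ := hp.exists_form halt hy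
  have hψ := hnil x y
  rw [h x, h1, h3, smul_eq_zero_iff_left hy] at hψ
  have hφ := hnil y x
  rw [neg_of_alternating halt x y, map_neg, h y, h2, h4, neg_eq_zero,
    smul_eq_zero_iff_left hy] at hφ
  exact Or.inr (IsT.zero_iff.mpr ⟨φ, ψ, x, y, χ x y, h1, h2, by simpa using hφ, h3, h4,
    by simpa using hψ, hy, h⟩)

lemma isSmall_of_nilpotent (halt : ∀ x, χ x x = 0) (hp : Plucker χ)
    (hnil : ∀ x y, χ x (χ x y) = 0) : IsSmall χ :=
  (eq_zero_or_isT_zero halt hp hnil).imp (fun h => ⟨0, 0, 0, by simp [h]⟩) id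

lemma IsT.alternating {β δ : k} (h : IsT 0 β δ μ) (x : Fin n → k) : μ x x = 0 := by
  obtain ⟨h, ψ, x, y, z, -, -, -, -, -, -, -, hμ⟩ := h
  rw [hμ]
  module

lemma HomPolyV.plucker {σ : Type} {d : ℕ} {L : (σ → k) → AlgStr k n → AlgStr k n}
    (hL : ∀ x y, HomPolyV d fun v χ => L v χ x y) (g : (Fin n → k) →ₗ[k] k)
    (x y u w : Fin n → k) : HomPolyV (d + d) fun v χ =>
      g (L v χ x y) • L v χ u w + g (L v χ y u) • L v χ x w + g (L v χ u x) • L v χ y w :=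
  ((HomPolyV.smul ((hL _ _).apply g) (hL _ _)).add (HomPolyV.smul ((hL _ _).apply g) (hL _ _))).add
    (HomPolyV.smul ((hL _ _).apply g) (hL _ _))

lemma eq_zero_or_isT_zero_of_degenerates (hμ : IsT 0 0 0 μ) (hd : degenerates μ χ) :
    χ = 0 ∨ IsT 0 0 0 χ := by
  have hS := satisfiesEqs_of_degenerates hd
    (fun ν => (∀ x, ν x x = 0) ∧ Plucker ν ∧ ∀ x y, ν x (ν x y) = 0) fun ν hν => by
      obtain ⟨h, ψ, x, y, z, hx, hy, hz, px, py, pz, z0, hν⟩ :=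
        IsT.zero_iff.mp (hμ.of_mem_orbit hν)
      exact ⟨fun x => by simp [hν], plucker_of_eq hν, fun x y => by simp [hν, hz, pz]⟩
  exact eq_zero_or_isT_zero (fun x => hS.eq_zero (HomPolyV.bilin' x x) fun _ _ h => h.1 x)
    (fun g x y u w => hS.eq_zero (HomPolyV.plucker (fun a b => HomPolyV.bilin' a b) g x y u w)
      fun _ _ h => h.2.1 g x y u w)
    fun x y => hS.eq_zero ((HomPolyV.const x).bilin (HomPolyV.bilin' x y)) fun _ _ h => h.2.2 x y

lemma IsT.of_form (hn : 3 ≤ n) {δ : k} (hδ : δ ≠ 0) {φ ψ : (Fin n → k) →ₗ[k] k}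
    {x y z : Fin n → k} (hx : φ x = 1) (hy : φ y = 0) (px : ψ x = 0) (py : ψ y = 1)
    (hz : ψ z ≠ 0) (h : ∀ u v, χ u v = (φ u * ψ v - φ v * ψ u) • z) : IsT 0 0 δ χ := by
  refine IsT.of (h := δ⁻¹ • (ψ z • φ - φ z • ψ)) (ψ := (δ / ψ z) • ψ) (x := (δ / ψ z) • x)
    (y := (ψ z / δ) • (y + (φ z / ψ z) • x)) (z := z) hn ?_ ?_ ?_ ?_ ?_ ?_ ?_ fun a b => ?_
  · simp [hx, px]; field_simp
  · simp [hx, px, hy, py]; field_simp; simp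
  · simp [px]
  · simp [px, py]; field_simp
  · simp; right; ring
  · simp; field_simp
  · rintro rfl; simp at hz
  · rw [h]
    simp only [LinearMap.smul_apply, LinearMap.sub_apply, smul_eq_mul, sub_self, zero_mul,
      zero_smul, zero_add]
    congr 1
    field_simp
    ring

lemma IsT.degenerates_zero_zero (hn : 3 ≤ n) {δ : k} (hδ : δ ≠ 0) (hμ : IsT 0 0 δ μ)
    (hd : degenerates μ χ) : IsSmall χ ∨ IsT 0 0 δ χ := by
  have hS := satisfiesEqs_of_degenerates hd
    (fun ν => (∀ x, ν x x = 0) ∧ Plucker ν) fun ν hν => by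
      have hν' := hμ.of_mem_orbit hν
      refine ⟨hν'.alternating, ?_⟩
      obtain ⟨h, ψ, x, y, z, hx, hy, hz, px, py, pz, z0, hν⟩ := hν'
      exact plucker_of_eq (φ := h) (ψ := ψ) (z := δ • y + z) fun a b => by rw [hν]; simp
  have halt : ∀ x, χ x x = 0 := fun x =>
    hS.eq_zero (HomPolyV.bilin' x x) fun _ _ h => h.1 x
  have hp : Plucker χ := fun g x y u w =>
    hS.eq_zero (HomPolyV.plucker (fun a b => HomPolyV.bilin' a b) g x y u w)
      fun _ _ h => h.2 g x y u w
  by_cases hnil : ∀ x y, χ x (χ x y) = 0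
  · exact Or.inl (isSmall_of_nilpotent halt hp hnil)
  push Not at hnil
  obtain ⟨x, y, hxy⟩ := hnil
  have h0 : χ x y ≠ 0 := fun h => hxy (by simp [h])
  obtain ⟨φ, ψ, h1, h2, h3, h4, h⟩ := hp.exists_form halt h0
  refine Or.inr (IsT.of_form hn hδ h1 h2 h3 h4 (fun hz => hxy ?_) h)
  rw [h x (χ x y), hz, h3]; simp

end PluckerForm

section PencilClosure

variable {n : ℕ} {μ χ : AlgStr k n}

/-- The equations satisfied by the algebras `T_ε^{2,(β+δ,β)}` and their functional `h`. -/
def TEqs (δ : k) (L : AlgStr k n) (h : (Fin n → k) →ₗ[k] k) : Prop :=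
  (∀ x, L x x = 0) ∧ (∀ x y u, h x • L y u + h y • L u x + h u • L x y = 0) ∧
    (∀ x y, h (L x y) = 0) ∧ (∀ x y, L x (L x y) - (δ * h x) • L x y = 0) ∧ Plucker L

lemma TEqs.exists_form {δ : k} {L : AlgStr k n} {h : (Fin n → k) →ₗ[k] k} (hL : TEqs δ L h)
    {x : Fin n → k} (hx : h x = 1) (h0 : L ≠ 0) :
    ∃ (ψ : (Fin n → k) →ₗ[k] k) (y z : Fin n → k), h y = 0 ∧ ψ x = 0 ∧ ψ y = 1 ∧ h z = 0 ∧
      ψ z = δ ∧ z ≠ 0 ∧ ∀ a b, L a b = (h a * ψ b - h b * ψ a) • z := by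
  obtain ⟨halt, hw, hh, hδ, hp⟩ := hL
  have hneg := neg_of_alternating halt
  have hN : ∀ y u, L y u = h y • L x u - h u • L x y := fun y u => by
    have := hw x y u
    rw [hx, one_smul, hneg x u, smul_neg] at this
    rw [← sub_eq_zero, ← this]; abel
  obtain ⟨y, hy⟩ : ∃ y, L x y ≠ 0 := by
    by_contra! hcon
    exact h0 (LinearMap.ext₂ fun a b => by rw [hN]; simp [hcon])
  have hy' : L x (y - h y • x) = L x y := by simp [halt]
  rw [← hy'] at hy
  obtain ⟨φ, ψ, h1, h2, h3, h4, hf⟩ := hp.exists_form halt hy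
  refine ⟨ψ, y - h y • x, _, by simp [hx], h3, h4, hh _ _, ?_, hy, fun a b => ?_⟩
  · have := hδ x (y - h y • x)
    rw [hf x, h1, h3, hx, ← sub_smul, smul_eq_zero_iff_left hy] at this
    simpa [sub_eq_zero] using this
  · rw [hN, hf x a, hf x b, h1, h3]
    module

lemma pencil_apply (β γ : k) (v : Option (Fin n) → k) (χ : AlgStr k n) (x y : Fin n → k) :
    pencil β γ v χ x y = v none • χ x y - ((β * functional (fun i => v (some i)) x) • y +
      (γ * functional (fun i => v (some i)) y) • x) := by
  rw [← scalarAlg_apply]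
  rfl

lemma IsT.degenerates [IsAlgClosed k] (hn : 3 ≤ n) {ε β δ : k} (hεβ : ε ≠ 0 ∨ β ≠ 0)
    (hμ : IsT ε β δ μ) (hd : degenerates μ χ) : IsSmall χ ∨ IsT ε β δ χ := by
  obtain ⟨v, hv, hS⟩ := exists_zero_of_degenerates hd
    (fun v ν => TEqs δ (pencil β (ε - β) v ν) (functional fun i => v (some i))) fun ν hν => by
      obtain ⟨h, ψ, x, y, z, hx, hy, hz, px, py, pz, z0, hν⟩ := hμ.of_mem_orbit hν
      obtain ⟨c, hc⟩ := exists_functional h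
      refine ⟨fun o => o.elim 1 c, fun h => one_ne_zero (congrFun h none), ?_⟩
      have hL : ∀ a b, pencil β (ε - β) (fun o => o.elim 1 c) ν a b =
          (h a * ψ b - h b * ψ a) • (δ • y + z) := fun a b => by
        simp only [pencil_apply, hν, Option.elim_none, Option.elim_some, hc, one_smul]
        abel
      simp only [Option.elim_some, hc]
      refine ⟨fun a => ?_, fun a b c => ?_, fun a b => ?_, fun a b => ?_, plucker_of_eq hL⟩
      · rw [hL]; module
      · rw [hL, hL, hL]; module
      · rw [hL]; simp [hy, hz]
      · rw [hL a b, hL a]; simp [hy, hz, py, pz]; module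
  change SatisfiesEqs _ v χ at hS
  have hpen : ∀ x y, HomPolyV 1 fun v (χ : AlgStr k n) => pencil β (ε - β) v χ x y :=
    fun x y => HomPolyV.pencil β (ε - β) (HomPolyV.const x) (HomPolyV.const y)
  have hfun : ∀ x, HomPoly 1 fun (v : Option (Fin n) → k) (χ : AlgStr k n) =>
      functional (fun i => v (some i)) x :=
    fun x => HomPoly.functional some (HomPolyV.const x)
  have key : ∀ w : Option (Fin n) → k, SatisfiesEqs (fun v ν => TEqs δ (pencil β (ε - β) v ν)
      (functional fun i => v (some i))) w χ →
      TEqs δ (pencil β (ε - β) w χ) (functional fun i => w (some i)) := fun w hS => by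
    refine ⟨fun x => hS.eq_zero (hpen x x) fun _ _ h => h.1 x,
      fun x y u => hS.eq_zero (d := 2) (((HomPolyV.smul (hfun x) (hpen y u)).add
        (HomPolyV.smul (hfun y) (hpen u x))).add (HomPolyV.smul (hfun u) (hpen x y))) fun _ _ h => h.2.1 x y u,
      fun x y => hS _ _ (HomPoly.functional some (hpen x y)) fun _ _ h => h.2.2.1 x y,
      fun x y => hS.eq_zero (d := 2) ((HomPolyV.pencil β (ε - β) (HomPolyV.const x)
        (hpen x y)).sub (HomPolyV.smul ((hfun x).const_mul δ) (hpen x y))) fun _ _ h => h.2.2.2.1 x y,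
      fun g x y u w => hS.eq_zero (HomPolyV.plucker hpen g x y u w)
        fun _ _ h => h.2.2.2.2 g x y u w⟩
  by_cases ht : v none = 0
  · exfalso
    have hE := key v hS
    set h := functional fun i => v (some i) with hh
    have h0 : h ≠ 0 := fun h0 => hv <| by
      have := functional_eq_zero.mp h0
      funext o
      cases o with
      | none => exact ht
      | some i => exact congrFun this i
    have hL : ∀ a b, pencil β (ε - β) v χ a b = -((β * h a) • b + ((ε - β) * h b) • a) :=
      fun a b => by
        simp only [pencil_apply, ht, zero_smul, zero_sub, hh]
    obtain ⟨halt, -, -, -, hp⟩ := hE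
    obtain ⟨x, hx⟩ := exists_eq_one h0
    have hε : ε = 0 := by
      have h1 := halt x
      have hx0 : x ≠ 0 := by rintro rfl; simp at hx
      rw [hL, hx, ← add_smul, neg_eq_zero, smul_eq_zero_iff_left hx0] at h1
      simpa using h1
    obtain ⟨y, y0, hy, -⟩ := exists_ne_zero_of_eq_zero hn h 0
    obtain ⟨g, hg⟩ := exists_dual_ne_zero y0
    obtain ⟨u, u0, hu, gu⟩ := exists_ne_zero_of_eq_zero hn h g
    have h1 := hp g x y u x
    simp only [hL] at h1
    simp only [hx, hy, hu, map_neg, map_add, map_smul, hg, gu, hε] at h1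
    simp [u0] at h1
    rcases hεβ with h | h
    · exact h hε
    · exact h h1
  · replace hS := hS.smul (v none)⁻¹
    have hE := key _ hS
    have ht1 : ((v none)⁻¹ • v) none = 1 := by simp [ht]
    generalize (v none)⁻¹ • v = w at hE ht1
    set h := functional fun i => w (some i) with hh
    have hχ : ∀ a b, χ a b = (β * h a) • b + ((ε - β) * h b) • a + pencil β (ε - β) w χ a b :=
      fun a b => by
        simp only [pencil_apply, ht1, one_smul, hh]
        abel
    by_cases h0 : h = 0
    · have : pencil β (ε - β) w χ = χ := LinearMap.ext₂ fun a b => by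
        rw [hχ a b]; simp [h0]
      rw [this, h0] at hE
      exact Or.inl (isSmall_of_nilpotent hE.1 hE.2.2.2.2 fun x y => by simpa using hE.2.2.2.1 x y)
    obtain ⟨x, hx⟩ := exists_eq_one h0
    by_cases hL0 : pencil β (ε - β) w χ = 0
    · exact Or.inl (Or.inl ⟨β, ε - β, h, fun a b => by rw [hχ, hL0]; simp⟩)
    obtain ⟨ψ, y, z, hy, px, py, hz, pz, z0, hform⟩ := hE.exists_form hx hL0
    exact Or.inr (IsT.of hn hx hy px py hz pz z0 fun a b => by rw [hχ, hform])

end PencilClosure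

/-! ### Closures of the orbits: the algebras in which any two elements span a subalgebra -/

section SpanClosure

variable {n : ℕ} {μ χ : AlgStr k n}

lemma isE_or_isD {a b : (Fin n → k) →ₗ[k] k} (h : ∀ u v, μ u v = a u • v + b v • u) :
    IsE μ ∨ IsD μ := by
  by_cases ha : a = 0
  · exact Or.inr ⟨0, 1, b, fun u v => by simp [h, ha]⟩
  obtain ⟨x, hx⟩ := exists_eq_one ha
  by_cases hb : ∀ y, a y = 0 → b y = 0
  · refine Or.inr ⟨1, b x, a, fun u v => ?_⟩
    have := hb (v - a v • x) (by simp [hx])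
    rw [map_sub, map_smul, smul_eq_mul, sub_eq_zero] at this
    rw [h, this, one_mul, mul_comm]
  · push Not at hb
    obtain ⟨y, hy, hby⟩ := hb
    exact Or.inl ⟨a, b, x - (b x / b y) • y, (b y)⁻¹ • y,
      ⟨by simp [hx, hy], by simp [hy], by simp [hby], by simp [hby]⟩, h⟩

/-- The defect of `v = (t, a, b)` in the equation `t χ(x, y) = a(x) y + b(y) x`. -/
def spanDefect (v : Option (Fin n ⊕ Fin n) → k) (χ : AlgStr k n) (x y : Fin n → k) : Fin n → k :=
  v none • χ x y - (functional (fun i => v (some (.inl i))) x • y +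
    functional (fun i => v (some (.inr i))) y • x)

lemma HomPoly.functional' {σ : Type} (f : Fin n → σ) (x : Fin n → k) :
    HomPoly 1 (fun v (_ : AlgStr k n) => _root_.functional (fun i => v (f i)) x) :=
  HomPoly.functional f (HomPolyV.const x)

lemma homPolyV_spanDefect (x y : Fin n → k) :
    HomPolyV 1 (fun v (χ : AlgStr k n) => spanDefect v χ x y) := by
  unfold spanDefect
  exact (HomPolyV.smul (HomPoly.coord _) (HomPolyV.bilin' x y)).sub
    ((HomPolyV.smul (HomPoly.functional' _ x) (HomPolyV.const y)).add
      (HomPolyV.smul (HomPoly.functional' _ y) (HomPolyV.const x)))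

lemma IsE.degenerates [IsAlgClosed k] (hμ : IsE μ) (hd : degenerates μ χ) : IsSmall χ ∨ IsE χ := by
  obtain ⟨v, hv, hS⟩ := exists_zero_of_degenerates hd
    (fun v ν => ∀ x y, spanDefect v ν x y = 0) fun ν hν => by
      obtain ⟨a, b, x, y, -, hν⟩ := hμ.of_mem_orbit hν
      obtain ⟨c, rfl⟩ := exists_functional a
      obtain ⟨d, rfl⟩ := exists_functional b
      exact ⟨fun o => o.elim 1 (Sum.elim c d), fun h => one_ne_zero (congrFun h none),
        fun x y => by simp [spanDefect, hν]⟩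
  change SatisfiesEqs _ v χ at hS
  have h : ∀ x y, v none • χ x y = functional (fun i => v (some (.inl i))) x • y +
      functional (fun i => v (some (.inr i))) y • x := fun x y => sub_eq_zero.mp <|
    hS.eq_zero (homPolyV_spanDefect x y) fun _ _ h => h x y
  by_cases ht : v none = 0
  · exfalso
    obtain ⟨a, b, x, y, ⟨h1, h2, h3, h4⟩, -⟩ := hμ
    have hli : LinearIndependent k ![x, y] := by
      rw [LinearIndependent.pair_iff]
      intro s t hst
      exact ⟨by simpa [h1, h2] using congrArg a hst, by simpa [h3, h4] using congrArg b hst⟩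
    have hn : 2 ≤ n := by simpa using hli.fintype_card_le_finrank
    simp only [ht, zero_smul] at h
    have hz : ∀ x, functional (fun i => v (some (.inl i))) x = 0 ∧
        functional (fun i => v (some (.inr i))) x = 0 := fun x => by
      by_cases hx : x = 0
      · simp [hx]
      obtain ⟨y, hy⟩ := exists_pair hn hx
      rw [LinearIndependent.pair_iff] at hy
      exact ⟨(hy _ _ ((add_comm _ _).trans (h x y).symm)).2, (hy _ _ (h y x).symm).2⟩
    have e1 := functional_eq_zero.mp (LinearMap.ext fun x => (hz x).1)
    have e2 := functional_eq_zero.mp (LinearMap.ext fun x => (hz x).2)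
    refine hv (funext fun o => ?_)
    match o with
    | none => exact ht
    | some (.inl i) => exact congrFun e1 i
    | some (.inr i) => exact congrFun e2 i
  · refine (isE_or_isD (a := (v none)⁻¹ • functional fun i => v (some (.inl i)))
      (b := (v none)⁻¹ • functional fun i => v (some (.inr i))) fun x y => ?_).symm.imp Or.inl id
    simp only [LinearMap.smul_apply, smul_assoc, ← smul_add, ← h]
    rw [inv_smul_smul₀ ht]

lemma mem_orbit_of_isD {a b : k} {h h' : (Fin n → k) →ₗ[k] k}
    (hμ : ∀ u v, μ u v = (a * h u) • v + (b * h v) • u)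
    (hχ : ∀ u v, χ u v = (a * h' u) • v + (b * h' v) • u) (h0 : h ≠ 0) (h0' : h' ≠ 0) :
    χ ∈ orbit μ := by
  have key : ∀ {h : (Fin n → k) →ₗ[k] k} {ν : AlgStr k n}, h ≠ 0 →
      (∀ u v, ν u v = (a * h u) • v + (b * h v) • u) →
      ∃ (hm : 1 ≤ n) (b' : Module.Basis (Fin n) k (Fin n → k)), ∀ i j, ν (b' i) (b' j) =
      (a * b'.repr (b' i) (Fin.castLE hm 0)) • b' j +
        (b * b'.repr (b' j) (Fin.castLE hm 0)) • b' i := by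
    intro h ν h0 hν
    obtain ⟨x, hx⟩ := exists_eq_one h0
    have hx0 : x ≠ 0 := by rintro rfl; simp at hx
    obtain ⟨hm, b', -, hb'⟩ := exists_adapted_basis (v := ![x])
      (LinearIndependent.of_subsingleton 0 (by simpa)) (fun _ => True) ![h] (by
        intro i hi j
        fin_cases i; fin_cases j; simp [hx])
    refine ⟨hm, b', fun i j => ?_⟩
    have e0 := hb' 0 trivial
    simp only [Matrix.cons_val] at e0
    rw [hν, e0, e0]
  obtain ⟨hm, c, hc⟩ := key h0 hμ
  obtain ⟨_, c', hc'⟩ := key h0' hχ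
  refine mem_orbit_of_bases c c' fun i j m => ?_
  rw [hc, hc']
  simp

lemma eq_zero_of_degenerates_zero (hd : degenerates (0 : AlgStr k n) χ) : χ = 0 := by
  have hS := satisfiesEqs_of_degenerates hd (fun ν => ν = 0) fun ν hν => mem_orbit_zero.mp hν
  exact LinearMap.ext₂ fun x y => hS.eq_zero (HomPolyV.bilin' x y) fun _ _ h => by simp [h]

lemma IsD.degenerates [IsAlgClosed k] (hn : 2 ≤ n) (hμ : IsD μ) (hd : degenerates μ χ) :
    χ = 0 ∨ χ ∈ orbit μ := by
  obtain ⟨a, b, h, hμ⟩ := hμ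
  by_cases hμ0 : μ = 0
  · subst hμ0
    exact Or.inl (eq_zero_of_degenerates_zero hd)
  obtain ⟨v, hv, hS⟩ := exists_zero_of_degenerates hd
    (fun (v : Option (Fin n) → k) ν => ∀ x y, pencil a b v ν x y = 0) fun ν hν => by
      obtain ⟨g, hg⟩ := mem_orbit_iff.mp hν
      obtain ⟨c, hc⟩ := exists_functional (h ∘ₗ g.symm.toLinearMap)
      refine ⟨fun o => o.elim 1 c, fun h => one_ne_zero (congrFun h none), fun x y => ?_⟩
      have := hg (g.symm x) (g.symm y)
      simp only [LinearEquiv.apply_symm_apply, hμ, map_add, map_smul] at this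
      simp [pencil_apply, hc, ← this]
  change SatisfiesEqs _ v χ at hS
  have hp : ∀ x y, v none • χ x y = (a * functional (fun i => v (some i)) x) • y +
      (b * functional (fun i => v (some i)) y) • x := fun x y => by
    have := hS.eq_zero (HomPolyV.pencil a b (HomPolyV.const x) (HomPolyV.const y))
      fun _ _ h => h x y
    rwa [pencil_apply, sub_eq_zero] at this
  by_cases ht : v none = 0
  · exfalso
    simp only [ht, zero_smul] at hp
    have h0 : functional (fun i => v (some i)) ≠ 0 := fun h0 => hv <| by
      have := functional_eq_zero.mp h0
      funext o
      cases o with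
      | none => exact ht
      | some i => exact congrFun this i
    obtain ⟨x, hx⟩ := exists_eq_one h0
    have hx0 : x ≠ 0 := by rintro rfl; simp at hx
    obtain ⟨y, hy⟩ := exists_pair hn hx0
    rw [LinearIndependent.pair_iff] at hy
    have ha := (hy _ _ ((add_comm _ _).trans (hp x y).symm)).2
    rw [hx, mul_one] at ha
    have hb := hp x x
    rw [hx, ha, mul_one, mul_one, zero_smul, zero_add, eq_comm, smul_eq_zero_iff_left hx0] at hb
    exact hμ0 (LinearMap.ext₂ fun u v => by rw [hμ, ha, hb]; simp)
  · by_cases h0 : χ = 0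
    · exact Or.inl h0
    right
    have hχ : ∀ u w, χ u w = (a * ((v none)⁻¹ • functional fun i => v (some i)) u) • w +
        (b * ((v none)⁻¹ • functional fun i => v (some i)) w) • u := fun u w => by
      rw [← inv_smul_smul₀ ht (χ u w), hp]
      simp only [LinearMap.smul_apply, smul_eq_mul]
      module
    refine mem_orbit_of_isD hμ hχ ?_ ?_
    · rintro rfl
      exact hμ0 (LinearMap.ext₂ fun u v => by simp [hμ])
    · intro h'
      rw [h'] at hχ
      exact h0 (LinearMap.ext₂ fun u v => by simp [hχ])

lemma IsSmall.not_hasChain_two [IsAlgClosed k] (hn : 2 ≤ n) (hμ : IsSmall μ) :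
    ¬ hasChain μ 2 := by
  rw [hasChain_two]
  rintro ⟨χ, ν, ⟨h1, h1'⟩, h2, h2'⟩
  have h0 : χ = 0 := by
    rcases hμ with h | h
    · exact (h.degenerates hn h1).resolve_right h1'
    · exact (eq_zero_or_isT_zero_of_degenerates h h1).resolve_right fun h' =>
        h1' (h.mem_orbit h')
  subst h0
  exact h2' (mem_orbit_zero.mpr (eq_zero_of_degenerates_zero h2))

/-- Criterion for the absence of chains of length three. -/
lemma not_hasChain_three [IsAlgClosed k] (hn : 2 ≤ n)
    (h : ∀ χ, degenerates μ χ → IsSmall χ ∨ χ ∈ orbit μ) : ¬ hasChain μ 3 := by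
  rw [hasChain_three]
  rintro ⟨χ, ⟨h1, h1'⟩, h2⟩
  exact ((h χ h1).resolve_right h1').not_hasChain_two hn h2

end SpanClosure

/-! ### Closures of the orbits: nilpotent algebras -/

section NilpotentClosure

variable {n : ℕ} {μ χ : AlgStr k n}

/-- The equations saying that `χ = h ∧ N` for an operator `N` with `h N = 0`. -/
def WedgeEqs (χ : AlgStr k n) (h : (Fin n → k) →ₗ[k] k) : Prop :=
  (∀ x, χ x x = 0) ∧ (∀ x y u, h x • χ y u + h y • χ u x + h u • χ x y = 0) ∧
    ∀ x y, h (χ x y) = 0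

lemma WedgeEqs.eq {h : (Fin n → k) →ₗ[k] k} (hw : WedgeEqs χ h) {x : Fin n → k} (hx : h x = 1)
    (y u : Fin n → k) : χ y u = h y • χ x u - h u • χ x y := by
  have := hw.2.1 x y u
  rw [hx, one_smul, neg_of_alternating hw.1 x u, smul_neg] at this
  rw [← sub_eq_zero, ← this]; abel

lemma WedgeEqs.of_eq {h : (Fin n → k) →ₗ[k] k} {N : (Fin n → k) →ₗ[k] (Fin n → k)}
    (h1 : ∀ x y, χ x y = h x • N y - h y • N x) (h2 : ∀ x, h (N x) = 0) : WedgeEqs χ h :=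
  ⟨fun x => by rw [h1, sub_self], fun x y u => by rw [h1, h1, h1]; module,
    fun x y => by rw [h1]; simp [h2]⟩

lemma SatisfiesEqs.wedge {R : (Fin n → k) → AlgStr k n → Prop} {v : Fin n → k}
    (hS : SatisfiesEqs R v χ) (hR : ∀ v' ν, R v' ν → WedgeEqs ν (functional v')) :
    WedgeEqs χ (functional v) := by
  have h1 : ∀ x y u, HomPolyV 1 fun (v : Fin n → k) (χ : AlgStr k n) =>
      functional v x • χ y u := fun x y u =>
    HomPolyV.smul (HomPoly.functional' (fun i => i) x) (HomPolyV.bilin' y u)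
  exact ⟨fun x => hS.eq_zero (HomPolyV.bilin' x x) fun _ _ h => (hR _ _ h).1 x,
    fun x y u => hS.eq_zero (((h1 x y u).add (h1 y u x)).add (h1 u x y))
      fun _ _ h => (hR _ _ h).2.1 x y u,
    fun x y => hS _ _ (HomPoly.functional (fun i => i) (HomPolyV.bilin' x y))
      fun _ _ h => (hR _ _ h).2.2 x y⟩

/-- If `χ = h ∧ N` with `N² = 0` and `N` of rank at most one then `χ` is small. -/
lemma WedgeEqs.isSmall {h : (Fin n → k) →ₗ[k] k} (hw : WedgeEqs χ h) {x : Fin n → k}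
    (hx : h x = 1) (hnil : ∀ y, χ x (χ x y) = 0)
    (hr : ∀ y y', ¬ LinearIndependent k ![χ x y, χ x y']) : IsSmall χ := by
  refine isSmall_of_nilpotent hw.1 ?_ fun a b => ?_
  · by_cases h0 : ∀ y, χ x y = 0
    · exact plucker_of_eq (φ := 0) (ψ := 0) (z := 0) fun u v => by rw [hw.eq hx]; simp [h0]
    push Not at h0
    obtain ⟨y, hy⟩ := h0
    obtain ⟨g, hg⟩ := exists_dual_ne_zero hy
    have hN : ∀ u, χ x u = g (χ x u) • χ x y := fun u => by
      have := hr y u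
      rw [LinearIndependent.pair_iff' hy] at this
      push Not at this
      obtain ⟨c, hc⟩ := this
      rw [← hc, map_smul, hg]; simp
    refine plucker_of_eq (φ := h) (ψ := g ∘ₗ χ x) (z := χ x y) fun u v => ?_
    rw [hw.eq hx, hN u, hN v]
    simp only [LinearMap.comp_apply]
    module
  · rw [hw.eq hx a (χ a b), hw.2.2, zero_smul, sub_zero, hw.eq hx a b]
    simp [hnil]

lemma eq_of_not_linearIndependent_three {z₁ z₂ w : Fin n → k} {g : Fin 2 → (Fin n → k) →ₗ[k] k}
    (hz : LinearIndependent k ![z₁, z₂])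
    (hg : ∀ i j, g i (![z₁, z₂] j) = if i = j then 1 else 0)
    (hw : ¬ LinearIndependent k ![z₁, z₂, w]) : w = g 0 w • z₁ + g 1 w • z₂ := by
  rw [Fintype.not_linearIndependent_iff] at hw
  obtain ⟨c, hc, i, hi⟩ := hw
  rw [LinearIndependent.pair_iff] at hz
  simp only [Fin.sum_univ_three, Matrix.cons_val] at hc
  have hc2 : c 2 ≠ 0 := fun h2 => hi <| by
    have := hz (c 0) (c 1) (by simpa [h2] using hc)
    fin_cases i
    · exact this.1
    · exact this.2
    · exact h2
  have hw : w = (-c 0 / c 2) • z₁ + (-c 1 / c 2) • z₂ := by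
    rw [← sub_eq_zero, ← smul_eq_zero_iff_right hc2, ← hc]
    rw [smul_sub, smul_add, smul_smul, smul_smul, mul_div_cancel₀ _ hc2, mul_div_cancel₀ _ hc2]
    module
  have h00 := hg 0 0
  have h01 := hg 0 1
  have h10 := hg 1 0
  have h11 := hg 1 1
  simp at h00 h01 h10 h11
  rw [hw]
  simp [h00, h01, h10, h11]

lemma exists_relation {m p : ℕ} (hpm : p < m) (c : Fin m → Fin p → k) :
    ∃ a : Fin m → k, a ≠ 0 ∧ ∀ j, ∑ i, a i * c i j = 0 := by
  have : ¬ LinearIndependent k c := fun h => by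
    have := h.fintype_card_le_finrank
    simp at this
    omega
  rw [Fintype.not_linearIndependent_iff] at this
  obtain ⟨a, ha, i, hi⟩ := this
  exact ⟨a, fun h => hi (congrFun h i), fun j => by simpa using congrFun ha j⟩

lemma not_linearIndependent_of_eq_sum {W : Type*} [AddCommGroup W] [Module k W] {m p : ℕ}
    (hpm : p < m) {c : Fin m → Fin p → k} {v : Fin m → W} {z : Fin p → W}
    (hv : ∀ i, v i = ∑ j, c i j • z j) : ¬ LinearIndependent k v := fun h => by
  obtain ⟨a, ha, hac⟩ := exists_relation hpm c
  refine ha (funext (Fintype.linearIndependent_iff.mp h a ?_))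
  simp only [hv, Finset.smul_sum, smul_smul]
  rw [Finset.sum_comm]
  simp only [← Finset.sum_smul, hac, zero_smul, Finset.sum_const_zero]

/-- The equations of the algebras isomorphic to `T_0^{2,2}`. -/
def Eqs22 (χ : AlgStr k n) : Prop :=
  (∀ x y, χ x (χ x y) = 0) ∧ ∀ (x y : Fin 3 → Fin n → k) (g : Fin 3 → (Fin n → k) →ₗ[k] k),
    (Matrix.of fun i j => g j (χ (x i) (y i))).det = 0

lemma Is22.degenerates [IsAlgClosed k] (hμ : Is22 μ) (hd : degenerates μ χ) :
    IsSmall χ ∨ Is22 χ := by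
  obtain ⟨v, hv, hS⟩ := exists_zero_of_degenerates hd
    (fun v ν => WedgeEqs ν (functional v) ∧ Eqs22 ν) fun ν hν => by
      obtain ⟨h, ψ₁, ψ₂, x, y₁, y₂, z₁, z₂, ⟨h1, h2, h3, h4, h5⟩, ⟨p1, p2, p3, p4, p5⟩,
        ⟨q1, q2, q3, q4, q5⟩, hz, hν⟩ := hμ.of_mem_orbit hν
      obtain ⟨c, rfl⟩ := exists_functional h
      refine ⟨c, fun h => ?_, WedgeEqs.of_eq
        (N := ψ₁.smulRight z₁ + ψ₂.smulRight z₂) (fun a b => ?_) fun a => ?_,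
        fun a b => ?_, fun x y g => ?_⟩
      · rw [functional_eq_zero.mpr h] at h1; simp at h1
      · rw [hν]; simp; module
      · simp [h4, h5]
      · rw [hν a b, hν]; simp [h4, h5, p4, p5, q4, q5]
      · refine det_eq_zero_of_dependent (v := fun i => ν (x i) (y i)) (fun hli => ?_) g
        exact not_linearIndependent_of_eq_sum (p := 2) (by norm_num)
          (c := fun i => ![functional c (x i) * ψ₁ (y i) - functional c (y i) * ψ₁ (x i),
            functional c (x i) * ψ₂ (y i) - functional c (y i) * ψ₂ (x i)]) (z := ![z₁, z₂])
          (fun i => by simp [hν]) hli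
  change SatisfiesEqs _ v χ at hS
  have hw := hS.wedge fun _ _ h => h.1
  have h0 : functional v ≠ 0 := fun h => hv (functional_eq_zero.mp h)
  generalize functional v = h at hw h0
  have hnil : ∀ x y, χ x (χ x y) = 0 := fun x y =>
    hS.eq_zero ((HomPolyV.const x).bilin (HomPolyV.bilin' x y)) fun _ _ h => h.2.1 x y
  obtain ⟨x, hx⟩ := exists_eq_one h0
  by_cases hr : ∀ y y', ¬ LinearIndependent k ![χ x y, χ x y']
  · exact Or.inl (hw.isSmall hx (hnil x) hr)
  push Not at hr
  obtain ⟨y₁, y₂, hli⟩ := hr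
  obtain ⟨g, hg⟩ := exists_dual_family hli
  have hN : ∀ u, χ x u = g 0 (χ x u) • χ x y₁ + g 1 (χ x u) • χ x y₂ := fun u =>
    eq_of_not_linearIndependent_three hli hg <| not_linearIndependent_of_det fun θ => by
      have := hS _ _ (HomPoly.det fun i j => (HomPolyV.bilin' (x) (![y₁, y₂, u] i)).apply (θ j))
        fun _ _ h => h.2.2 (fun _ => x) ![y₁, y₂, u] θ
      convert this using 4 with i j
      fin_cases i <;> rfl
  have h00 := hg 0 0
  have h01 := hg 0 1
  have h10 := hg 1 0
  have h11 := hg 1 1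
  simp at h00 h01 h10 h11
  refine Or.inr ⟨h, g 0 ∘ₗ χ x, g 1 ∘ₗ χ x, x, y₁ - h y₁ • x, y₂ - h y₂ • x, χ x y₁, χ x y₂,
    ?_, ?_, ?_, hli, fun a b => ?_⟩
  · simp [hx, hw.2.2]
  · simp [hw.1, h00, h01, hnil]
  · simp [hw.1, h10, h11, hnil]
  · rw [hw.eq hx, hN a, hN b]
    simp only [LinearMap.comp_apply]
    module

lemma Is03.degenerates [IsAlgClosed k] (hn : n = 4) (hμ : Is03 μ) (hd : degenerates μ χ) :
    IsSmall χ ∨ Is03 χ := by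
  obtain ⟨v, hv, hS⟩ := exists_zero_of_degenerates hd
    (fun v ν => WedgeEqs ν (functional v) ∧ ∀ x y, ν x (ν x (ν x y)) = 0) fun ν hν => by
      obtain ⟨h, ψ₁, ψ₂, x, y₁, y₂, z, ⟨h1, h2, h3, h4⟩, ⟨p1, p2, p3, p4⟩,
        ⟨q1, q2, q3, q4⟩, hz, hν⟩ := hμ.of_mem_orbit hν
      obtain ⟨c, rfl⟩ := exists_functional h
      refine ⟨c, fun h => ?_, WedgeEqs.of_eq
        (N := ψ₁.smulRight y₂ + ψ₂.smulRight z) (fun a b => ?_) fun a => ?_, fun a b => ?_⟩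
      · rw [functional_eq_zero.mpr h] at h1; simp at h1
      · rw [hν]; simp; module
      · simp [h3, h4]
      · rw [hν a b, map_add, map_smul, map_smul, hν a y₂, hν a z]
        simp [h3, h4, p3, p4, q3, q4, hν a z]
  change SatisfiesEqs _ v χ at hS
  have hw := hS.wedge fun _ _ h => h.1
  have h0 : functional v ≠ 0 := fun h => hv (functional_eq_zero.mp h)
  generalize functional v = h at hw h0
  have hnil : ∀ x y, χ x (χ x (χ x y)) = 0 := fun x y => hS.eq_zero
    ((HomPolyV.const x).bilin ((HomPolyV.const x).bilin (HomPolyV.bilin' x y))) fun _ _ h => h.2 x y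
  obtain ⟨x, hx⟩ := exists_eq_one h0
  by_cases hN2 : ∀ y, χ x (χ x y) = 0
  · refine Or.inl (hw.isSmall hx hN2 fun y y' hli => ?_)
    have h5 : LinearIndependent k ![x, y - h y • x, y' - h y' • x, χ x y, χ x y'] := by
      rw [LinearIndependent.pair_iff] at hli
      rw [Fintype.linearIndependent_iff]
      intro c hc
      simp only [Fin.sum_univ_five, Matrix.cons_val] at hc
      have c0 : c 0 = 0 := by simpa [hx, hw.2.2] using congrArg h hc
      have c12 := hli (c 1) (c 2) (by simpa [hw.1, hN2] using congrArg (χ x) hc)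
      have c34 := hli (c 3) (c 4) (by simpa [c0, c12] using hc)
      intro i
      fin_cases i
      exacts [c0, c12.1, c12.2, c34.1, c34.2]
    have := h5.fintype_card_le_finrank
    simp at this
    omega
  push Not at hN2
  obtain ⟨y, hy⟩ := hN2
  have h4 : LinearIndependent k ![x, y - h y • x, χ x y, χ x (χ x y)] := by
    rw [Fintype.linearIndependent_iff]
    intro c hc
    simp only [Fin.sum_univ_four, Matrix.cons_val] at hc
    have c0 : c 0 = 0 := by simpa [hx, hw.2.2] using congrArg h hc
    have c1 : c 1 = 0 := by
      simpa [hw.1, hnil, hy] using congrArg (χ x ∘ₗ χ x) hc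
    have c2 : c 2 = 0 := by
      simpa [hw.1, hnil, hy, c1] using congrArg (χ x) hc
    have c3 : c 3 = 0 := by simpa [c0, c1, c2, hy] using hc
    intro i
    fin_cases i
    exacts [c0, c1, c2, c3]
  let b := basisOfLinearIndependentOfCardEqFinrank h4 (by simp [hn])
  have hb : ⇑b = ![x, y - h y • x, χ x y, χ x (χ x y)] := by simp [b]
  have hb0 : b 0 = x := by simp [hb]
  have hb1 : b 1 = y - h y • x := by simp [hb]
  have hb2 : b 2 = χ x y := by simp [hb]
  have hb3 : b 3 = χ x (χ x y) := by simp [hb]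
  have hc : ∀ i j, b.coord i (b j) = if j = i then 1 else 0 := fun i j => by
    simp [Finsupp.single_apply]
  have hh : h = b.coord 0 := b.ext fun i => by
    rw [hc]
    fin_cases i <;> simp [hb, hx, hw.2.2]
  have hN : χ x = (b.coord 1).smulRight (b 2) + (b.coord 2).smulRight (b 3) := b.ext fun i => by
    simp only [LinearMap.add_apply, LinearMap.smulRight_apply, hc]
    fin_cases i <;> simp [hb, hw.1, hnil]
  refine Or.inr ⟨b.coord 0, b.coord 1, b.coord 2, b 0, b 1, b 2, b 3, ?_, ?_, ?_, b.ne_zero 3,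
    fun u w => ?_⟩
  · simp [hc]
  · simp [hc]
  · simp [hc]
  · rw [hw.eq hx, hN, hh]
    simp only [LinearMap.add_apply, LinearMap.smulRight_apply]
    module

/-- The equations of the algebras isomorphic to `η_2 ⊕ k^{n-5}`. -/
def EtaEqs (χ : AlgStr k n) : Prop :=
  (∀ x, χ x x = 0) ∧ (∀ (g : (Fin n → k) →ₗ[k] k) (x y u v : Fin n → k),
    g (χ x y) • χ u v - g (χ u v) • χ x y = 0) ∧ (∀ x y u, χ x (χ y u) = 0) ∧
  ∀ (x y : Fin 5 → Fin n → k) (g : (Fin n → k) →ₗ[k] k),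
    (Matrix.of fun i j => g (χ (x i) (y j))).det = 0

lemma IsEta.eqs (hμ : IsEta μ) : EtaEqs μ := by
  obtain ⟨φ, x, z, h1, h2, hz, hμ⟩ := hμ
  refine ⟨fun a => by rw [hμ]; module, fun g a b c d => ?_, fun a b c => ?_, fun u v g => ?_⟩
  · rw [hμ, hμ]; simp; module
  · rw [hμ b c, map_smul, hμ a z]; simp [h2]
  · obtain ⟨a, ha, hac⟩ := exists_relation (p := 4) (by norm_num) (fun i j => φ j (u i))
    refine Matrix.exists_vecMul_eq_zero_iff.mp ⟨a, ha, funext fun j => ?_⟩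
    have e := fun j => hac j
    simp only [Matrix.vecMul, dotProduct, Matrix.of_apply, hμ, map_smul, smul_eq_mul,
      Pi.zero_apply]
    calc ∑ i, a i * ((φ 0 (u i) * φ 1 (v j) - φ 0 (v j) * φ 1 (u i) +
          (φ 2 (u i) * φ 3 (v j) - φ 2 (v j) * φ 3 (u i))) * g z)
        = ((∑ i, a i * φ 0 (u i)) * φ 1 (v j) - (∑ i, a i * φ 1 (u i)) * φ 0 (v j) +
          ((∑ i, a i * φ 2 (u i)) * φ 3 (v j) - (∑ i, a i * φ 3 (u i)) * φ 2 (v j))) * g z := by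
          simp only [Finset.sum_mul, ← Finset.sum_sub_distrib, ← Finset.sum_add_distrib]
          exact Finset.sum_congr rfl fun i _ => by ring
      _ = 0 := by simp [hac]

/-- An alternating form is, up to a form of smaller rank, a product of two functionals. -/
lemma exists_symplectic_step {W : Type*} [AddCommGroup W] [Module k W]
    {θ : W →ₗ[k] W →ₗ[k] k} {P : W →ₗ[k] W}
    (h0 : ∃ u v, θ (P u) (P v) ≠ 0) : ∃ p q : W, θ (P p) (P q) = 1 := by
  obtain ⟨u, v, h⟩ := h0
  exact ⟨(θ (P u) (P v))⁻¹ • u, v, by simp [h]⟩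

lemma IsEta.degenerates (hμ : IsEta μ) (hd : degenerates μ χ) : IsSmall χ ∨ IsEta χ := by
  have hS := satisfiesEqs_of_degenerates hd EtaEqs fun ν hν => (hμ.of_mem_orbit hν).eqs
  have halt : ∀ x, χ x x = 0 := fun x => hS.eq_zero (HomPolyV.bilin' x x) fun _ _ h => h.1 x
  have hrk : ∀ (g : (Fin n → k) →ₗ[k] k) x y u v, g (χ x y) • χ u v = g (χ u v) • χ x y :=
    fun g x y u v => sub_eq_zero.mp <| hS.eq_zero
      ((HomPolyV.smul ((HomPolyV.bilin' x y).apply g) (HomPolyV.bilin' u v)).sub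
        (HomPolyV.smul ((HomPolyV.bilin' u v).apply g) (HomPolyV.bilin' x y)))
      fun _ _ h => h.2.1 g x y u v
  have hnil : ∀ x y u, χ x (χ y u) = 0 := fun x y u => hS.eq_zero
    ((HomPolyV.const x).bilin (HomPolyV.bilin' y u)) fun _ _ h => h.2.2.1 x y u
  have hdet : ∀ (x y : Fin 5 → Fin n → k) (g : (Fin n → k) →ₗ[k] k),
      (Matrix.of fun i j => g (χ (x i) (y j))).det = 0 := fun x y g =>
    hS _ _ (HomPoly.det fun i j => (HomPolyV.bilin' (x i) (y j)).apply g)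
      fun _ _ h => h.2.2.2 x y g
  clear hS hd hμ
  by_cases h0 : χ = 0
  · exact Or.inl (Or.inl ⟨0, 0, 0, by simp [h0]⟩)
  obtain ⟨x, hx⟩ := DFunLike.ne_iff.mp h0
  obtain ⟨y, hy⟩ := DFunLike.ne_iff.mp hx
  replace hy : χ x y ≠ 0 := hy
  obtain ⟨g, hg⟩ := exists_dual_ne_zero hy
  set θ := χ.compr₂ g with hθ
  have hχ : ∀ u v, χ u v = θ u v • χ x y := fun u v => by
    have := hrk g x y u v
    rwa [hg, one_smul] at this
  generalize hz : χ x y = z at hχ hy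
  have hθalt : ∀ u, θ u u = 0 := fun u => by simp [hθ, halt]
  have hθneg : ∀ u v, θ v u = - θ u v := fun u v => by
    simp [hθ, neg_of_alternating halt u v]
  have hθz : ∀ u, θ u z = 0 := fun u => by simp [hθ, ← hz, hnil]
  have hθz' : ∀ u, θ z u = 0 := fun u => by rw [hθneg, hθz, neg_zero]
  have hxy : θ x y = 1 := by simpa [hθ] using hg
  have hyx : θ y x = -1 := by rw [hθneg, hxy]
  have hdet' : ∀ (x y : Fin 5 → Fin n → k), (Matrix.of fun i j => θ (x i) (y j)).det = 0 :=
    fun x y => hdet x y g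
  clear_value θ
  let P : (Fin n → k) →ₗ[k] (Fin n → k) :=
    LinearMap.id - (θ.flip y).smulRight x - (θ x).smulRight y
  have hP : ∀ u, P u = u - θ u y • x - θ x u • y := fun u => by simp [P]
  have hPx : ∀ u, θ (P u) x = 0 := fun u => by
    simp [hP, hθalt, hyx, hθneg x u]
  have hPy : ∀ u, θ (P u) y = 0 := fun u => by
    simp [hP, hθalt, hxy]
  have hdec : ∀ u v, θ u v = θ u y * θ x v - θ v y * θ x u + θ (P u) (P v) := fun u v => by
    rw [hP v]
    simp only [map_sub, map_smul, hPx, hPy]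
    rw [hP u]
    simp [hθneg v y]
    ring
  by_cases hr : ∃ u v, θ (P u) (P v) ≠ 0
  swap
  · push Not at hr
    refine Or.inl (Or.inr (IsT.zero_iff.mpr ⟨θ.flip y, θ x, x, y, z, by simp [hxy],
      by simp [hθalt], by simp [hθz'], by simp [hθalt], by simp [hxy], by simp [hθz], hy,
      fun u v => ?_⟩))
    rw [hχ, hdec, hr]
    simp
  obtain ⟨p, q, hpq⟩ := exists_symplectic_step hr
  have hpx := hPx p
  have hpy := hPy p
  have hqx := hPx q
  have hqy := hPy q
  generalize P p = x₃ at *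
  generalize P q = x₄ at *
  have hqp : θ x₄ x₃ = -1 := by rw [hθneg, hpq]
  have hxp : θ x x₃ = 0 := by rw [hθneg, hpx, neg_zero]
  have hyp : θ y x₃ = 0 := by rw [hθneg, hpy, neg_zero]
  have hxq : θ x x₄ = 0 := by rw [hθneg, hqx, neg_zero]
  have hyq : θ y x₄ = 0 := by rw [hθneg, hqy, neg_zero]
  let Q : (Fin n → k) →ₗ[k] (Fin n → k) := LinearMap.id - (θ.flip y).smulRight x -
    (θ x).smulRight y - (θ.flip x₄).smulRight x₃ - (θ x₃).smulRight x₄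
  have hQ : ∀ u, Q u = u - θ u y • x - θ x u • y - θ u x₄ • x₃ - θ x₃ u • x₄ :=
    fun u => by simp [Q]
  have hQx : ∀ u, θ (Q u) x = 0 := fun u => by
    simp [hQ, hθalt, hyx, hθneg x u, hpx, hqx]
  have hQy : ∀ u, θ (Q u) y = 0 := fun u => by
    simp [hQ, hθalt, hxy, hpy, hqy]
  have hQ3 : ∀ u, θ (Q u) x₃ = 0 := fun u => by
    simp [hQ, hθalt, hxp, hyp, hqp, hθneg x₃ u]
  have hQ4 : ∀ u, θ (Q u) x₄ = 0 := fun u => by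
    simp [hQ, hθalt, hxq, hyq, hpq]
  have hdec' : ∀ u v, θ u v = θ u y * θ x v - θ v y * θ x u +
      (θ u x₄ * θ x₃ v - θ v x₄ * θ x₃ u) + θ (Q u) (Q v) := fun u v => by
    rw [hQ v]
    simp only [map_sub, map_smul, hQx, hQy, hQ3, hQ4]
    rw [hQ u]
    simp [hθneg v y, hθneg v x₄]
    ring
  by_cases hr' : ∃ u v, θ (Q u) (Q v) ≠ 0
  · exfalso
    obtain ⟨p, q, h56⟩ := exists_symplectic_step hr'
    have := hdet' ![x, y, x₃, x₄, Q p] ![y, -x, x₄, -x₃, Q q]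
    have h1 : (Matrix.of fun i j => θ (![x, y, x₃, x₄, Q p] i)
        (![y, -x, x₄, -x₃, Q q] j)) = (1 : Matrix (Fin 5) (Fin 5) k) := by
      ext i j
      fin_cases i <;> fin_cases j <;>
        simp [hxy, hyx, hpq, hqp, h56, hθalt, hpx, hpy, hqx, hqy, hxp, hyp, hxq, hyq, hQx, hQy,
          hQ3, hQ4, hθneg (Q q)]
    rw [h1, Matrix.det_one] at this
    exact one_ne_zero this
  · push Not at hr'
    refine Or.inr ⟨![θ.flip y, θ x, θ.flip x₄, θ x₃], ![x, y, x₃, x₄], z, fun i j => ?_,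
      fun i => ?_, hy, fun u v => ?_⟩
    · fin_cases i <;> fin_cases j <;>
        simp [hxy, hpq, hθalt, hpx, hpy, hqy, hxp, hxq, hyq]
    · fin_cases i <;> simp [hθz, hθz']
    · rw [hχ, hdec', hr']
      simp

end NilpotentClosure

/-! ### Algebras of generation type one -/

section GenTypeOne

variable {n : ℕ} {μ χ : AlgStr k n} {f : (Fin n → k) →ₗ[k] k}

lemma exists_smul_of_genType (hG : genType μ 1) (a : Fin n → k) : ∃ c : k, μ a a = c • a := by
  have hle : Module.finrank k (subalgGen μ {a}) ≤ 1 := hG.2 ⟨a, rfl⟩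
  have ha : a ∈ subalgGen μ {a} := by
    simp only [subalgGen, Submodule.mem_sInf]
    exact fun W hW => hW.1 rfl
  have haa : μ a a ∈ subalgGen μ {a} := by
    simp only [subalgGen, Submodule.mem_sInf]
    exact fun W hW => hW.2 a (hW.1 rfl) a (hW.1 rfl)
  by_cases h0 : a = 0
  · exact ⟨0, by simp [h0]⟩
  obtain ⟨v, hv⟩ := finrank_le_one_iff.mp hle
  obtain ⟨c, hc⟩ := hv ⟨a, ha⟩
  obtain ⟨d, hd⟩ := hv ⟨μ a a, haa⟩
  have hc' : c • (v : Fin n → k) = a := congrArg Subtype.val hc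
  have hd' : d • (v : Fin n → k) = μ a a := congrArg Subtype.val hd
  have hc0 : c ≠ 0 := by
    rintro rfl
    exact h0 (by rw [← hc', zero_smul])
  refine ⟨d * c⁻¹, ?_⟩
  rw [← hd', mul_smul]
  congr 1
  rw [eq_inv_smul_iff₀ hc0, hc']

lemma exists_functional_of_genType [Infinite k] (hG : genType μ 1) :
    ∃ f : (Fin n → k) →ₗ[k] k, ∀ x, μ x x = f x • x := by
  classical
  choose l hl using exists_smul_of_genType hG
  let L : (Fin n → k) → k := fun x => if x = 0 then 0 else l x
  have hL : ∀ x, μ x x = L x • x := fun x => by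
    by_cases hx : x = 0
    · simp [hx]
    · simp [L, hx, hl]
  have hL0 : L 0 = 0 := by simp [L]
  have hsmul : ∀ (c : k) x, L (c • x) = c * L x := fun c x => by
    by_cases hc : c = 0
    · simp [hc, hL0]
    by_cases hx : x = 0
    · simp [hx, hL0]
    have h := hL (c • x)
    simp only [map_smul, LinearMap.smul_apply, hL x, smul_smul] at h
    have h := smul_left_injective k hx h
    exact mul_right_cancel₀ hc (by rw [← h]; ring)
  obtain ⟨s, hs⟩ := Set.Infinite.exists_notMem_finset (Set.infinite_univ (α := k)) {0, 1}
  simp only [Set.mem_univ, Finset.mem_insert, Finset.mem_singleton, true_and, not_or] at hs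
  have hadd : ∀ x y, L (x + y) = L x + L y := fun x y => by
    by_cases hxy : LinearIndependent k ![x, y]
    · have hli := LinearIndependent.pair_iff.mp hxy
      have h1 := hL (x + y)
      have h2 := hL (x + s • y)
      simp only [map_add, map_smul, LinearMap.add_apply, LinearMap.smul_apply, hL x, hL y]
        at h1 h2
      have key : μ x y + μ y x = (L (x + y) - L x) • x + (L (x + y) - L y) • y := by
        rw [← sub_eq_zero]
        rw [← sub_eq_zero] at h1
        rw [← h1]
        module
      have h3 : (L x + s * (L (x + y) - L x) - L (x + s • y)) • x +
          (s * (L (x + y) - L y) + s ^ 2 * L y - s * L (x + s • y)) • y = 0 := by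
        have h4 : s • (μ x y + μ y x) + (L x • x + s ^ 2 • L y • y) -
            L (x + s • y) • (x + s • y) = 0 := by
          rw [← sub_eq_zero] at h2
          rw [← h2]
          module
        rw [key] at h4
        rw [← h4]
        module
      obtain ⟨h5, h6⟩ := hli _ _ h3
      have h7 : s * (1 - s) * (L (x + y) - (L x + L y)) = 0 := by
        linear_combination h6 - s * h5
      have h8 : 1 - s ≠ 0 := sub_ne_zero.mpr (Ne.symm hs.2)
      exact sub_eq_zero.mp ((mul_eq_zero.mp h7).resolve_left (mul_ne_zero hs.1 h8))
    · by_cases hx : x = 0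
      · simp [hx, hL0]
      rw [LinearIndependent.pair_iff' hx] at hxy
      push Not at hxy
      obtain ⟨c, rfl⟩ := hxy
      rw [show x + c • x = (1 + c) • x by module, hsmul, hsmul]
      ring
  exact ⟨IsLinearMap.mk' L ⟨hadd, hsmul⟩, hL⟩

lemma add_swap_eq (hf : ∀ x, μ x x = f x • x) (x y : Fin n → k) :
    μ x y + μ y x = f x • y + f y • x := by
  have h := hf (x + y)
  simp only [map_add, LinearMap.add_apply, hf x, hf y] at h
  rw [← sub_eq_zero] at h ⊢
  rw [← h]
  module

lemma swap_eq (hf : ∀ x, μ x x = f x • x) (x y : Fin n → k) :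
    μ y x = f x • y + f y • x - μ x y :=
  eq_sub_of_add_eq' (add_swap_eq hf x y)

lemma mkQ_eq_zero_iff {x y : Fin n → k} : (k ∙ x).mkQ y = 0 ↔ ∃ c : k, y = c • x := by
  rw [Submodule.mkQ_apply, Submodule.Quotient.mk_eq_zero, Submodule.mem_span_singleton]
  exact exists_congr fun c => eq_comm

lemma linearIndependent_cons_of_mkQ {m : ℕ} {x : Fin n → k} (hx : x ≠ 0) {v : Fin m → Fin n → k}
    (h : LinearIndependent k fun i => (k ∙ x).mkQ (v i)) :
    LinearIndependent k (Fin.cons x v : Fin (m + 1) → Fin n → k) := by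
  rw [Fintype.linearIndependent_iff] at h ⊢
  intro g hg
  simp only [Fin.sum_univ_succ, Fin.cons_zero, Fin.cons_succ] at hg
  have h1 : ∀ i, g (Fin.succ i) = 0 := h _ <| by
    have := congrArg (k ∙ x).mkQ hg
    rwa [map_add, map_smul, mkQ_eq_zero_iff.mpr ⟨1, (one_smul k x).symm⟩, smul_zero, zero_add, map_sum, map_zero] at this
  simp only [h1, zero_smul, Finset.sum_const_zero, add_zero, smul_eq_zero, hx, or_false] at hg
  exact Fin.cases hg h1

/-- An endomorphism which is a homothety modulo `x`. -/
lemma exists_smul_add_of_forall {M : (Fin n → k) →ₗ[k] (Fin n → k)} {x : Fin n → k} (hx : x ≠ 0)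
    {c : k} (hM : M x = c • x) (h : ∀ y, ¬ LinearIndependent k ![x, y, M y]) :
    ∃ (α : k) (c : (Fin n → k) →ₗ[k] k), ∀ y, M y = α • y + c y • x := by
  have hle : (k ∙ x) ≤ (k ∙ x).comap M := by
    rw [Submodule.span_singleton_le_iff_mem, Submodule.mem_comap, hM]
    exact Submodule.smul_mem _ _ (Submodule.mem_span_singleton_self x)
  obtain ⟨α, hα⟩ := LinearMap.exists_eq_smul_id_of_forall_notLinearIndependent
    (f := (k ∙ x).mapQ (k ∙ x) M hle) fun v hv => by
      obtain ⟨y, rfl⟩ := (k ∙ x).mkQ_surjective v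
      refine h y (linearIndependent_cons_of_mkQ (v := ![y, M y]) hx ?_)
      rwa [show (fun i => (k ∙ x).mkQ (![y, M y] i)) = ![(k ∙ x).mkQ y, (k ∙ x).mkQ (M y)] by
        ext1 i; fin_cases i <;> rfl]
  obtain ⟨g, hg⟩ := exists_dual_ne_zero hx
  refine ⟨α, g.comp (M - α • LinearMap.id), fun y => ?_⟩
  have h1 : (k ∙ x).mkQ (M y - α • y) = 0 := by
    rw [map_sub, map_smul, sub_eq_zero]
    exact LinearMap.congr_fun hα ((k ∙ x).mkQ y)
  obtain ⟨c, hc⟩ := mkQ_eq_zero_iff.mp h1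
  have : g (M y - α • y) = c := by rw [hc, map_smul, hg, smul_eq_mul, mul_one]
  simp only [LinearMap.comp_apply, LinearMap.sub_apply, LinearMap.smul_apply, LinearMap.id_apply,
    this, ← hc]
  abel

/-- If any two elements span a subalgebra, the product is a combination of the factors with
coefficients given by linear functionals. -/
lemma exists_of_forall_not_linearIndependent (hn : 2 ≤ n) (hf : ∀ x, μ x x = f x • x)
    (h : ∀ x y, ¬ LinearIndependent k ![x, y, μ x y]) :
    ∃ a b : (Fin n → k) →ₗ[k] k, ∀ u v, μ u v = a u • v + b v • u := by
  have key : ∀ x, ∃ (α : k) (c : (Fin n → k) →ₗ[k] k), ∀ y, μ x y = α • y + c y • x := fun x => by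
    by_cases hx : x = 0
    · exact ⟨0, 0, by simp [hx]⟩
    · exact exists_smul_add_of_forall hx (hf x) (h x)
  choose α c hc using key
  have : Nontrivial (Fin n → k) := by
    have : Nonempty (Fin n) := ⟨⟨0, by omega⟩⟩
    infer_instance
  obtain ⟨y₀, hy₀⟩ := exists_ne (0 : Fin n → k)
  obtain ⟨x₀, hli⟩ := exists_pair hn hy₀
  have hx₀ : x₀ ≠ 0 := hli.ne_zero 1
  have hrel : ∀ {x y}, LinearIndependent k ![x, y] → α x + c y x = f x ∧ c x y + α y = f y := by
    intro x y hxy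
    have h1 := add_swap_eq hf x y
    rw [hc x y, hc y x, ← sub_eq_zero] at h1
    have h2 := LinearIndependent.pair_iff.mp hxy (c x y + α y - f y) (α x + c y x - f x)
      (by rw [← h1]; module)
    exact ⟨sub_eq_zero.mp h2.2, sub_eq_zero.mp h2.1⟩
  have hout : ∀ {x y : Fin n → k}, x ≠ 0 → (¬ ∃ t : k, y = t • x) → LinearIndependent k ![x, y] := by
    intro x y hx hy
    rw [LinearIndependent.pair_iff' hx]
    exact fun t ht => hy ⟨t, ht.symm⟩
  have hD : ∀ x y, (¬ ∃ t : k, x = t • y₀) → (¬ ∃ t : k, y = t • x₀) →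
      μ x y = (f - c y₀) x • y + c x₀ y • x := by
    intro x y hx hy
    have h1 := (hrel (hout hy₀ hx)).2
    have h2 := (hrel (hout hx₀ hy)).2
    have hx0 : x ≠ 0 := fun h => hx ⟨0, by simp [h]⟩
    have h3 : (f - c y₀) x = α x := by simp [← h1]
    rw [h3]
    by_cases hxy : ∃ t : k, y = t • x
    · obtain ⟨t, rfl⟩ := hxy
      have ht : t ≠ 0 := fun h => hy ⟨0, by simp [h]⟩
      have h4 := (hrel (hout hx₀ (y := x) fun ⟨s, hs⟩ => hy ⟨t * s, by rw [hs, mul_smul]⟩)).2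
      rw [map_smul, map_smul, hf, ← h4]
      simp only [smul_eq_mul]
      module
    · have h4 := (hrel (hout hx0 hxy)).2
      rw [hc x y, add_right_cancel (h4.trans h2.symm)]
  have hstep : ∀ {x y : Fin n → k}, LinearIndependent k ![x, y] → ¬ ∃ t : k, x = t • y := by
    rintro x y hxy ⟨t, rfl⟩
    have := (LinearIndependent.pair_iff.mp hxy 1 (-t) (by module)).1
    exact one_ne_zero this
  have hstep' : ∀ {x y : Fin n → k}, LinearIndependent k ![x, y] → ¬ ∃ t : k, y = t • x :=
    fun hxy => hstep (LinearIndependent.pair_symm_iff.mp hxy)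
  have hD' : ∀ x y, (¬ ∃ t : k, x = t • y₀) → μ x y = (f - c y₀) x • y + c x₀ y • x := by
    intro x y hx
    by_cases hy : ∃ t : k, y = t • x₀
    · obtain ⟨t, rfl⟩ := hy
      have h1 := hD x y₀ hx (hstep hli)
      have h2 := hD x (t • x₀ + y₀) hx fun ⟨s, hs⟩ =>
        hstep hli ⟨s - t, by rw [sub_smul, ← hs]; module⟩
      rw [map_add, h1] at h2
      rw [eq_sub_of_add_eq h2]
      simp only [map_add]
      module
    · exact hD x y hx hy
  refine ⟨f - c y₀, c x₀, fun x y => ?_⟩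
  by_cases hx : ∃ t : k, x = t • y₀
  · obtain ⟨t, rfl⟩ := hx
    have h1 := hD' x₀ y (hstep' hli)
    have h2 := hD' (t • y₀ + x₀) y fun ⟨s, hs⟩ =>
      hstep' hli ⟨s - t, by rw [sub_smul, ← hs]; module⟩
    rw [map_add, LinearMap.add_apply, h1] at h2
    rw [eq_sub_of_add_eq h2]
    simp only [map_add]
    module
  · exact hD' x y hx

end GenTypeOne

/-! ### Endomorphisms which are homotheties up to rank one -/

section RankOne

variable {W Q : Type*} [AddCommGroup W] [Module k W] [AddCommGroup Q] [Module k Q]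

lemma exists_eq_smul_of_forall_not_linearIndependent {π φ : W →ₗ[k] Q}
    (hπ : Function.Surjective π) (hQ : ∀ z : Q, z ≠ 0 → ∃ w, LinearIndependent k ![z, w])
    (h : ∀ v, ¬ LinearIndependent k ![π v, φ v]) : ∃ β : k, ∀ v, φ v = β • π v := by
  have hdep : ∀ v, π v ≠ 0 → ∃ c : k, φ v = c • π v := fun v hv => by
    have := h v
    rw [LinearIndependent.pair_iff' hv] at this
    push Not at this
    exact this.imp fun _ => Eq.symm
  have hker : ∀ v, π v = 0 → φ v = 0 := fun v hv => by
    by_contra hφ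
    obtain ⟨w, hw⟩ := hQ _ hφ
    obtain ⟨u, rfl⟩ := hπ w
    have hu : π u ≠ 0 := hw.ne_zero 1
    obtain ⟨c, hc⟩ := hdep u hu
    obtain ⟨d, hd⟩ := hdep (u + v) (by rwa [map_add, hv, add_zero])
    rw [map_add, map_add, hv, add_zero, hc] at hd
    have := (LinearIndependent.pair_iff.mp hw 1 (c - d) (by
      rw [← sub_eq_zero] at hd
      rw [← hd]
      module)).1
    exact one_ne_zero this
  obtain ⟨s, hs⟩ := π.exists_rightInverse_of_surjective (LinearMap.range_eq_top.mpr hπ)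
  have hs' : ∀ q, π (s q) = q := fun q => LinearMap.congr_fun hs q
  obtain ⟨β, hβ⟩ := LinearMap.exists_eq_smul_id_of_forall_notLinearIndependent
    (f := φ.comp s) fun q hq => h (s q) (by rw [hs']; exact hq)
  refine ⟨β, fun v => ?_⟩
  have h1 := hker (v - s (π v)) (by rw [map_sub, hs', sub_self])
  rw [map_sub, sub_eq_zero] at h1
  rw [h1]
  exact LinearMap.congr_fun hβ (π v)

lemma exists_linearIndependent_pair [FiniteDimensional k Q] (hQ : 2 ≤ Module.finrank k Q)
    {z : Q} (hz : z ≠ 0) : ∃ w, LinearIndependent k ![z, w] := by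
  by_contra! hw
  have : (k ∙ z) = ⊤ := by
    refine Submodule.eq_top_iff'.mpr fun w => ?_
    have := hw w
    rw [LinearIndependent.pair_iff' hz] at this
    push Not at this
    exact Submodule.mem_span_singleton.mpr this
  have h1 := finrank_span_singleton (K := k) hz
  rw [this, finrank_top] at h1
  omega

lemma eq_smul_of_not_linearIndependent {u v : W} (hu : u ≠ 0)
    (h : ¬ LinearIndependent k ![u, v]) : ∃ c : k, v = c • u := by
  rw [LinearIndependent.pair_iff' hu] at h
  push Not at h
  exact h.imp fun _ => Eq.symm

lemma finrank_span_pair {u v : W} (h : LinearIndependent k ![u, v]) :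
    Module.finrank k (Submodule.span k {u, v}) = 2 := by
  have := finrank_span_eq_card h
  rwa [Matrix.range_cons_cons_empty] at this

variable [FiniteDimensional k W]

lemma exists_mem_span_of_finrank_range_le_one {N : W →ₗ[k] W}
    (h : Module.finrank k (LinearMap.range N) ≤ 1) : ∃ z : W, ∀ v, ∃ c : k, N v = c • z := by
  obtain ⟨z, hz⟩ := finrank_le_one_iff.mp h
  refine ⟨z, fun v => ?_⟩
  obtain ⟨c, hc⟩ := hz ⟨N v, v, rfl⟩
  exact ⟨c, (congrArg Subtype.val hc).symm⟩

lemma exists_sub_mem_span_pair {M : W →ₗ[k] W} (hW : 4 ≤ Module.finrank k W)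
    (h : ∀ u v, ¬ LinearIndependent k ![u, v, M u, M v]) {u : W}
    (hu : LinearIndependent k ![u, M u]) :
    ∃ β : k, ∀ v, M v - β • v ∈ Submodule.span k {u, M u} := by
  set U := Submodule.span k {u, M u} with hU
  have huU : u ∈ U := Submodule.subset_span (by simp)
  have hMuU : M u ∈ U := Submodule.subset_span (by simp)
  have hdim := Submodule.finrank_quotient_add_finrank U
  rw [finrank_span_pair hu] at hdim
  obtain ⟨β, hβ⟩ := exists_eq_smul_of_forall_not_linearIndependent (φ := U.mkQ.comp M)
    U.mkQ_surjective (fun z hz => exists_linearIndependent_pair (by omega) hz) fun v hv =>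
      h u v <| by
        rw [Fintype.linearIndependent_iff]
        intro g hg
        simp only [Fin.sum_univ_four, Matrix.cons_val] at hg
        have h1 := congrArg U.mkQ hg
        simp only [map_add, map_smul, map_zero, (Submodule.Quotient.mk_eq_zero U).mpr huU,
          (Submodule.Quotient.mk_eq_zero U).mpr hMuU, Submodule.mkQ_apply, smul_zero, zero_add,
          add_zero] at h1
        obtain ⟨h2, h3⟩ := LinearIndependent.pair_iff.mp hv _ _ h1
        rw [h2, h3, zero_smul, zero_smul, add_zero, add_zero] at hg
        obtain ⟨h4, h5⟩ := LinearIndependent.pair_iff.mp hu _ _ hg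
        intro i
        fin_cases i <;> assumption
  refine ⟨β, fun v => ?_⟩
  rw [← Submodule.Quotient.mk_eq_zero U, ← Submodule.mkQ_apply, map_sub, map_smul, sub_eq_zero]
  exact hβ v

/-- If `u, v, M u, M v` are always dependent, `M` is a homothety up to rank one. -/
lemma exists_rank_one_of_four_le {M : W →ₗ[k] W} (hW : 4 ≤ Module.finrank k W)
    (h : ∀ u v, ¬ LinearIndependent k ![u, v, M u, M v]) :
    ∃ (β : k) (z : W), ∀ v, ∃ c : k, M v = β • v + c • z := by
  by_cases h0 : ∀ u, ¬ LinearIndependent k ![u, M u]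
  · obtain ⟨β, hβ⟩ := LinearMap.exists_eq_smul_id_of_forall_notLinearIndependent h0
    exact ⟨β, 0, fun v => ⟨0, by rw [hβ]; simp⟩⟩
  push Not at h0
  obtain ⟨u, hu⟩ := h0
  obtain ⟨β, hβ⟩ := exists_sub_mem_span_pair hW h hu
  set N : W →ₗ[k] W := M - β • LinearMap.id with hN
  have hNv : ∀ v, N v = M v - β • v := fun v => by simp [hN]
  suffices H : Module.finrank k (LinearMap.range N) ≤ 1 by
    obtain ⟨z, hz⟩ := exists_mem_span_of_finrank_range_le_one H
    refine ⟨β, z, fun v => ?_⟩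
    obtain ⟨c, hc⟩ := hz v
    exact ⟨c, by rw [← hc, hNv]; abel⟩
  have hN4 : ∀ u v, ¬ LinearIndependent k ![u, v, N u, N v] := fun u v huv => h u v <| by
    rw [Fintype.linearIndependent_iff] at huv ⊢
    intro g hg
    have := huv ![g 0 + β * g 2, g 1 + β * g 3, g 2, g 3] (by
      rw [← hg]
      simp only [Fin.sum_univ_four, Matrix.cons_val, hNv]
      module)
    have h2 : g 2 = 0 := this 2
    have h3 : g 3 = 0 := this 3
    have h0 : g 0 + β * g 2 = 0 := this 0
    have h1 : g 1 + β * g 3 = 0 := this 1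
    rw [h2, mul_zero, add_zero] at h0
    rw [h3, mul_zero, add_zero] at h1
    intro i
    fin_cases i <;> assumption
  by_contra! hrk
  have hle : LinearMap.range N ≤ Submodule.span k {u, M u} := by
    rintro _ ⟨v, rfl⟩
    rw [hNv]
    exact hβ v
  have hrk2 : Module.finrank k (LinearMap.range N) = 2 := by
    have := Submodule.finrank_mono hle
    rw [finrank_span_pair hu] at this
    omega
  have hker := N.finrank_range_add_finrank_ker
  have hout : ∀ w, w ∉ LinearMap.range N → N w = 0 := by
    intro w hw
    by_contra hNw
    have hw0 : w ≠ 0 := fun h => hw (h ▸ Submodule.zero_mem _)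
    have hwN : LinearIndependent k ![w, N w] := by
      by_contra hdep
      obtain ⟨c, hc⟩ := eq_smul_of_not_linearIndependent hw0 hdep
      have hc0 : c ≠ 0 := by
        rintro rfl
        exact hNw (by rw [hc, zero_smul])
      exact hw ⟨c⁻¹ • w, by rw [map_smul, hc, inv_smul_smul₀ hc0]⟩
    have hdim := finrank_span_pair hwN
    obtain ⟨γ, hγ⟩ := exists_sub_mem_span_pair hW hN4 hwN
    by_cases hγ0 : γ = 0
    · have : LinearMap.range N ≤ Submodule.span k {w, N w} := by
        rintro _ ⟨v, rfl⟩
        simpa [hγ0] using hγ v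
      have := Submodule.eq_of_le_of_finrank_eq this (by rw [hrk2, hdim])
      exact hw (this ▸ Submodule.subset_span (by simp))
    · have hk : LinearMap.ker N ≤ Submodule.span k {w, N w} := by
        intro v hv
        have := hγ v
        rw [LinearMap.mem_ker.mp hv, zero_sub, Submodule.neg_mem_iff,
          Submodule.smul_mem_iff _ hγ0] at this
        exact this
      have := Submodule.eq_of_le_of_finrank_le hk (by omega)
      exact hNw (LinearMap.mem_ker.mp (this ▸ Submodule.subset_span (by simp)))
  have hne : LinearMap.range N ≠ ⊤ := fun h => by
    rw [h, finrank_top] at hrk2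
    omega
  obtain ⟨w, -, hw⟩ := SetLike.exists_of_lt (lt_top_iff_ne_top.mpr hne)
  have hN0 : N = 0 := LinearMap.ext fun v => by
    by_cases hv : v ∈ LinearMap.range N
    · have h1 := hout (v + w) fun h => hw (by simpa using Submodule.sub_mem _ h hv)
      simpa [hout w hw] using h1
    · exact hout v hv
  rw [hN0, LinearMap.range_zero, finrank_bot] at hrk2
  omega

lemma exists_rank_range_lt [IsAlgClosed k] (M : W →ₗ[k] W) (hW : 0 < Module.finrank k W) :
    ∃ β : k, Module.finrank k (LinearMap.range (M - β • LinearMap.id)) < Module.finrank k W := by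
  have : Nontrivial W := Module.finrank_pos_iff.mp hW
  obtain ⟨β, hβ⟩ := Module.End.exists_eigenvalue M
  obtain ⟨v, hv⟩ := hβ.exists_hasEigenvector
  refine ⟨β, ?_⟩
  have hker := (M - β • LinearMap.id).finrank_range_add_finrank_ker
  have hv' : v ∈ LinearMap.ker (M - β • LinearMap.id) := by
    simp [LinearMap.mem_ker, hv.apply_eq_smul]
  have : 0 < Module.finrank k (LinearMap.ker (M - β • LinearMap.id)) :=
    Module.finrank_pos_iff.mpr ⟨⟨⟨v, hv'⟩, 0, fun h => hv.2 (congrArg Subtype.val h)⟩⟩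
  omega

lemma exists_rank_one_of_finrank_eq_two [IsAlgClosed k] (M : W →ₗ[k] W)
    (hW : Module.finrank k W = 2) :
    ∃ (β : k) (z : W), ∀ v, ∃ c : k, M v = β • v + c • z := by
  obtain ⟨β, hβ⟩ := exists_rank_range_lt M (by omega)
  obtain ⟨z, hz⟩ := exists_mem_span_of_finrank_range_le_one (N := M - β • LinearMap.id) (by omega)
  refine ⟨β, z, fun v => (hz v).imp fun c hc => ?_⟩
  rw [← hc]
  simp

/-- If `u, M u, M (M u)` are always dependent in dimension three, `M` is a homothety up to
rank one. -/
lemma exists_rank_one_of_finrank_eq_three [IsAlgClosed k] {M : W →ₗ[k] W}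
    (hW : Module.finrank k W = 3) (h : ∀ u, ¬ LinearIndependent k ![u, M u, M (M u)]) :
    ∃ (β : k) (z : W), ∀ v, ∃ c : k, M v = β • v + c • z := by
  obtain ⟨β, hβ⟩ := exists_rank_range_lt M (by omega)
  set N : W →ₗ[k] W := M - β • LinearMap.id with hN
  have hNv : ∀ v, N v = M v - β • v := fun v => by simp [hN]
  by_cases hrk : Module.finrank k (LinearMap.range N) ≤ 1
  · obtain ⟨z, hz⟩ := exists_mem_span_of_finrank_range_le_one hrk
    refine ⟨β, z, fun v => (hz v).imp fun c hc => ?_⟩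
    rw [← hc, hNv]
    abel
  have hrk2 : Module.finrank k (LinearMap.range N) = 2 := by omega
  have hN3 : ∀ u, ¬ LinearIndependent k ![u, N u, N (N u)] := fun u hu => h u <| by
    rw [Fintype.linearIndependent_iff] at hu ⊢
    intro g hg
    have := hu ![g 0 + β * g 1 + β ^ 2 * g 2, g 1 + 2 * β * g 2, g 2] (by
      rw [← hg]
      simp only [Fin.sum_univ_three, Matrix.cons_val, hNv, map_sub, map_smul]
      module)
    have h2 : g 2 = 0 := this 2
    have h1 : g 1 + 2 * β * g 2 = 0 := this 1
    have h0 : g 0 + β * g 1 + β ^ 2 * g 2 = 0 := this 0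
    rw [h2, mul_zero, add_zero] at h1
    rw [h1, h2, mul_zero, mul_zero, add_zero, add_zero] at h0
    intro i
    fin_cases i <;> assumption
  have hne : LinearMap.range N ≠ ⊤ := fun h => by
    rw [h, finrank_top] at hrk2
    omega
  obtain ⟨w, -, hw⟩ := SetLike.exists_of_lt (lt_top_iff_ne_top.mpr hne)
  have hspan : ∀ v, LinearIndependent k ![N v, N (N v)] →
      Submodule.span k {N v, N (N v)} = LinearMap.range N := fun v hv => by
    refine Submodule.eq_of_le_of_finrank_eq ?_ (by rw [hrk2, finrank_span_pair hv])
    rw [Submodule.span_le]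
    rintro _ (rfl | rfl)
    exacts [⟨_, rfl⟩, ⟨_, rfl⟩]
  have hout : ∀ v, v ∉ LinearMap.range N → ¬ LinearIndependent k ![N v, N (N v)] := fun v hv hl =>
    hN3 v <| by
      rw [show ![v, N v, N (N v)] = Fin.cons v ![N v, N (N v)] from rfl, linearIndependent_finCons]
      refine ⟨hl, fun hmem => hv ?_⟩
      rw [← hspan v hl]
      rwa [Matrix.range_cons_cons_empty] at hmem
  have hall : ∀ v, ¬ LinearIndependent k ![N v, N (N v)] := fun v hv => by
    have hNw : N w ∈ Submodule.span k {N v, N (N v)} := by rw [hspan v hv]; exact ⟨_, rfl⟩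
    have hNNw : N (N w) ∈ Submodule.span k {N v, N (N v)} := by rw [hspan v hv]; exact ⟨_, rfl⟩
    obtain ⟨a, b, hab⟩ := Submodule.mem_span_pair.mp hNw
    obtain ⟨c, d, hcd⟩ := Submodule.mem_span_pair.mp hNNw
    have hvI : v ∈ LinearMap.range N := by
      by_contra hvI
      exact hout v hvI hv
    have hdet : ∀ t : k, (a + t) * (d + t) = b * c := fun t => by
      by_contra ht
      refine hout (w + t • v) (fun hm => hw ?_) ?_
      · simpa using Submodule.sub_mem _ hm (Submodule.smul_mem _ t hvI)
      · rw [LinearIndependent.pair_iff] at hv ⊢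
        intro p q hpq
        simp only [map_add, map_smul] at hpq
        rw [← hcd, ← hab] at hpq
        obtain ⟨h1, h2⟩ := hv (p * (a + t) + q * c) (p * b + q * (d + t)) (by
          rw [← hpq]; module)
        have h3 : (a + t) * (d + t) - b * c ≠ 0 := sub_ne_zero.mpr ht
        constructor
        · refine (mul_eq_zero.mp (?_ : p * ((a + t) * (d + t) - b * c) = 0)).resolve_right h3
          linear_combination (d + t) * h1 - c * h2
        · refine (mul_eq_zero.mp (?_ : q * ((a + t) * (d + t) - b * c) = 0)).resolve_right h3
          linear_combination (a + t) * h2 - b * h1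
    classical
    obtain ⟨s, hs⟩ := Set.Infinite.exists_notMem_finset (Set.infinite_univ (α := k)) {0, 1}
    simp only [Set.mem_univ, Finset.mem_insert, Finset.mem_singleton, true_and, not_or] at hs
    have : s * (s - 1) = 0 := by
      linear_combination hdet s - hdet 0 - s * (hdet 1 - hdet 0)
    rcases mul_eq_zero.mp this with h | h
    exacts [hs.1 h, hs.2 (sub_eq_zero.mp h)]
  obtain ⟨γ, hγ⟩ := exists_eq_smul_of_forall_not_linearIndependent (W := LinearMap.range N)
    (Q := LinearMap.range N) (π := LinearMap.id)
    (φ := N.restrict (p := LinearMap.range N) (q := LinearMap.range N) fun v _ => ⟨v, rfl⟩)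
    Function.surjective_id (fun z hz => exists_linearIndependent_pair (by omega) hz) (by
      rintro ⟨_, v, rfl⟩ hv
      refine hall v ?_
      rw [LinearIndependent.pair_iff] at hv ⊢
      exact fun s t hst => hv s t (Subtype.ext hst))
  have hγ' : ∀ v, N (N v) = γ • N v := fun v => congrArg Subtype.val (hγ ⟨N v, v, rfl⟩)
  have hker := N.finrank_range_add_finrank_ker
  have hγ0 : γ ≠ 0 := by
    rintro rfl
    have : LinearMap.range N ≤ LinearMap.ker N := by
      rintro _ ⟨v, rfl⟩
      rw [LinearMap.mem_ker, hγ', zero_smul]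
    have := Submodule.finrank_mono this
    omega
  set N' : W →ₗ[k] W := N - γ • LinearMap.id with hN'
  have hker' := N'.finrank_range_add_finrank_ker
  have hle : LinearMap.range N ≤ LinearMap.ker N' := by
    rintro _ ⟨v, rfl⟩
    simp [hN', hγ']
  have := Submodule.finrank_mono hle
  obtain ⟨z, hz⟩ := exists_mem_span_of_finrank_range_le_one (N := N') (by omega)
  refine ⟨β + γ, z, fun v => (hz v).imp fun c hc => ?_⟩
  rw [← hc]
  simp only [hN', LinearMap.sub_apply, LinearMap.smul_apply, LinearMap.id_apply, hNv]
  module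

end RankOne

/-! ### Degenerations of algebras of generation type one -/

section Limits

variable {n : ℕ} {μ χ : AlgStr k n} {f : (Fin n → k) →ₗ[k] k}

/-- The alternating structure `(a, b) ↦ (φ ∧ ψ)(a, b) z`. -/
def wedge (φ ψ : (Fin n → k) →ₗ[k] k) (z : Fin n → k) : AlgStr k n :=
  LinearMap.mk₂ k (fun a b => (φ a * ψ b - φ b * ψ a) • z)
    (fun _ _ _ => by simp only [map_add]; module) (fun _ _ _ => by
      simp only [map_smul, smul_eq_mul]; module)
    (fun _ _ _ => by simp only [map_add]; module) (fun _ _ _ => by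
      simp only [map_smul, smul_eq_mul]; module)

lemma wedge_apply (φ ψ : (Fin n → k) →ₗ[k] k) (z a b : Fin n → k) :
    wedge φ ψ z a b = (φ a * ψ b - φ b * ψ a) • z := rfl

lemma degenerates_of_alternating [Infinite k] (hf : ∀ x, μ x x = f x • x)
    (hχ : ∀ x, χ x x = 0) (b : Module.Basis (Fin n) k (Fin n → k)) {w : Fin n → ℕ}
    (hw : ∀ i, 0 < w i)
    (h : ∀ i j, i < j →
      (χ (b i) (b j) = 0 ∨ ∃ p, χ (b i) (b j) = b p ∧ w i + w j = w p) ∧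
      (μ (b i) (b j) = χ (b i) (b j) ∨ ∀ m, w m < w i + w j)) : degenerates μ χ := by
  have h1 : ∀ i j m, i < j → w i + w j ≤ w m →
      b.repr (μ (b i) (b j)) m = b.repr (χ (b i) (b j)) m := fun i j m hij hm => by
    rcases (h i j hij).2 with h | h
    · rw [h]
    · exact absurd (h m) (by omega)
  have h2 : ∀ i j m, i < j → w i + w j ≠ w m → b.repr (χ (b i) (b j)) m = 0 :=
    fun i j m hij hm => by
      rcases (h i j hij).1 with h | ⟨p, h, hp⟩
      · simp [h]
      · rw [h, b.repr_self, Finsupp.single_eq_of_ne]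
        rintro rfl
        exact hm hp
  refine degenerates_of_weights b w (fun i j m hm => ?_) fun i j m hm => ?_
  · have hi : m ≠ i := by
      rintro rfl
      have := hw j
      omega
    have hj : m ≠ j := by
      rintro rfl
      have := hw i
      omega
    rcases lt_trichotomy i j with hij | rfl | hij
    · exact h1 i j m hij hm
    · simp [hf, hχ, Finsupp.single_eq_of_ne hi]
    · rw [swap_eq hf (b j) (b i), neg_of_alternating hχ (b j) (b i)]
      simp [h1 j i m hij (by omega), Finsupp.single_eq_of_ne hi, Finsupp.single_eq_of_ne hj]
  · rcases lt_trichotomy i j with hij | rfl | hij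
    · exact h2 i j m hij hm
    · simp [hχ]
    · rw [neg_of_alternating hχ (b j) (b i)]
      simp [h2 j i m hij (by omega)]

lemma coord_castLE {m : ℕ} (hm : m ≤ n) (b : Module.Basis (Fin n) k (Fin n → k)) (t : Fin m)
    (i : Fin n) : b.coord (Fin.castLE hm t) (b i) = if i.val = t.val then 1 else 0 := by
  simp [Finsupp.single_apply, Fin.ext_iff]

lemma exists_isT_zero_of_linearIndependent [Infinite k] (hf : ∀ x, μ x x = f x • x)
    {x y : Fin n → k} (h : LinearIndependent k ![x, y, μ x y]) :
    ∃ χ, IsT 0 0 0 χ ∧ degenerates μ χ := by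
  obtain ⟨hm, b, hb, -⟩ := exists_adapted_basis h (fun _ => False) (fun _ => 0) (by simp)
  have hc := coord_castLE hm b
  refine ⟨wedge (b.coord (Fin.castLE hm 0)) (b.coord (Fin.castLE hm 1)) (b (Fin.castLE hm 2)),
    IsT.zero_iff.mpr ⟨_, _, b (Fin.castLE hm 0), b (Fin.castLE hm 1), b (Fin.castLE hm 2),
      by simp [hc], by simp [hc], by simp [hc], by simp [hc], by simp [hc], by simp [hc],
      b.ne_zero _, wedge_apply _ _ _⟩, ?_⟩
  refine degenerates_of_alternating hf (fun x => by simp [wedge_apply]) b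
    (w := fun i => if i.val ≤ 1 then 2 else if i.val = 2 then 4 else 3)
    (fun i => by split_ifs <;> omega) fun i j hij => ?_
  rw [Fin.lt_def] at hij
  simp only [wedge_apply, hc]
  by_cases h01 : i.val = 0 ∧ j.val = 1
  · obtain rfl : i = Fin.castLE hm 0 := Fin.ext h01.1
    obtain rfl : j = Fin.castLE hm 1 := Fin.ext h01.2
    refine ⟨Or.inr ⟨Fin.castLE hm 2, by simp, by simp⟩, Or.inl ?_⟩
    simp only [hb]
    simp
  · refine ⟨Or.inl ?_, Or.inr fun m => ?_⟩
    · rw [smul_eq_zero]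
      left
      simp only [Fin.val_zero, Fin.val_one]
      split_ifs <;> first | omega | simp
    · split_ifs <;> omega

lemma exists_is22_of_linearIndependent [Infinite k] (hf : ∀ x, μ x x = f x • x)
    {x u v : Fin n → k} (h : LinearIndependent k ![x, u, v, μ x u, μ x v]) :
    ∃ χ, Is22 χ ∧ degenerates μ χ := by
  obtain ⟨hm, b, hb, -⟩ := exists_adapted_basis h (fun _ => False) (fun _ => 0) (by simp)
  have hc := coord_castLE hm b
  refine ⟨wedge (b.coord (Fin.castLE hm 0)) (b.coord (Fin.castLE hm 1)) (b (Fin.castLE hm 3)) +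
    wedge (b.coord (Fin.castLE hm 0)) (b.coord (Fin.castLE hm 2)) (b (Fin.castLE hm 4)),
    ⟨_, _, _, b (Fin.castLE hm 0), b (Fin.castLE hm 1), b (Fin.castLE hm 2),
      b (Fin.castLE hm 3), b (Fin.castLE hm 4), by simp [hc], by simp [hc], by simp [hc],
      ?_, fun u v => rfl⟩, ?_⟩
  · have := b.linearIndependent.comp ![Fin.castLE hm 3, Fin.castLE hm 4] (by
      intro i j
      fin_cases i <;> fin_cases j <;> simp)
    rwa [show b ∘ ![Fin.castLE hm 3, Fin.castLE hm 4] =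
      ![b (Fin.castLE hm 3), b (Fin.castLE hm 4)] by ext1 i; fin_cases i <;> rfl] at this
  refine degenerates_of_alternating hf (fun x => by simp [wedge_apply]) b
    (w := fun i => if i.val = 0 then 2 else if i.val ≤ 2 then 3 else if i.val ≤ 4 then 5 else 4)
    (fun i => by split_ifs <;> omega) fun i j hij => ?_
  rw [Fin.lt_def] at hij
  simp only [wedge_apply, LinearMap.add_apply, hc]
  by_cases h01 : i.val = 0 ∧ j.val = 1
  · obtain rfl : i = Fin.castLE hm 0 := Fin.ext h01.1
    obtain rfl : j = Fin.castLE hm 1 := Fin.ext h01.2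
    refine ⟨Or.inr ⟨Fin.castLE hm 3, by simp, by simp⟩, Or.inl ?_⟩
    simp only [hb]
    simp
  by_cases h02 : i.val = 0 ∧ j.val = 2
  · obtain rfl : i = Fin.castLE hm 0 := Fin.ext h02.1
    obtain rfl : j = Fin.castLE hm 2 := Fin.ext h02.2
    refine ⟨Or.inr ⟨Fin.castLE hm 4, by simp, by simp⟩, Or.inl ?_⟩
    simp only [hb]
    simp
  · refine ⟨Or.inl ?_, Or.inr fun m => ?_⟩
    · simp only [Fin.val_zero, Fin.val_one, Fin.val_two]
      split_ifs <;> first | omega | simp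
    · split_ifs <;> omega

lemma exists_is03_of_linearIndependent [Infinite k] (hn : n = 4) (hf : ∀ x, μ x x = f x • x)
    {x u : Fin n → k} (h : LinearIndependent k ![x, u, μ x u, μ x (μ x u)]) :
    ∃ χ, Is03 χ ∧ degenerates μ χ := by
  obtain ⟨hm, b, hb, -⟩ := exists_adapted_basis h (fun _ => False) (fun _ => 0) (by simp)
  have hc := coord_castLE hm b
  refine ⟨wedge (b.coord (Fin.castLE hm 0)) (b.coord (Fin.castLE hm 1)) (b (Fin.castLE hm 2)) +
    wedge (b.coord (Fin.castLE hm 0)) (b.coord (Fin.castLE hm 2)) (b (Fin.castLE hm 3)),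
    ⟨_, _, _, b (Fin.castLE hm 0), b (Fin.castLE hm 1), b (Fin.castLE hm 2),
      b (Fin.castLE hm 3), by simp [hc], by simp [hc], by simp [hc], b.ne_zero _,
      fun u v => rfl⟩, ?_⟩
  refine degenerates_of_alternating hf (fun x => by simp [wedge_apply]) b
    (w := fun i => i.val + 1) (fun i => by omega) fun i j hij => ?_
  rw [Fin.lt_def] at hij
  simp only [wedge_apply, LinearMap.add_apply, hc]
  by_cases h01 : i.val = 0 ∧ j.val = 1
  · obtain rfl : i = Fin.castLE hm 0 := Fin.ext h01.1
    obtain rfl : j = Fin.castLE hm 1 := Fin.ext h01.2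
    refine ⟨Or.inr ⟨Fin.castLE hm 2, by simp, by simp⟩, Or.inl ?_⟩
    simp only [hb]
    simp
  by_cases h02 : i.val = 0 ∧ j.val = 2
  · obtain rfl : i = Fin.castLE hm 0 := Fin.ext h02.1
    obtain rfl : j = Fin.castLE hm 2 := Fin.ext h02.2
    refine ⟨Or.inr ⟨Fin.castLE hm 3, by simp, by simp⟩, Or.inl ?_⟩
    simp only [hb]
    simp
  · refine ⟨Or.inl ?_, Or.inr fun m => by omega⟩
    simp only [Fin.val_zero, Fin.val_one, Fin.val_two]
    split_ifs <;> first | omega | simp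

lemma exists_isEta_of_linearIndependent [Infinite k] (hf : ∀ x, μ x x = f x • x)
    {x y u v : Fin n → k} (h : LinearIndependent k ![x, y, u, v, μ x y]) (huv : μ u v = μ x y)
    (hxu : μ x u = 0) (hxv : μ x v = 0) (hyu : μ y u = 0) (hyv : μ y v = 0) :
    ∃ χ, IsEta χ ∧ degenerates μ χ := by
  obtain ⟨hm, b, hb, -⟩ := exists_adapted_basis h (fun _ => False) (fun _ => 0) (by simp)
  have hc := coord_castLE hm b
  refine ⟨wedge (b.coord (Fin.castLE hm 0)) (b.coord (Fin.castLE hm 1)) (b (Fin.castLE hm 4)) +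
    wedge (b.coord (Fin.castLE hm 2)) (b.coord (Fin.castLE hm 3)) (b (Fin.castLE hm 4)),
    ⟨![b.coord (Fin.castLE hm 0), b.coord (Fin.castLE hm 1), b.coord (Fin.castLE hm 2),
        b.coord (Fin.castLE hm 3)],
      ![b (Fin.castLE hm 0), b (Fin.castLE hm 1), b (Fin.castLE hm 2), b (Fin.castLE hm 3)],
      b (Fin.castLE hm 4), fun i j => ?_, fun i => ?_, b.ne_zero _, fun u v => ?_⟩, ?_⟩
  · fin_cases i <;> fin_cases j <;> simp [hc]
  · fin_cases i <;> simp [hc]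
  · simp only [LinearMap.add_apply, wedge_apply, add_smul]
    rfl
  refine degenerates_of_alternating hf (fun x => by simp [wedge_apply]) b
    (w := fun i => if i.val ≤ 3 then 2 else if i.val = 4 then 4 else 3)
    (fun i => by split_ifs <;> omega) fun i j hij => ?_
  rw [Fin.lt_def] at hij
  simp only [wedge_apply, LinearMap.add_apply, hc]
  by_cases hj : 3 < j.val
  · refine ⟨Or.inl ?_, Or.inr fun m => ?_⟩
    · simp [show j.val ≠ 0 by omega, show j.val ≠ 1 by omega, show j.val ≠ 2 by omega,
        show j.val ≠ 3 by omega]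
    · split_ifs <;> omega
  by_cases h01 : i.val = 0 ∧ j.val = 1
  · obtain rfl : i = Fin.castLE hm 0 := Fin.ext h01.1
    obtain rfl : j = Fin.castLE hm 1 := Fin.ext h01.2
    refine ⟨Or.inr ⟨Fin.castLE hm 4, by simp, by simp⟩, Or.inl ?_⟩
    simp only [hb]
    simp
  by_cases h23 : i.val = 2 ∧ j.val = 3
  · obtain rfl : i = Fin.castLE hm 2 := Fin.ext h23.1
    obtain rfl : j = Fin.castLE hm 3 := Fin.ext h23.2
    refine ⟨Or.inr ⟨Fin.castLE hm 4, by simp, by simp⟩, Or.inl ?_⟩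
    simp only [hb]
    simp [huv]
  have hz : ∀ s t : Fin 5, s.val ≤ 1 → 2 ≤ t.val → t.val ≤ 3 →
      μ (b (Fin.castLE hm s)) (b (Fin.castLE hm t)) = 0 := fun s t hs ht ht' => by
    rw [hb, hb]
    obtain rfl | rfl : s = 0 ∨ s = 1 := by omega
    all_goals obtain rfl | rfl : t = 2 ∨ t = 3 := by omega
    exacts [hxu, hxv, hyu, hyv]
  have hi : i.val = 0 ∨ i.val = 1 := by omega
  have hj : j.val = 2 ∨ j.val = 3 := by omega
  refine ⟨Or.inl ?_, Or.inl ((hz ⟨i.val, by omega⟩ ⟨j.val, by omega⟩ (by simp; omega)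
    (by simp; omega) (by simp; omega)).trans (Eq.symm ?_))⟩ <;>
  rcases hi with hi | hi <;> rcases hj with hj | hj <;> simp [hi, hj]

end Limits

section RankOneLimits

variable {n : ℕ} {μ χ : AlgStr k n} {f : (Fin n → k) →ₗ[k] k}

lemma exists_rank_one_mod [IsAlgClosed k] (hf : ∀ x, μ x x = f x • x) {x : Fin n → k}
    (hx : x ≠ 0)
    (h : n = 3 ∨ (n = 4 ∧ ∀ u, ¬ LinearIndependent k ![x, u, μ x u, μ x (μ x u)]) ∨
      (5 ≤ n ∧ ∀ u v, ¬ LinearIndependent k ![x, u, v, μ x u, μ x v])) :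
    ∃ (β : k) (z : Fin n → k), ∀ v, ∃ c e : k, μ x v = β • v + c • z + e • x := by
  set M := Submodule.mapQ (k ∙ x) (k ∙ x) (μ x) (by
    rw [Submodule.span_singleton_le_iff_mem, Submodule.mem_comap, hf]
    exact Submodule.smul_mem _ _ (Submodule.mem_span_singleton_self x)) with hM
  have hMq : ∀ v, M ((k ∙ x).mkQ v) = (k ∙ x).mkQ (μ x v) := fun v => rfl
  have hrank : Module.finrank k ((Fin n → k) ⧸ (k ∙ x)) + 1 = n := by
    have := Submodule.finrank_quotient_add_finrank (k ∙ x)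
    rwa [finrank_span_singleton hx, Module.finrank_fin_fun] at this
  have key : ∃ (β : k) (z : (Fin n → k) ⧸ (k ∙ x)), ∀ v, ∃ c : k, M v = β • v + c • z := by
    rcases h with h | ⟨h, h4⟩ | ⟨h, h5⟩
    · exact exists_rank_one_of_finrank_eq_two M (by omega)
    · refine exists_rank_one_of_finrank_eq_three (by omega) fun u => ?_
      obtain ⟨u, rfl⟩ := (k ∙ x).mkQ_surjective u
      rw [hMq, hMq]
      refine fun hu => h4 u ?_
      refine linearIndependent_cons_of_mkQ (v := ![u, μ x u, μ x (μ x u)]) hx ?_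
      rwa [show (fun i => (k ∙ x).mkQ (![u, μ x u, μ x (μ x u)] i)) =
        ![(k ∙ x).mkQ u, (k ∙ x).mkQ (μ x u), (k ∙ x).mkQ (μ x (μ x u))] by
        ext1 i; fin_cases i <;> rfl]
    · refine exists_rank_one_of_four_le (by omega) fun u v => ?_
      obtain ⟨u, rfl⟩ := (k ∙ x).mkQ_surjective u
      obtain ⟨v, rfl⟩ := (k ∙ x).mkQ_surjective v
      rw [hMq, hMq]
      refine fun hu => h5 u v ?_
      refine linearIndependent_cons_of_mkQ (v := ![u, v, μ x u, μ x v]) hx ?_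
      rwa [show (fun i => (k ∙ x).mkQ (![u, v, μ x u, μ x v] i)) =
        ![(k ∙ x).mkQ u, (k ∙ x).mkQ v, (k ∙ x).mkQ (μ x u), (k ∙ x).mkQ (μ x v)] by
        ext1 i; fin_cases i <;> rfl]
  obtain ⟨β, z, hz⟩ := key
  obtain ⟨z, rfl⟩ := (k ∙ x).mkQ_surjective z
  refine ⟨β, z, fun v => ?_⟩
  obtain ⟨c, hc⟩ := hz ((k ∙ x).mkQ v)
  rw [hMq, ← map_smul, ← map_smul, ← map_add, ← sub_eq_zero, ← map_sub,
    mkQ_eq_zero_iff] at hc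
  obtain ⟨e, he⟩ := hc
  exact ⟨c, e, by rw [← he]; abel⟩

lemma exists_isT_of_rank_one [Infinite k] (hn : 3 ≤ n) (hf : ∀ x, μ x x = f x • x)
    {x y z : Fin n → k} {β : k} (hxy : LinearIndependent k ![x, y, μ x y])
    (hz : ∀ v, ∃ c e : k, μ x v = β • v + c • z + e • x) :
    ∃ δ χ, IsT (f x) β δ χ ∧ degenerates μ χ ∧ (δ = 0 → ∃ e : k, μ x z = β • z + e • x) := by
  have hx : x ≠ 0 := hxy.ne_zero 0
  have hy : ∀ e : k, μ x y ≠ β • y + e • x := fun e he => by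
    rw [Fintype.linearIndependent_iff] at hxy
    have := hxy ![e, β, -1] (by simp [Fin.sum_univ_succ, he]) 2
    simp at this
  have hxz : LinearIndependent k ![x, z] := by
    by_contra h
    obtain ⟨c, rfl⟩ := eq_smul_of_not_linearIndependent hx h
    obtain ⟨c', e, he⟩ := hz y
    exact hy (c' * c + e) (by rw [he]; module)
  obtain ⟨hm, b, hb, -⟩ := exists_adapted_basis hxz (fun _ => False) (fun _ => 0) (by simp)
  have hc := coord_castLE hm b
  have hb0 : b (Fin.castLE hm 0) = x := hb 0
  have hb1 : b (Fin.castLE hm 1) = z := hb 1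
  set h := b.coord (Fin.castLE hm 0) with hh
  set g := b.coord (Fin.castLE hm 1) with hg
  have hhx : h x = 1 := by rw [← hb0, hc]; simp
  have hhz : h z = 0 := by rw [← hb1, hc]; simp
  have hgx : g x = 0 := by rw [← hb0, hc]; simp
  have hgz : g z = 1 := by rw [← hb1, hc]; simp
  set d : (Fin n → k) →ₗ[k] k := g.comp (μ x) - β • g with hd
  have hdv : ∀ v, ∃ e : k, μ x v = β • v + d v • z + e • x := fun v => by
    obtain ⟨c, e, he⟩ := hz v
    refine ⟨e, ?_⟩
    have : d v = c := by simp [hd, he, hgx, hgz]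
    rw [this, he]
  have hdx : d x = 0 := by simp [hd, hf, hgx]
  have hdy : d y ≠ 0 := fun h0 => by
    obtain ⟨e, he⟩ := hdv y
    exact hy e (by simp [he, h0])
  let χ : AlgStr k n := LinearMap.mk₂ k
    (fun a b => (β * h a) • b + ((f x - β) * h b) • a + (h a * d b - h b * d a) • z)
    (fun _ _ _ => by simp only [map_add]; module) (fun _ _ _ => by
      simp only [map_smul, smul_eq_mul]; module)
    (fun _ _ _ => by simp only [map_add]; module) (fun _ _ _ => by
      simp only [map_smul, smul_eq_mul]; module)
  have hχ : ∀ a b, χ a b =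
    (β * h a) • b + ((f x - β) * h b) • a + (h a * d b - h b * d a) • z := fun _ _ => rfl
  refine ⟨d z, χ, IsT.of hn (y := (d y)⁻¹ • y - (h ((d y)⁻¹ • y)) • x) hhx (by simp [hhx]) hdx
    (by simp [hdx, hdy]) hhz rfl (hxz.ne_zero 1) hχ, ?_, fun h0 => ?_⟩
  · have hi0 : ∀ i, i = Fin.castLE hm 0 ∨ (i.val ≠ 0 ∧ h (b i) = 0) := fun i => by
      by_cases hi : i.val = 0
      · exact Or.inl (Fin.ext hi)
      · exact Or.inr ⟨hi, by rw [hh, hc]; simp [hi]⟩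
    have hxm : ∀ m : Fin n, m.val ≠ 0 → b.repr x m = 0 := fun m hm' => by
      rw [← hb0, b.repr_self, Finsupp.single_eq_of_ne]
      rintro rfl
      exact hm' rfl
    have hr0 : ∀ v, b.repr v (Fin.castLE hm 0) = h v := fun v => rfl
    refine degenerates_of_weights b (fun i => if i.val = 0 then 0 else 1)
      (fun i j m hw => ?_) fun i j m hw => ?_
    · rcases hi0 i with rfl | ⟨hi, hbi⟩ <;> rcases hi0 j with rfl | ⟨hj, hbj⟩
      · rw [hb0, hχ, hf, hhx, hdx]
        congr 2
        module
      · have hm0 : m.val ≠ 0 := fun h0 => by simp [h0, hj] at hw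
        obtain ⟨e, he⟩ := hdv (b j)
        rw [hb0, he, hχ, hhx, hbj]
        simp [hxm m hm0]
      · have hm0 : m.val ≠ 0 := fun h0 => by simp [h0, hi] at hw
        obtain ⟨e, he⟩ := hdv (b i)
        rw [hb0, swap_eq hf x (b i), he, hχ, hhx, hbi]
        simp [hxm m hm0]
        ring
      · simp only [hi, hj, if_false] at hw
        split_ifs at hw <;> omega
    · rcases hi0 i with rfl | ⟨hi, hbi⟩ <;> rcases hi0 j with rfl | ⟨hj, hbj⟩
      · have hm0 : m.val ≠ 0 := fun h0 => by simp [h0] at hw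
        rw [hb0, hχ]
        simp [hxm m hm0, hdx]
      · have hm0 : m = Fin.castLE hm 0 := by
          by_contra h0
          have : m.val ≠ 0 := fun h1 => h0 (Fin.ext h1)
          simp [hj, this] at hw
        rw [hm0, hr0, hb0, hχ]
        simp [hbj, hhz]
      · have hm0 : m = Fin.castLE hm 0 := by
          by_contra h0
          have : m.val ≠ 0 := fun h1 => h0 (Fin.ext h1)
          simp [hi, this] at hw
        rw [hm0, hr0, hb0, hχ]
        simp [hbi, hhz]
      · rw [hχ]
        simp [hbi, hbj]
  · obtain ⟨e, he⟩ := hdv z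
    exact ⟨e, by simp [he, h0]⟩

end RankOneLimits

/-! ### The algebras of level two -/

section LevelTwo

variable {n : ℕ} {μ χ : AlgStr k n} {f : (Fin n → k) →ₗ[k] k}

/-- The algebras of generation type one and level two. -/
def IsLevelTwo (μ : AlgStr k n) : Prop :=
  (∃ β δ, (β ≠ 0 ∨ δ ≠ 0) ∧ IsT 0 β δ μ) ∨ (∃ β δ, IsT 1 β δ μ) ∨ (n = 4 ∧ Is03 μ) ∨
    Is22 μ ∨ IsE μ ∨ IsEta μ

lemma IsLevelTwo.of_mem_orbit (hμ : IsLevelTwo μ) (hχ : χ ∈ orbit μ) : IsLevelTwo χ := by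
  rcases hμ with ⟨β, δ, h, hT⟩ | ⟨β, δ, hT⟩ | ⟨hn, h⟩ | h | h | h
  · exact Or.inl ⟨β, δ, h, hT.of_mem_orbit hχ⟩
  · exact Or.inr <| Or.inl ⟨β, δ, hT.of_mem_orbit hχ⟩
  · exact Or.inr <| Or.inr <| Or.inl ⟨hn, h.of_mem_orbit hχ⟩
  · exact Or.inr <| Or.inr <| Or.inr <| Or.inl <| h.of_mem_orbit hχ
  · exact Or.inr <| Or.inr <| Or.inr <| Or.inr <| Or.inl <| h.of_mem_orbit hχ
  · exact Or.inr <| Or.inr <| Or.inr <| Or.inr <| Or.inr <| h.of_mem_orbit hχ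

lemma linearIndependent_triple {h ψ : (Fin n → k) →ₗ[k] k} {x y z : Fin n → k} (hx : h x = 1)
    (hy : h y = 0) (hz : h z = 0) (py : ψ y = 1) (pz : ψ z = 0) (z0 : z ≠ 0)
    (s : k) : LinearIndependent k ![x, y, s • y + z] := by
  rw [Fintype.linearIndependent_iff]
  intro g hg
  simp only [Fin.sum_univ_three, Matrix.cons_val_zero, Matrix.cons_val_one,
    Matrix.cons_val] at hg
  have h0 : g 0 = 0 := by simpa [hx, hy, hz] using congrArg h hg
  have h1 : g 1 + g 2 * s = 0 := by simpa [h0, py, pz] using congrArg ψ hg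
  have h2 : g 2 = 0 := by
    rw [h0, show (0 : k) • x + g 1 • y + g 2 • (s • y + z) = (g 1 + g 2 * s) • y + g 2 • z by
      module, h1, zero_smul, zero_add, smul_eq_zero] at hg
    exact hg.resolve_right z0
  intro i
  fin_cases i
  exacts [h0, by simpa [h2] using h1, h2]

lemma hasChain_two_of_linearIndependent [Infinite k] (hf : ∀ x, μ x x = f x • x)
    {x y : Fin n → k} (h : LinearIndependent k ![x, y, μ x y]) (hμ : ¬ IsT 0 0 0 μ) :
    hasChain μ 2 := by
  obtain ⟨χ, hχ, hd⟩ := exists_isT_zero_of_linearIndependent hf h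
  refine hasChain_two.mpr ⟨χ, 0, ⟨hd, fun h => hμ (hχ.of_mem_orbit (orbit_symm h))⟩,
    degenerates_zero χ, fun h => ?_⟩
  obtain ⟨_, _, x, y, z, hx, hy, -, -, hψ, -, hz, hχ⟩ := IsT.zero_iff.mp hχ
  have := hχ x y
  rw [zero_mem_orbit.mp h] at this
  exact hz (by simpa [hx, hy, hψ] using this.symm)

lemma IsT.hasChain_two [Infinite k] {ε β δ : k} (hne : ε ≠ 0 ∨ β ≠ 0 ∨ δ ≠ 0)
    (hμ : IsT ε β δ μ) : hasChain μ 2 := by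
  obtain ⟨h, ψ, x, y, z, hx, hy, hz, px, py, pz, z0, hμ⟩ := hμ
  have hxy : μ x y = (β + δ) • y + z := by
    rw [hμ]
    simp only [hx, hy, px, py]
    module
  refine hasChain_two_of_linearIndependent (f := ε • h) (x := x) (y := y) (fun a => ?_)
    (hxy ▸ linearIndependent_triple hx hy hz py pz z0 _) fun h0 => ?_
  · rw [hμ]
    simp only [LinearMap.smul_apply, smul_eq_mul]
    module
  obtain ⟨h', ψ', x', y', z', -, -, hz', -, -, pz', -, hμ'⟩ := IsT.zero_iff.mp h0
  have hε : ε = 0 := by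
    have hxx := congrArg h ((hμ x x).symm.trans (hμ' x x))
    simp only [map_add, map_smul, smul_eq_mul, hx, hy, hz, px] at hxx
    linear_combination hxx
  have hnil : μ x (μ x y) = 0 := by
    rw [hμ' x y, hμ']
    simp [hz', pz']
  have hexp : μ x (μ x y) = ((β + δ) * (β + δ)) • y + (β + δ + β) • z := by
    rw [hxy, hμ]
    simp only [map_add, map_smul, smul_eq_mul, hx, hy, hz, px, py, pz]
    module
  rw [hexp] at hnil
  have h1 : β + δ = 0 := by simpa [py, pz] using congrArg ψ hnil
  have h2 : β = 0 := by simpa [h1, z0] using hnil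
  rcases hne with h | h | h
  · exact h hε
  · exact h h2
  · exact h (by simpa [h2] using h1)

lemma Is22.hasChain_two [Infinite k] (hμ : Is22 μ) : hasChain μ 2 := by
  obtain ⟨h, ψ₁, ψ₂, x, y₁, y₂, z₁, z₂, h1, h2, h3, hz, hμ⟩ := hμ
  have hxy : μ x y₁ = z₁ := by simp [hμ, h1, h2, h3]
  have hxy' : μ x y₂ = z₂ := by simp [hμ, h1, h2, h3]
  refine hasChain_two_of_linearIndependent (f := 0) (x := x) (y := y₁) (fun a => ?_) ?_
    fun h0 => ?_
  · rw [hμ]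
    simp only [LinearMap.zero_apply]
    module
  · have := linearIndependent_triple h1.1 h1.2.1 h1.2.2.2.1 h2.2.1 h2.2.2.2.1 (hz.ne_zero 0) 0
    simpa [hxy] using this
  · obtain ⟨h', ψ', x', y', z', -, -, -, -, -, -, -, hμ'⟩ := IsT.zero_iff.mp h0
    rw [hμ'] at hxy hxy'
    set c := h' x * ψ' y₁ - h' y₁ * ψ' x
    set c' := h' x * ψ' y₂ - h' y₂ * ψ' x
    rw [Fintype.linearIndependent_iff] at hz
    have hc : c = 0 := by
      have := hz ![c', -c] (by simp [← hxy, ← hxy', smul_smul, mul_comm]) 1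
      simpa using this
    have := hz ![1, 0] (by simp [← hxy, hc]) 0
    simp at this

lemma Is03.hasChain_two [Infinite k] (hμ : Is03 μ) : hasChain μ 2 := by
  obtain ⟨h, ψ₁, ψ₂, x, y₁, y₂, z, h1, h2, h3, hz, hμ⟩ := hμ
  have hxy : μ x y₁ = y₂ := by simp [hμ, h1, h2, h3]
  have hxy' : μ x y₂ = z := by simp [hμ, h1, h2, h3]
  have hy2 : y₂ ≠ 0 := by
    rintro rfl
    simp at h3
  refine hasChain_two_of_linearIndependent (f := 0) (x := x) (y := y₁) (fun a => ?_) ?_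
    fun h0 => ?_
  · rw [hμ]
    simp only [LinearMap.zero_apply]
    module
  · have := linearIndependent_triple h1.1 h1.2.1 h1.2.2.1 h2.2.1 h2.2.2.1 hy2 0
    simpa [hxy] using this
  · obtain ⟨h', ψ', x', y', z', -, -, hz', -, -, pz', -, hμ'⟩ := IsT.zero_iff.mp h0
    refine hz ?_
    rw [← hxy', ← hxy, hμ' x y₁, hμ']
    simp [hz', pz']

lemma IsEta.hasChain_two [Infinite k] (hμ : IsEta μ) : hasChain μ 2 := by
  obtain ⟨φ, x, z, hφ, hφz, hz, hμ⟩ := hμ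
  refine hasChain_two_of_linearIndependent (f := 0) (x := x 0) (y := x 1) (fun a => ?_) ?_
    fun h0 => ?_
  · rw [hμ]
    simp only [LinearMap.zero_apply]
    module
  · have := linearIndependent_triple (h := φ 0) (ψ := φ 1) (x := x 0) (y := x 1) (z := z)
      (by simp [hφ]) (by simp [hφ]) (hφz 0) (by simp [hφ]) (hφz 1) hz 0
    have hxy : μ (x 0) (x 1) = z := by simp [hμ, hφ]
    simpa [hxy] using this
  · obtain ⟨h', ψ', x', y', z', -, -, -, -, -, -, z0, hμ'⟩ := IsT.zero_iff.mp h0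
    have hzero : ∀ i j, μ (x i) (x j) = 0 → h' (x i) * ψ' (x j) - h' (x j) * ψ' (x i) = 0 :=
      fun i j h => by
        rw [hμ', smul_eq_zero] at h
        exact h.resolve_right z0
    have hne : ∀ i j, μ (x i) (x j) = z → h' (x i) * ψ' (x j) - h' (x j) * ψ' (x i) ≠ 0 :=
      fun i j h h0 => by
        rw [hμ', h0, zero_smul] at h
        exact hz h.symm
    refine mul_ne_zero (hne 0 1 (by simp [hμ, hφ])) (hne 2 3 (by simp [hμ, hφ])) ?_
    linear_combination (h' (x 1) * ψ' (x 3) - h' (x 3) * ψ' (x 1)) *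
      hzero 0 2 (by simp [hμ, hφ]) - (h' (x 1) * ψ' (x 2) - h' (x 2) * ψ' (x 1)) *
      hzero 0 3 (by simp [hμ, hφ])

lemma IsE.hasChain_two [Infinite k] (hμ : IsE μ) : hasChain μ 2 := by
  have hμ' := hμ
  obtain ⟨a, b, x, y, ⟨ax, ay, bx, hby⟩, hμ⟩ := hμ
  have hxy : LinearIndependent k ![x, y] := by
    rw [LinearIndependent.pair_iff]
    intro s t hst
    exact ⟨by simpa [ax, ay] using congrArg a hst, by simpa [bx, hby] using congrArg b hst⟩
  obtain ⟨hm, e, -, hS⟩ := exists_adapted_basis hxy (fun _ => True) ![a, b] (by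
    intro i _ j
    fin_cases i <;> fin_cases j <;> simp [ax, ay, bx, hby])
  have ha : ∀ i, a (e i) = if i.val = 0 then 1 else 0 := fun i => by
    have := hS 0 trivial (e i)
    simpa [Finsupp.single_apply, Fin.ext_iff] using this
  have hb : ∀ i, b (e i) = if i.val = 1 then 1 else 0 := fun i => by
    have := hS 1 trivial (e i)
    simpa [Finsupp.single_apply, Fin.ext_iff] using this
  let χ : AlgStr k n := LinearMap.mk₂ k (fun u v => a u • v)
    (fun _ _ _ => by simp only [map_add]; module) (fun _ _ _ => by
      simp only [map_smul, smul_eq_mul]; module)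
    (fun _ _ _ => by module) (fun _ _ _ => by module)
  have hχ : ∀ u v, χ u v = a u • v := fun _ _ => rfl
  refine _root_.hasChain_two.mpr ⟨χ, 0, ⟨?_, fun h => ?_⟩, degenerates_zero χ, fun h => ?_⟩
  · refine degenerates_of_weights e (fun i => if i.val = 0 then 0 else 1)
      (fun i j m hw => ?_) fun i j m hw => ?_
    · rw [hμ, hχ]
      simp only [hb, map_add, map_smul, e.repr_self, Finsupp.add_apply, Finsupp.smul_apply,
        Finsupp.single_apply, add_eq_left, smul_eq_mul, mul_ite, mul_one, mul_zero]
      split_ifs with h1 h2 <;> simp_all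
    · rw [hχ]
      simp only [ha, map_smul, e.repr_self, Finsupp.smul_apply, Finsupp.single_apply,
        smul_eq_mul, mul_ite, mul_one, mul_zero]
      split_ifs with h1 h2 <;> simp_all
  · obtain ⟨a', b', x', y', ⟨ax', ay', bx', hby'⟩, h'⟩ := hμ'.of_mem_orbit h
    have h2 : a x' • y' = y' + x' := by
      have := h' x' y'
      rw [hχ] at this
      simpa [ax', hby'] using this
    have := congrArg a' h2
    simp [ax', ay'] at this
  · have := hχ x x
    rw [zero_mem_orbit.mp h] at this
    rw [ax, one_smul] at this
    rw [← this] at ax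
    simp at ax

lemma IsLevelTwo.levelIs [IsAlgClosed k] (hμ : IsLevelTwo μ) (hn : 2 ≤ n) :
    levelIs μ 2 := by
  have hn3 : ∀ {ε β δ}, IsT ε β δ μ → 3 ≤ n := fun hT => by
    obtain ⟨h, ψ, x, y, z, hx, hy, hz, px, py, pz, z0, -⟩ := hT
    simpa using (linearIndependent_triple hx hy hz py pz z0 0).fintype_card_le_finrank
  rcases hμ with ⟨β, δ, h, hT⟩ | ⟨β, δ, hT⟩ | ⟨h4, h⟩ | h | h | h
  · refine ⟨hT.hasChain_two (Or.inr h), not_hasChain_three hn fun χ hχ => ?_⟩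
    by_cases hβ : β = 0
    · subst hβ
      exact (hT.degenerates_zero_zero (hn3 hT) (by simpa using h) hχ).imp_right hT.mem_orbit
    · exact (hT.degenerates (hn3 hT) (Or.inr hβ) hχ).imp_right hT.mem_orbit
  · exact ⟨hT.hasChain_two (Or.inl one_ne_zero), not_hasChain_three hn fun χ hχ =>
      (hT.degenerates (hn3 hT) (Or.inl one_ne_zero) hχ).imp_right hT.mem_orbit⟩
  · exact ⟨h.hasChain_two, not_hasChain_three hn fun χ hχ =>
      (h.degenerates h4 hχ).imp_right h.mem_orbit⟩
  · exact ⟨h.hasChain_two, not_hasChain_three hn fun χ hχ =>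
      (h.degenerates hχ).imp_right h.mem_orbit⟩
  · exact ⟨h.hasChain_two, not_hasChain_three hn fun χ hχ =>
      (h.degenerates hχ).imp_right h.mem_orbit⟩
  · exact ⟨h.hasChain_two, not_hasChain_three hn fun χ hχ =>
      (h.degenerates hχ).imp_right h.mem_orbit⟩

end LevelTwo

section Alternating

variable {n : ℕ} {μ χ : AlgStr k n}

lemma linearIndependent_triple_iff {x y z : Fin n → k} : LinearIndependent k ![x, y, z] ↔
    ∀ a b c : k, a • x + b • y + c • z = 0 → a = 0 ∧ b = 0 ∧ c = 0 := by
  rw [Fintype.linearIndependent_iff]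
  refine ⟨fun h a b c habc => ?_, fun h g hg => ?_⟩
  · have := h ![a, b, c] (by simpa [Fin.sum_univ_three] using habc)
    exact ⟨this 0, this 1, this 2⟩
  · obtain ⟨h0, h1, h2⟩ := h (g 0) (g 1) (g 2) (by simpa [Fin.sum_univ_three] using hg)
    intro i
    fin_cases i <;> assumption

lemma mem_span_triple_or {w x y z : Fin n → k} (h : LinearIndependent k ![x, y, z]) :
    (∃ a b c : k, w = a • x + b • y + c • z) ∨
      ∀ a b c d : k, a • w + (b • x + c • y + d • z) = 0 → a = 0 ∧ b = 0 ∧ c = 0 ∧ d = 0 := by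
  refine or_iff_not_imp_left.mpr fun hw a b c d habcd => ?_
  have ha : a = 0 := by
    by_contra ha
    refine hw ⟨-(a⁻¹ * b), -(a⁻¹ * c), -(a⁻¹ * d), ?_⟩
    rw [← smul_right_inj ha, ← sub_eq_zero, ← habcd]
    simp only [smul_add, smul_smul, mul_neg, mul_inv_cancel_left₀ ha]
    module
  subst ha
  exact ⟨rfl, linearIndependent_triple_iff.mp h b c d (by simpa using habcd)⟩

/-- The hypothesis `h` says that no algebra `T_0^{2,(α,β)}` with `(α, β) ≠ (0, 0)` shows up among
the limits of `μ`. -/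
lemma isT_zero_or_exists_linearIndependent (halt : ∀ x, μ x x = 0)
    (h : ∀ x y, LinearIndependent k ![x, y, μ x y] →
      (∀ v, ∃ c e : k, μ x v = c • μ x y + e • x) ∧ ∃ e : k, μ x (μ x y) = e • x)
    {x y : Fin n → k} (hxy : LinearIndependent k ![x, y, μ x y]) :
    IsT 0 0 0 μ ∨ ∃ u v, LinearIndependent k ![x, y, u, v, μ x y] ∧ μ u v = μ x y ∧
      μ x u = 0 ∧ μ x v = 0 ∧ μ y u = 0 ∧ μ y v = 0 := by
  have hneg := neg_of_alternating halt
  have hL := linearIndependent_triple_iff.mp hxy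
  obtain ⟨z, hz⟩ : ∃ z, z = μ x y := ⟨_, rfl⟩
  simp only [← hz] at hL hxy ⊢
  have hz0 : z ≠ 0 := hxy.ne_zero 2
  have hyx : μ y x = -z := by rw [hneg x y, hz]
  have key : ∀ {p q : Fin n → k}, LinearIndependent k ![p, q, μ p q] →
      ∀ v, ∃ c e : k, μ p v = c • μ p q + e • p := fun hpq => (h _ _ hpq).1
  have hx := key (hz ▸ hxy)
  have hLyx : LinearIndependent k ![y, x, μ y x] := by
    rw [linearIndependent_triple_iff, hyx]
    intro a b c h0
    obtain ⟨h1, h2, h3⟩ := hL b a (-c) (by rw [← h0]; module)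
    exact ⟨h2, h1, by simpa using h3⟩
  have hy := key hLyx
  have hLs : LinearIndependent k ![x + y, y, μ (x + y) y] := by
    rw [linearIndependent_triple_iff, map_add, LinearMap.add_apply, halt, ← hz, add_zero]
    intro a b c h0
    obtain ⟨h1, h2, h3⟩ := hL a (a + b) c (by rw [← h0]; module)
    exact ⟨h1, by simpa [h1] using h2, h3⟩
  have hs := key hLs
  rw [hyx] at hy
  rw [map_add, LinearMap.add_apply, halt, ← hz, add_zero] at hs
  rw [← hz] at hx
  have hα : ∀ w, ∃ α c c' : k, μ x w = α • x + c • z ∧ μ y w = α • y + c' • z := fun w => by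
    obtain ⟨c, e, h1⟩ := hx w
    obtain ⟨c', e', h2⟩ := hy w
    obtain ⟨c'', e'', h3⟩ := hs w
    rw [LinearMap.add_apply, h1, h2] at h3
    obtain ⟨h4, h5, -⟩ := hL (e - e'') (e' - e'') (c - c' - c'') (by
      rw [← sub_eq_zero] at h3
      rw [← h3]
      module)
    refine ⟨e, c, -c', by rw [h1, add_comm], ?_⟩
    rw [h2, sub_eq_zero.mp h4, sub_eq_zero.mp h5]
    module
  obtain ⟨α, hαz, hαz'⟩ : ∃ α : k, μ x z = α • x ∧ μ y z = α • y := by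
    obtain ⟨α, c, c', h1, h2⟩ := hα z
    obtain ⟨e, h3⟩ := (h x y (hz ▸ hxy)).2
    obtain ⟨e', h4⟩ := (h y x hLyx).2
    rw [← hz, h1] at h3
    rw [hyx, map_neg, h2] at h4
    have h5 := (hL (α - e) 0 c (by rw [← sub_eq_zero] at h3; rw [← h3]; module)).2.2
    have h6 := (hL 0 (α + e') c' (by rw [← sub_eq_zero, ← neg_eq_zero] at h4; rw [← h4]; module)).2.2
    exact ⟨α, by simpa [h5] using h1, by simpa [h6] using h2⟩
  have hα0 : α = 0 := by
    have hp : LinearIndependent k ![z + y, x, μ (z + y) x] := by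
      rw [linearIndependent_triple_iff, map_add, LinearMap.add_apply, hyx, hneg x z, hαz]
      intro a b c h0
      obtain ⟨h1, h2, h3⟩ := hL (b - c * α) a (a - c) (by rw [← h0]; module)
      subst h2
      have hc : c = 0 := by simpa using h3
      exact ⟨rfl, by simpa [hc] using h1, hc⟩
    obtain ⟨c, e, h1⟩ := key hp y
    simp only [map_add, LinearMap.add_apply, hyx, hneg x z, hneg y z, hαz, hαz', halt] at h1
    obtain ⟨h2, h3, h4⟩ := hL (c * α) (-α - e) (c - e) (by
      rw [← sub_eq_zero] at h1
      rw [← h1]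
      module)
    rcases mul_eq_zero.mp h2 with h | h
    · rw [h, zero_sub, neg_eq_zero] at h4
      simpa [h4] using h3
    · exact h
  rw [hα0, zero_smul] at hαz hαz'
  have hzx : μ z x = 0 := by rw [hneg x z, hαz, neg_zero]
  have hzy : μ z y = 0 := by rw [hneg y z, hαz', neg_zero]
  have hC' : ∀ {w} {a : k}, μ x w = a • x → μ y w = a • y → a = 0 := fun {w a} h1 h2 => by
    have hwx : μ w x = -(a • x) := by rw [hneg x w, h1]
    have hwy : μ w y = -(a • y) := by rw [hneg y w, h2]
    rcases mem_span_triple_or hxy (w := w) with ⟨r, s, t, rfl⟩ | hw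
    · simp only [map_add, map_smul, halt, ← hz, hαz, smul_zero, zero_add, add_zero] at h1
      simpa using (hL a 0 (-s) (by rw [← sub_eq_zero.mpr h1.symm]; module)).1
    have hp : LinearIndependent k ![w + y, x, μ (w + y) x] := by
      rw [linearIndependent_triple_iff, map_add, LinearMap.add_apply, hyx, hwx]
      intro a' b c h0
      obtain ⟨h1, h2, -, h3⟩ := hw a' (b - c * a) a' (-c) (by rw [← h0]; module)
      have hc : c = 0 := by simpa using h3
      exact ⟨h1, by simpa [hc] using h2, hc⟩
    obtain ⟨c, e, h3⟩ := key hp y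
    simp only [map_add, LinearMap.add_apply, hyx, hwx, hwy, halt] at h3
    obtain ⟨h4, -, h5, -⟩ := hw e (-(c * a)) (e + a) (-c) (by
      rw [← sub_eq_zero.mpr h3.symm]
      module)
    simpa [h4] using h5
  have hγ : ∀ w, ∃ c c' : k, μ x w = c • z ∧ μ y w = c' • z := fun w => by
    obtain ⟨a, c, c', h1, h2⟩ := hα w
    have ha := hC' (w := w - c • y + c' • x) (a := a)
      (by simp only [map_add, map_sub, map_smul, h1, halt, ← hz]; module)
      (by simp only [map_add, map_sub, map_smul, h2, halt, hyx]; module)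
    exact ⟨c, c', by simpa [ha] using h1, by simpa [ha] using h2⟩
  have hspan : ∀ {r s t : k}, μ x (r • x + s • y + t • z) = 0 → μ y (r • x + s • y + t • z) = 0 →
      r = 0 ∧ s = 0 := fun {r s t} h1 h2 => by
    simp only [map_add, map_smul, halt, ← hz, hyx, hαz, hαz', smul_zero, zero_add, add_zero,
      smul_neg, neg_eq_zero, smul_eq_zero, hz0, or_false] at h1 h2
    exact ⟨h2, h1⟩
  -- the pair `(w, v)` is annihilated by `x` and `y`
  have hline : ∀ {w v}, (∀ a b c d : k, a • w + (b • x + c • y + d • z) = 0 →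
      a = 0 ∧ b = 0 ∧ c = 0 ∧ d = 0) → μ x w = 0 → μ y w = 0 → μ x v = 0 → μ y v = 0 →
      ∃ c : k, μ w v = c • z := fun {w v} hw xw yw xv yv => by
    have hp : LinearIndependent k ![x + w, y, μ (x + w) y] := by
      rw [linearIndependent_triple_iff, map_add, LinearMap.add_apply, ← hz, hneg y w, yw, neg_zero,
        add_zero]
      intro a b c h0
      exact (hw a a b c (by rw [← h0]; module)).2
    have hq : LinearIndependent k ![y + w, x, μ (y + w) x] := by
      rw [linearIndependent_triple_iff, map_add, LinearMap.add_apply, hyx, hneg x w, xw, neg_zero,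
        add_zero]
      intro a b c h0
      obtain ⟨h1, h2, -, h4⟩ := hw a b a (-c) (by rw [← h0]; module)
      exact ⟨h1, h2, by simpa using h4⟩
    obtain ⟨c, e, h1⟩ := key hp v
    obtain ⟨c', e', h2⟩ := key hq v
    simp only [map_add, LinearMap.add_apply, ← hz, hneg y w, yw, xv, neg_zero, zero_add,
      add_zero] at h1
    simp only [map_add, LinearMap.add_apply, hyx, hneg x w, xw, yv, neg_zero, zero_add,
      add_zero] at h2
    obtain ⟨-, h3, -⟩ := hw (e - e') e (-e') (c + c') (by
      rw [← sub_eq_zero.mpr (h1.symm.trans h2)]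
      module)
    exact ⟨c, by simpa [h3] using h1⟩
  have hzC : ∀ {w}, μ x w = 0 → μ y w = 0 → μ z w = 0 := fun {w} xw yw => by
    rcases mem_span_triple_or hxy (w := w) with ⟨r, s, t, rfl⟩ | hw
    · obtain ⟨rfl, rfl⟩ := hspan xw yw
      simp [halt]
    obtain ⟨c, hc⟩ := hline hw xw yw hαz hαz'
    have hp : LinearIndependent k ![x + w, y, μ (x + w) y] := by
      rw [linearIndependent_triple_iff, map_add, LinearMap.add_apply, ← hz, hneg y w, yw, neg_zero,
        add_zero]
      intro a b c h0
      exact (hw a a b c (by rw [← h0]; module)).2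
    obtain ⟨e, h1⟩ := (h _ _ hp).2
    simp only [map_add, LinearMap.add_apply, ← hz, hneg y w, yw, hαz, neg_zero, zero_add,
      add_zero, hc] at h1
    obtain ⟨-, -, -, h2⟩ := hw (-e) (-e) 0 c (by
      rw [← sub_eq_zero.mpr h1]
      module)
    rw [hneg w z, hc, h2, zero_smul, neg_zero]
  have hCC : ∀ {w v}, μ x w = 0 → μ y w = 0 → μ x v = 0 → μ y v = 0 →
      ∃ c : k, μ w v = c • z := fun {w v} xw yw xv yv => by
    rcases mem_span_triple_or hxy (w := w) with ⟨r, s, t, rfl⟩ | hw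
    · obtain ⟨rfl, rfl⟩ := hspan xw yw
      exact ⟨0, by simp [hzC xv yv]⟩
    · exact hline hw xw yw xv yv
  by_cases hφ : ∀ w v, μ x w = 0 → μ y w = 0 → μ x v = 0 → μ y v = 0 → μ w v = 0
  · left
    obtain ⟨g, hg⟩ := exists_dual_ne_zero hz0
    set γ := g ∘ₗ μ x with hγd
    set γ' := g ∘ₗ μ y with hγd'
    have h1 : ∀ w, μ x w = γ w • z := fun w => by
      obtain ⟨c, -, hc, -⟩ := hγ w
      simp [hγd, hc, hg]
    have h2 : ∀ w, μ y w = γ' w • z := fun w => by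
      obtain ⟨-, c, -, hc⟩ := hγ w
      simp [hγd', hc, hg]
    have h1x : γ x = 0 := by simp [hγd, halt]
    have h1y : γ y = 1 := by simp [hγd, ← hz, hg]
    have h1z : γ z = 0 := by simp [hγd, hαz]
    have h2x : γ' x = -1 := by simp [hγd', hyx, hg]
    have h2y : γ' y = 0 := by simp [hγd', halt]
    have h2z : γ' z = 0 := by simp [hγd', hαz']
    refine IsT.zero_iff.mpr ⟨-γ', γ, x, y, z, by simp [h2x], by simp [h2y], by simp [h2z],
      h1x, h1y, h1z, hz0, fun a b => ?_⟩
    have hxC : ∀ w, μ x (w - γ w • y + γ' w • x) = 0 := fun w => by simp [h1, h1x, h1y]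
    have hyC : ∀ w, μ y (w - γ w • y + γ' w • x) = 0 := fun w => by simp [h2, h2x, h2y]
    have h0 := hφ _ _ (hxC a) (hyC a) (hxC b) (hyC b)
    simp only [map_add, map_sub, map_smul, LinearMap.add_apply, LinearMap.sub_apply,
      LinearMap.smul_apply, h1, h2, hneg x a, hneg y a, h1x, h1y, h2x, h2y] at h0
    rw [← sub_eq_zero, ← h0]
    simp only [LinearMap.neg_apply]
    module
  · right
    push Not at hφ
    obtain ⟨w, v, xw, yw, xv, yv, hwv⟩ := hφ
    obtain ⟨c, hc⟩ := hCC xw yw xv yv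
    have hc0 : c ≠ 0 := by
      rintro rfl
      exact hwv (by simpa using hc)
    have hu : μ (c⁻¹ • w) v = z := by simp [hc, hc0]
    have hu' : μ v (c⁻¹ • w) = -z := by rw [hneg, hu]
    have xu : μ x (c⁻¹ • w) = 0 := by simp [xw]
    have yu : μ y (c⁻¹ • w) = 0 := by simp [yw]
    refine ⟨c⁻¹ • w, v, ?_, hu, xu, xv, yu, yv⟩
    generalize c⁻¹ • w = u at *
    have hzu := hzC xu yu
    have hzv := hzC xv yv
    rw [Fintype.linearIndependent_iff]
    intro g hg
    simp only [Fin.sum_univ_five, Matrix.cons_val_zero, Matrix.cons_val_one,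
      Matrix.cons_val] at hg
    have g1 : g 1 = 0 := by
      have := congrArg (μ x) hg
      simpa [halt, ← hz, xu, xv, hαz, hz0] using this
    have g0 : g 0 = 0 := by
      have := congrArg (μ y) hg
      simpa [halt, hyx, yu, yv, hαz', hz0] using this
    have g3 : g 3 = 0 := by
      have := congrArg (μ u) hg
      simpa [halt, g0, g1, hu, hneg z u, hzu, hz0] using this
    have g2 : g 2 = 0 := by
      have := congrArg (μ v) hg
      simpa [halt, g0, g1, hu', hneg z v, hzv, hz0] using this
    have g4 : g 4 = 0 := by simpa [g0, g1, g2, g3, hz0] using hg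
    intro i
    fin_cases i <;> assumption

end Alternating

section Classification

variable {n : ℕ} {μ χ : AlgStr k n} {f : (Fin n → k) →ₗ[k] k}

lemma IsT.rescale {ε β δ : k} (hε : ε ≠ 0) (hμ : IsT ε β δ μ) : IsT 1 (ε⁻¹ * β) (ε⁻¹ * δ) μ := by
  obtain ⟨h, ψ, x, y, z, hx, hy, hz, px, py, pz, z0, hμ⟩ := hμ
  refine ⟨ε • h, ψ, ε⁻¹ • x, y, ε⁻¹ • z, by simp [hx, hε], by simp [hy], by simp [hz], by simp [px],
    py, by simp [pz], by simp [hε, z0], fun a b => ?_⟩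
  have h1 : ε⁻¹ * β * (ε * h a) = β * h a := by field_simp
  have h2 : (1 - ε⁻¹ * β) * (ε * h b) = (ε - β) * h b := by field_simp
  have h3 : (ε * h a * ψ b - ε * h b * ψ a) • ((ε⁻¹ * δ) • y + ε⁻¹ • z) =
      (h a * ψ b - h b * ψ a) • (δ • y + z) := by
    rw [mul_smul, ← smul_add, smul_smul]
    congr 1
    field_simp
  simp only [hμ, LinearMap.smul_apply, smul_eq_mul, h1, h2, h3]

lemma exists_linearIndependent_of_ne_zero [Infinite k] (hf0 : f ≠ 0) {x y : Fin n → k}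
    (hxy : LinearIndependent k ![x, y, μ x y]) :
    ∃ x, f x ≠ 0 ∧ LinearIndependent k ![x, y, μ x y] := by
  by_cases hx : f x ≠ 0
  · exact ⟨x, hx, hxy⟩
  rw [not_not] at hx
  obtain ⟨w, hw⟩ := exists_eq_one hf0
  obtain ⟨θ, hθ⟩ := exists_dual_family hxy
  have h0 : ∀ i, θ i x = if i = 0 then 1 else 0 := fun i => hθ i 0
  have h1 : ∀ i, θ i y = if i = 1 then 1 else 0 := fun i => hθ i 1
  have h2 : ∀ i, θ i (μ x y) = if i = 2 then 1 else 0 := fun i => hθ i 2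
  by_contra! hcon
  have key : ∀ t : k, t ≠ 0 → (1 + t * θ 0 w) * (1 + t * θ 2 (μ w y)) -
      t * θ 2 w * (t * θ 0 (μ w y)) = 0 := fun t ht => by
    have := det_eq_zero_of_dependent (hcon (x + t • w) (by simp [hx, hw, ht])) θ
    rw [Matrix.det_fin_three] at this
    simpa [h0, h1, h2] using this
  open Polynomial in
  have hP : (X * ((1 + X * C (θ 0 w)) * (1 + X * C (θ 2 (μ w y))) -
      X * C (θ 2 w) * (X * C (θ 0 (μ w y)))) : k[X]) = 0 := by
    refine Polynomial.funext fun t => ?_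
    by_cases ht : t = 0
    · simp [ht]
    · simp [-mul_eq_zero, Polynomial.eval_mul]
      linear_combination t * key t ht
  have := congrArg (Polynomial.eval 0) ((mul_eq_zero.mp hP).resolve_left Polynomial.X_ne_zero)
  simp at this

lemma exists_isLevelTwo [IsAlgClosed k] (hf : ∀ x, μ x x = f x • x) {x y : Fin n → k}
    (hxy : LinearIndependent k ![x, y, μ x y]) (hμ : ¬ IsT 0 0 0 μ) :
    ∃ χ, IsLevelTwo χ ∧ degenerates μ χ := by
  have hn : 3 ≤ n := by simpa using hxy.fintype_card_le_finrank
  by_cases h5 : ∃ x u v, LinearIndependent k ![x, u, v, μ x u, μ x v]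
  · obtain ⟨x, u, v, h⟩ := h5
    obtain ⟨χ, hχ, hd⟩ := exists_is22_of_linearIndependent hf h
    exact ⟨χ, Or.inr <| Or.inr <| Or.inr <| Or.inl hχ, hd⟩
  by_cases h4 : n = 4 ∧ ∃ x u, LinearIndependent k ![x, u, μ x u, μ x (μ x u)]
  · obtain ⟨hn4, x, u, h⟩ := h4
    obtain ⟨χ, hχ, hd⟩ := exists_is03_of_linearIndependent hn4 hf h
    exact ⟨χ, Or.inr <| Or.inr <| Or.inl ⟨hn4, hχ⟩, hd⟩
  push Not at h4 h5
  have hT : ∀ {x y : Fin n → k}, LinearIndependent k ![x, y, μ x y] →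
      ∃ (β : k) (z : Fin n → k) (δ : k) (χ : AlgStr k n),
        (∀ v, ∃ c e : k, μ x v = β • v + c • z + e • x) ∧ IsT (f x) β δ χ ∧ degenerates μ χ ∧
          (δ = 0 → ∃ e : k, μ x z = β • z + e • x) := fun {x y} h => by
    obtain ⟨β, z, hz⟩ := exists_rank_one_mod hf (h.ne_zero 0) (by
      rcases (by omega : n = 3 ∨ n = 4 ∨ 5 ≤ n) with h | h | h
      · exact Or.inl h
      · exact Or.inr <| Or.inl ⟨h, h4 h _⟩
      · exact Or.inr <| Or.inr ⟨h, h5 _⟩)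
    obtain ⟨δ, χ, h'⟩ := exists_isT_of_rank_one hn hf h hz
    exact ⟨β, z, δ, χ, hz, h'⟩
  by_cases hf0 : f = 0
  · subst hf0
    by_contra! hcon
    have halt : ∀ x, μ x x = 0 := fun x => by simpa using hf x
    have hrank : ∀ x y, LinearIndependent k ![x, y, μ x y] →
        (∀ v, ∃ c e : k, μ x v = c • μ x y + e • x) ∧ ∃ e : k, μ x (μ x y) = e • x := by
      intro x y h
      obtain ⟨β, z, δ, χ, hz, hχ, hd, hδ⟩ := hT h
      have hβδ : ¬ (β ≠ 0 ∨ δ ≠ 0) := fun h0 => hcon χ (Or.inl ⟨β, δ, h0, hχ⟩) hd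
      push Not at hβδ
      obtain ⟨rfl, rfl⟩ := hβδ
      obtain ⟨e, he⟩ := hδ rfl
      obtain ⟨c₀, e₀, h0⟩ := hz y
      simp only [zero_smul, zero_add] at hz he h0
      have hc₀ : c₀ ≠ 0 := by
        rintro rfl
        have := (linearIndependent_triple_iff.mp h (-e₀) 0 1 (by rw [h0]; module)).2.2
        exact one_ne_zero this
      refine ⟨fun v => ?_, c₀ * e, ?_⟩
      · obtain ⟨c, e', h1⟩ := hz v
        refine ⟨c * c₀⁻¹, e' - c * c₀⁻¹ * e₀, ?_⟩
        rw [h1, h0]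
        simp only [smul_add, smul_smul, inv_mul_cancel_right₀ hc₀]
        module
      · rw [h0]
        simp [he, halt, smul_smul]
    rcases isT_zero_or_exists_linearIndependent halt hrank hxy with
      h | ⟨u, v, hL, huv, hxu, hxv, hyu, hyv⟩
    · exact hμ h
    · obtain ⟨χ, hχ, hd⟩ := exists_isEta_of_linearIndependent hf hL huv hxu hxv hyu hyv
      exact hcon χ (Or.inr <| Or.inr <| Or.inr <| Or.inr <| Or.inr hχ) hd
  · obtain ⟨x, hx, hxy⟩ := exists_linearIndependent_of_ne_zero hf0 hxy
    obtain ⟨β, z, δ, χ, -, hχ, hd, -⟩ := hT hxy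
    exact ⟨χ, Or.inr <| Or.inl ⟨_, _, hχ.rescale hx⟩, hd⟩

lemma levelIs_two_iff [IsAlgClosed k] (hn : 2 ≤ n) (hG : genType μ 1) :
    levelIs μ 2 ↔ IsLevelTwo μ := by
  refine ⟨fun ⟨h2, h3⟩ => ?_, fun h => h.levelIs hn⟩
  obtain ⟨f, hf⟩ := exists_functional_of_genType hG
  by_cases hspan : ∀ x y, ¬ LinearIndependent k ![x, y, μ x y]
  · obtain ⟨a, b, hab⟩ := exists_of_forall_not_linearIndependent hn hf hspan
    rcases isE_or_isD hab with h | h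
    · exact Or.inr <| Or.inr <| Or.inr <| Or.inr <| Or.inl h
    · exact absurd h2 (IsSmall.not_hasChain_two hn (Or.inl h))
  push Not at hspan
  obtain ⟨x, y, hxy⟩ := hspan
  obtain ⟨χ, hχ, hd⟩ := exists_isLevelTwo hf hxy fun h =>
    IsSmall.not_hasChain_two hn (Or.inr h) h2
  by_contra hμ
  exact h3 (hasChain_three.mpr ⟨χ, ⟨hd, fun h => hμ (hχ.of_mem_orbit (orbit_symm h))⟩,
    (hχ.levelIs hn).1⟩)

lemma IsT.three_le {ε β δ : k} (h : IsT ε β δ μ) : 3 ≤ n := by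
  obtain ⟨h, ψ, x, y, z, hx, hy, hz, px, py, pz, z0, -⟩ := h
  simpa using (linearIndependent_triple hx hy hz py pz z0 0).fintype_card_le_finrank

lemma Is22.five_le (h : Is22 μ) : 5 ≤ n := by
  obtain ⟨h, ψ₁, ψ₂, x, y₁, y₂, z₁, z₂, h1, h2, h3, hz, -⟩ := h
  have : LinearIndependent k ![x, y₁, y₂, z₁, z₂] := by
    rw [Fintype.linearIndependent_iff] at hz ⊢
    intro g hg
    simp only [Fin.sum_univ_five, Matrix.cons_val_zero, Matrix.cons_val_one,
      Matrix.cons_val] at hg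
    have g0 : g 0 = 0 := by simpa [h1] using congrArg h hg
    have g1 : g 1 = 0 := by simpa [h2] using congrArg ψ₁ hg
    have g2 : g 2 = 0 := by simpa [h3] using congrArg ψ₂ hg
    have g34 := hz ![g 3, g 4] (by simpa [g0, g1, g2] using hg)
    intro i
    fin_cases i
    exacts [g0, g1, g2, g34 0, g34 1]
  simpa using this.fintype_card_le_finrank

lemma IsEta.five_le (h : IsEta μ) : 5 ≤ n := by
  obtain ⟨φ, x, z, hφ, hφz, hz, -⟩ := h
  have : LinearIndependent k ![x 0, x 1, x 2, x 3, z] := by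
    rw [Fintype.linearIndependent_iff]
    intro g hg
    simp only [Fin.sum_univ_five, Matrix.cons_val_zero, Matrix.cons_val_one,
      Matrix.cons_val] at hg
    have g0 : g 0 = 0 := by simpa [hφ, hφz] using congrArg (φ 0) hg
    have g1 : g 1 = 0 := by simpa [hφ, hφz] using congrArg (φ 1) hg
    have g2 : g 2 = 0 := by simpa [hφ, hφz] using congrArg (φ 2) hg
    have g3 : g 3 = 0 := by simpa [hφ, hφz] using congrArg (φ 3) hg
    have g4 : g 4 = 0 := by simpa [g0, g1, g2, g3, hz] using hg
    intro i
    fin_cases i <;> assumption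
  simpa using this.fintype_card_le_finrank

lemma exists_mem_orbit_T02str (hn : 3 ≤ n) :
    (∃ α β : k, (α, β) ≠ (0, 0) ∧ μ ∈ orbit (T02str n α β)) ↔
      ∃ β δ : k, (β ≠ 0 ∨ δ ≠ 0) ∧ IsT 0 β δ μ := by
  simp only [mem_orbit_T02str hn]
  constructor
  · rintro ⟨α, β, h, hT⟩
    refine ⟨β, α - β, ?_, hT⟩
    by_contra! h0
    exact h (by simpa [h0.1] using h0.2)
  · rintro ⟨β, δ, h, hT⟩
    refine ⟨β + δ, β, fun h0 => ?_, by simpa using hT⟩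
    rw [Prod.mk.injEq] at h0
    simp [h0.2] at h0 h
    exact h h0

lemma exists_mem_orbit_T12str (hn : 3 ≤ n) :
    (∃ α β : k, μ ∈ orbit (T12str n α β)) ↔ ∃ β δ : k, IsT 1 β δ μ := by
  simp only [mem_orbit_T12str hn]
  exact ⟨fun ⟨_, _, h⟩ => ⟨_, _, h⟩, fun ⟨β, δ, h⟩ => ⟨β + δ, β, by simpa using h⟩⟩

end Classification

/-! ## STATEMENT 11 -/
theorem stmt11 {k : Type*} [Field k] [IsAlgClosed k] (n : ℕ) (μ : AlgStr k n)
    (hG : genType μ 1) :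
    (n = 2 → (levelIs μ 2 ↔ μ ∈ orbit (kE4str n))) ∧
    (n = 3 → (levelIs μ 2 ↔
      ((∃ α β : k, (α, β) ≠ (0, 0) ∧ μ ∈ orbit (T02str n α β)) ∨
        (∃ α β : k, μ ∈ orbit (T12str n α β)) ∨ μ ∈ orbit (kE4str n)))) ∧
    (n = 4 → (levelIs μ 2 ↔
      ((∃ α β : k, (α, β) ≠ (0, 0) ∧ μ ∈ orbit (T02str n α β)) ∨
        (∃ α β : k, μ ∈ orbit (T12str n α β)) ∨ μ ∈ orbit (T03str n) ∨
        μ ∈ orbit (kE4str n)))) ∧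
    (5 ≤ n → (levelIs μ 2 ↔
      ((∃ α β : k, (α, β) ≠ (0, 0) ∧ μ ∈ orbit (T02str n α β)) ∨
        (∃ α β : k, μ ∈ orbit (T12str n α β)) ∨ μ ∈ orbit (T022str n) ∨
        μ ∈ orbit (kE4str n) ∨ μ ∈ orbit (etaStr n 2)))) := by
  have hT : n < 3 → ∀ ε β δ : k, ¬ IsT ε β δ μ := fun hn ε β δ h => by
    have := h.three_le
    omega
  have h22 : n < 5 → ¬ Is22 μ := fun hn h => by
    have := h.five_le
    omega
  have hEta : n < 5 → ¬ IsEta μ := fun hn h => by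
    have := h.five_le
    omega
  refine ⟨fun hn => ?_, fun hn => ?_, fun hn => ?_, fun hn => ?_⟩
  · rw [levelIs_two_iff (by omega) hG, mem_orbit_kE4str (by omega), IsLevelTwo]
    simp [hT (by omega), h22 (by omega), hEta (by omega), hn]
  · rw [levelIs_two_iff (by omega) hG, mem_orbit_kE4str (by omega),
      exists_mem_orbit_T02str (by omega), exists_mem_orbit_T12str (by omega), IsLevelTwo]
    simp [h22 (by omega), hEta (by omega), hn]
  · rw [levelIs_two_iff (by omega) hG, mem_orbit_kE4str (by omega), mem_orbit_T03str (by omega),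
      exists_mem_orbit_T02str (by omega), exists_mem_orbit_T12str (by omega), IsLevelTwo]
    simp only [h22 (by omega), hEta (by omega), hn, true_and, false_or, or_false]
  · rw [levelIs_two_iff (by omega) hG, mem_orbit_kE4str (by omega), mem_orbit_T022str hn,
      mem_orbit_etaStr hn, exists_mem_orbit_T02str (by omega),
      exists_mem_orbit_T12str (by omega), IsLevelTwo]
    simp only [show n ≠ 4 by omega, false_and, false_or]

end
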